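/- Let k be a perfect field of characteristic p > 0 and let (R, I) be a standard graded pair over k such that R is a two-dimensional domain, with graded maximal ideal 𝔪. Then the F-threshold c^I(𝔪) = lim_{n→∞} (1/p^n)·min{r ∈ ℕ : 𝔪^{r+1} ⊆ I^{[p^n]}} exists and is a rational number. -/

import Mathlib

/-!
STATEMENT 0: For a standard graded pair `(R, I)` over a perfect field `k` of
characteristic `p > 0`, with `R` a two-dimensional domain and graded maximal ideal `𝔪`,
the `F`-threshold `c^I(𝔪) = lim_{n→∞} (1/p^n)·min{r : 𝔪^{r+1} ⊆ I^{[p^n]}}`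
exists and is a rational number.
-/

open Filter Topology

/-- The Frobenius power `I^{[q]}` of an ideal `I`, generated by the `q`-th powers of the
elements of `I`. -/
def Ideal.frobPow {R : Type*} [CommRing R] (I : Ideal R) (q : ℕ) : Ideal R :=
  Ideal.span ((fun f => f ^ q) '' (I : Set R))

/-- `ν_I(J, q) = min { r ∈ ℕ | J^{r+1} ⊆ I^{[q]} }`. -/
noncomputable def nuF {R : Type*} [CommRing R] (J I : Ideal R) (q : ℕ) : ℕ :=
  sInf {r : ℕ | J ^ (r + 1) ≤ I.frobPow q}

/-- The graded maximal (irrelevant) ideal `𝔪 = ⊕_{m>0} R_m` of an `ℕ`-graded algebra. -/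
def irrelevantIdeal {k R : Type*} [CommSemiring k] [CommRing R] [Algebra k R]
    (𝒜 : ℕ → Submodule k R) : Ideal R :=
  Ideal.span (⋃ n ∈ Set.Ioi (0 : ℕ), (𝒜 n : Set R))


section part1
set_option linter.all false
open scoped nonZeroDivisors

namespace FThr

section Ind

variable {k : Type*} [Field k] {V V' V'' : Type*} [AddCommGroup V] [Module k V]
  [AddCommGroup V'] [Module k V'] [AddCommGroup V''] [Module k V'']

/-- The index `dim_k Y/(X ∩ Y)`. -/
noncomputable def ind (X Y : Submodule k V) : ℕ∞ := Module.length k (Y ⧸ X.comap Y.subtype)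

lemma ind_eq_length_range (X Y : Submodule k V) :
    ind X Y = Module.length k (LinearMap.range (X.mkQ.comp Y.subtype)) := by
  have hker : LinearMap.ker (X.mkQ.comp Y.subtype) = X.comap Y.subtype := by
    rw [LinearMap.ker_comp, Submodule.ker_mkQ]
  rw [ind, ← hker]
  exact (LinearMap.quotKerEquivRange _).length_eq

lemma length_range_le {p : Submodule k V} (g : V →ₗ[k] V') (h : p ≤ LinearMap.ker g) :
    Module.length k (LinearMap.range g) ≤ Module.length k (V ⧸ p) := by
  refine Module.length_le_of_surjective (p.liftQ g.rangeRestrict (by simpa using h)) ?_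
  rw [← LinearMap.range_eq_top, Submodule.range_liftQ, LinearMap.range_rangeRestrict]

/-- surjection principle -/
lemma ind_le_of_surj {X Y : Submodule k V} {X' Y' : Submodule k V'} (f : V →ₗ[k] V')
    (h1 : ∀ x ∈ X, x ∈ Y → f x ∈ X') (h2 : ∀ y' ∈ Y', ∃ y ∈ Y, y' - f y ∈ X') :
    ind X' Y' ≤ ind X Y := by
  rw [ind_eq_length_range X' Y']
  set g : Y →ₗ[k] (V' ⧸ X') := (X'.mkQ.comp f).comp Y.subtype with hg
  have hle : LinearMap.range (X'.mkQ.comp Y'.subtype) ≤ LinearMap.range g := by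
    rintro _ ⟨y', rfl⟩
    obtain ⟨y, hy, h⟩ := h2 y' y'.2
    refine ⟨⟨y, hy⟩, ?_⟩
    simp only [hg, LinearMap.comp_apply, Submodule.subtype_apply, Submodule.mkQ_apply]
    rw [eq_comm, Submodule.Quotient.eq]; exact h
  have h3 : Module.length k (LinearMap.range (X'.mkQ.comp Y'.subtype)) ≤
      Module.length k (LinearMap.range g) :=
    Module.length_le_of_injective (Submodule.inclusion hle) (Submodule.inclusion_injective hle)
  refine h3.trans (length_range_le g ?_)
  intro x hx
  rw [LinearMap.mem_ker]
  simp only [hg, LinearMap.comp_apply, Submodule.subtype_apply, Submodule.mkQ_apply]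
  rw [Submodule.Quotient.mk_eq_zero]
  exact h1 _ hx x.2

/-- injection principle -/
lemma ind_le_of_inj {X Y : Submodule k V} {X' Y' : Submodule k V'} (f : V →ₗ[k] V')
    (h1 : ∀ y ∈ Y, f y ∈ X' → y ∈ X) (h2 : ∀ y ∈ Y, f y ∈ Y') :
    ind X Y ≤ ind X' Y' := by
  rw [ind_eq_length_range X' Y']
  set g : Y →ₗ[k] (V' ⧸ X') := (X'.mkQ.comp f).comp Y.subtype with hg
  have hle : LinearMap.range g ≤ LinearMap.range (X'.mkQ.comp Y'.subtype) := by
    rintro _ ⟨y, rfl⟩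
    exact ⟨⟨f y, h2 y y.2⟩, rfl⟩
  have h3 : Module.length k (LinearMap.range g) ≤
      Module.length k (LinearMap.range (X'.mkQ.comp Y'.subtype)) :=
    Module.length_le_of_injective (Submodule.inclusion hle) (Submodule.inclusion_injective hle)
  refine le_trans ?_ h3
  rw [← (LinearMap.quotKerEquivRange g).length_eq, ind]
  have hk : LinearMap.ker g ≤ X.comap Y.subtype := by
    intro x hx
    rw [LinearMap.mem_ker] at hx
    simp only [hg, LinearMap.comp_apply, Submodule.subtype_apply, Submodule.mkQ_apply] at hx
    rw [Submodule.Quotient.mk_eq_zero] at hx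
    exact h1 _ x.2 hx
  exact Module.length_le_of_surjective (Submodule.factor hk) (Submodule.factor_surjective hk)

lemma ind_mono {X X' Y Y' : Submodule k V} (h : X' ≤ X) (h' : Y ≤ Y') : ind X Y ≤ ind X' Y' :=
  ind_le_of_inj LinearMap.id (fun _ _ hx => h hx) (fun _ hy => h' hy)

lemma ind_prod (A X : Submodule k V') (A' X' : Submodule k V'') :
    ind (A.prod A') (X.prod X') = ind A X + ind A' X' := by
  rw [ind, ind, ind, ← Module.length_prod]
  let f1 : (X.prod X') →ₗ[k] X := LinearMap.codRestrict X
    ((LinearMap.fst k V' V'').comp (X.prod X').subtype) (fun x => x.2.1)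
  let f2 : (X.prod X') →ₗ[k] X' := LinearMap.codRestrict X'
    ((LinearMap.snd k V' V'').comp (X.prod X').subtype) (fun x => x.2.2)
  have e1 : ∀ x, (f1 x : V') = (x : V' × V'').1 := fun x => rfl
  have e2 : ∀ x, (f2 x : V'') = (x : V' × V'').2 := fun x => rfl
  let g : (X.prod X') →ₗ[k] (X ⧸ A.comap X.subtype) × (X' ⧸ A'.comap X'.subtype) :=
    ((Submodule.mkQ _).comp f1).prod ((Submodule.mkQ _).comp f2)
  have hk : LinearMap.ker g = (A.prod A').comap (X.prod X').subtype := by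
    ext x
    rw [LinearMap.mem_ker, Submodule.mem_comap, Submodule.mem_prod]
    simp only [g, LinearMap.prod_apply, Function.prod_apply, LinearMap.comp_apply, Submodule.mkQ_apply,
      Prod.mk_eq_zero, Submodule.Quotient.mk_eq_zero, Submodule.mem_comap,
      Submodule.subtype_apply, e1, e2]
  have hs : Function.Surjective g := by
    rintro ⟨x, x'⟩
    obtain ⟨x, rfl⟩ := Submodule.Quotient.mk_surjective _ x
    obtain ⟨x', rfl⟩ := Submodule.Quotient.mk_surjective _ x'
    exact ⟨⟨(x, x'), ⟨x.2, x'.2⟩⟩, rfl⟩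
  rw [← hk]
  exact (LinearMap.quotKerEquivOfSurjective g hs).length_eq

lemma ind_le_add_of_inj {Z Y : Submodule k V} {A X : Submodule k V'} {A' X' : Submodule k V''}
    (f : V →ₗ[k] V') (f' : V →ₗ[k] V'')
    (h0 : ∀ y ∈ Y, f y ∈ A → f' y ∈ A' → y ∈ Z)
    (h1 : ∀ y ∈ Y, f y ∈ X) (h2 : ∀ y ∈ Y, f' y ∈ X') :
    ind Z Y ≤ ind A X + ind A' X' := by
  rw [← ind_prod]
  refine ind_le_of_inj (f.prod f') ?_ ?_
  · intro y hy h
    exact h0 y hy h.1 h.2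
  · intro y hy
    exact ⟨h1 y hy, h2 y hy⟩

lemma add_le_ind_of_surj {Z Y : Submodule k V} {A X : Submodule k V'} {A' X' : Submodule k V''}
    (f : V →ₗ[k] V') (f' : V →ₗ[k] V'')
    (h0 : ∀ y ∈ Z, y ∈ Y → f y ∈ A ∧ f' y ∈ A')
    (h1 : ∀ x ∈ X, ∀ x' ∈ X', ∃ y ∈ Y, x - f y ∈ A ∧ x' - f' y ∈ A') :
    ind A X + ind A' X' ≤ ind Z Y := by
  rw [← ind_prod]
  refine ind_le_of_surj (f.prod f') ?_ ?_
  · intro y hy h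
    exact h0 y hy h
  · rintro ⟨x, x'⟩ ⟨hx, hx'⟩
    obtain ⟨y, hy, h, h'⟩ := h1 x hx x' hx'
    exact ⟨y, hy, h, h'⟩

lemma ind_inf_le (A X A' X' : Submodule k V) :
    ind (A ⊓ A') (X ⊓ X') ≤ ind A X + ind A' X' :=
  ind_le_add_of_inj LinearMap.id LinearMap.id (fun _ _ h h' => ⟨h, h'⟩) (fun _ h => h.1)
    (fun _ h => h.2)

lemma le_ind_inf {A X A' X' : Submodule k V} (hA : A ≤ X) (hA' : A' ≤ X')
    (h : ∀ w : V, ∃ a ∈ A, ∃ a' ∈ A', w = a + a') :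
    ind A X + ind A' X' ≤ ind (A ⊓ A') (X ⊓ X') := by
  refine add_le_ind_of_surj LinearMap.id LinearMap.id (fun _ h _ => ⟨h.1, h.2⟩) ?_
  intro x hx x' hx'
  obtain ⟨a, ha, a', ha', e⟩ := h (x - x')
  have e2 : x - a = x' + a' := by
    rw [sub_eq_iff_eq_add] at e ⊢; rw [e]; abel
  refine ⟨x - a, ⟨X.sub_mem hx (hA ha), ?_⟩, ?_, ?_⟩
  · rw [e2]; exact X'.add_mem hx' (hA' ha')
  · simpa using ha
  · simp only [LinearMap.id_apply]; rw [e2]; simpa using ha'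

lemma ind_chain {X Y Z : Submodule k V} (h : X ≤ Y) (h' : Y ≤ Z) :
    ind X Y + ind Y Z = ind X Z := by
  let f : (Y ⧸ X.comap Y.subtype) →ₗ[k] (Z ⧸ X.comap Z.subtype) :=
    Submodule.mapQ _ _ (Submodule.inclusion h') (fun x hx => hx)
  let g : (Z ⧸ X.comap Z.subtype) →ₗ[k] (Z ⧸ Y.comap Z.subtype) :=
    Submodule.mapQ _ _ LinearMap.id (fun x hx => h hx)
  have hf : Function.Injective f := by
    rw [← LinearMap.ker_eq_bot, LinearMap.ker_eq_bot']
    intro x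
    obtain ⟨x, rfl⟩ := Submodule.Quotient.mk_surjective _ x
    intro hx
    change Submodule.Quotient.mk (Submodule.inclusion h' x) = 0 at hx
    rw [Submodule.Quotient.mk_eq_zero] at hx ⊢
    exact hx
  have hg : Function.Surjective g := by
    intro x
    obtain ⟨x, rfl⟩ := Submodule.Quotient.mk_surjective _ x
    exact ⟨Submodule.Quotient.mk x, rfl⟩
  refine (Module.length_eq_add_of_exact f g hf hg ?_).symm
  intro x
  obtain ⟨x, rfl⟩ := Submodule.Quotient.mk_surjective _ x
  constructor
  · intro hx
    change Submodule.Quotient.mk x = 0 at hx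
    rw [Submodule.Quotient.mk_eq_zero] at hx
    exact ⟨Submodule.Quotient.mk ⟨x, hx⟩, rfl⟩
  · rintro ⟨y, hy⟩
    obtain ⟨y, rfl⟩ := Submodule.Quotient.mk_surjective _ y
    rw [← hy]
    change Submodule.Quotient.mk (Submodule.inclusion h' y) = 0
    rw [Submodule.Quotient.mk_eq_zero]
    exact y.2

lemma ind_sup (X Y : Submodule k V) : ind X (X ⊔ Y) = ind X Y := by
  refine le_antisymm ?_ (ind_mono le_rfl le_sup_right)
  refine ind_le_of_surj LinearMap.id (fun x hx _ => hx) ?_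
  intro y hy
  obtain ⟨x, hx, y, hy', rfl⟩ := Submodule.mem_sup.1 hy
  exact ⟨y, hy', by simpa using hx⟩

lemma ind_triangle (X Y Z : Submodule k V) : ind X Z ≤ ind X Y + ind Y Z := by
  have h1 : ind X Z ≤ ind X (X ⊔ Y ⊔ Z) := ind_mono le_rfl le_sup_right
  rw [← ind_chain (Y := X ⊔ Y) le_sup_left le_sup_left, ind_sup, ind_sup] at h1
  exact h1.trans (add_le_add le_rfl (ind_mono le_sup_right le_rfl))

lemma ind_eq_zero_iff {X Y : Submodule k V} : ind X Y = 0 ↔ Y ≤ X := by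
  rw [ind, Module.length_eq_zero_iff, Submodule.Quotient.subsingleton_iff,
    Submodule.comap_subtype_eq_top]

@[simp] lemma ind_self (X : Submodule k V) : ind X X = 0 := ind_eq_zero_iff.2 le_rfl

lemma ind_bot (Y : Submodule k V) : ind ⊥ Y = Module.length k Y := by
  rw [ind]
  have : (⊥ : Submodule k V).comap Y.subtype = ⊥ := by
    simp
  rw [this]
  exact (Submodule.quotEquivOfEqBot _ rfl).length_eq

lemma finite_of_ind_ne_top {Y : Submodule k V} (h : ind ⊥ Y ≠ ⊤) : Module.Finite k Y := by
  rw [ind_bot, Module.length_ne_top_iff, isFiniteLength_iff_isNoetherian_isArtinian] at h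
  haveI := h.1
  infer_instance

lemma ind_ne_top_of_finite {X Y : Submodule k V} [Module.Finite k Y] : ind X Y ≠ ⊤ := by
  rw [ind]; exact Module.length_ne_top

lemma ind_pi {ι : Type*} [Fintype ι] (A X : ι → Submodule k V) :
    ind (Submodule.pi Set.univ A) (Submodule.pi Set.univ X) = ∑ i, ind (A i) (X i) := by
  let f (i : ι) : (Submodule.pi Set.univ X) →ₗ[k] X i :=
    LinearMap.codRestrict (X i) ((LinearMap.proj i).comp (Submodule.pi Set.univ X).subtype)
        (fun x => x.2 i (Set.mem_univ i))
  have e1 : ∀ i x, (f i x : V) = (x : ι → V) i := fun i x => rfl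
  let g : (Submodule.pi Set.univ X) →ₗ[k] (∀ i, X i ⧸ (A i).comap (X i).subtype) :=
    LinearMap.pi fun i => (Submodule.mkQ _).comp (f i)
  have hk : LinearMap.ker g = (Submodule.pi Set.univ A).comap (Submodule.pi Set.univ X).subtype := by
    ext x
    rw [LinearMap.mem_ker, Submodule.mem_comap, Submodule.mem_pi, funext_iff]
    simp only [g, LinearMap.pi_apply, LinearMap.comp_apply,
      Submodule.mkQ_apply, Pi.zero_apply, Submodule.Quotient.mk_eq_zero,
      Submodule.mem_comap, Set.mem_univ, true_imp_iff, Submodule.subtype_apply, e1]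
  have hs : Function.Surjective g := by
    intro y
    choose f hf using fun i => Submodule.Quotient.mk_surjective _ (y i)
    refine ⟨⟨fun i => f i, fun i _ => (f i).2⟩, ?_⟩
    funext i
    rw [← hf i]; rfl
  rw [ind, ← hk, (LinearMap.quotKerEquivOfSurjective g hs).length_eq,
    Module.length_pi_of_fintype]
  rfl

end Ind
end FThr
end part1


section part2
set_option linter.all false
open scoped nonZeroDivisors

namespace FThr

section Lat

variable (k : Type*) {D K : Type*} [Field k] [CommRing D] [Field K] [Algebra k D]
  [Algebra D K] [Algebra k K] [IsScalarTower k D K]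
  {V V' : Type*} [AddCommGroup V] [Module D V] [Module k V] [IsScalarTower k D V]
  [Module K V] [IsScalarTower D K V]
  [AddCommGroup V'] [Module D V'] [Module k V'] [IsScalarTower k D V']
  [Module K V'] [IsScalarTower D K V']

/-- index of lattices -/
noncomputable def indD (N M : Submodule D V) : ℕ∞ :=
  ind (N.restrictScalars k) (M.restrictScalars k)

lemma indD_chain {X Y Z : Submodule D V} (h : X ≤ Y) (h' : Y ≤ Z) :
    indD k X Y + indD k Y Z = indD k X Z := ind_chain h h'

lemma indD_triangle (X Y Z : Submodule D V) : indD k X Z ≤ indD k X Y + indD k Y Z :=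
  ind_triangle _ _ _

lemma indD_mono {X X' Y Y' : Submodule D V} (h : X' ≤ X) (h' : Y ≤ Y') :
    indD k X Y ≤ indD k X' Y' := ind_mono h h'

lemma indD_self (X : Submodule D V) : indD k X X = 0 := ind_self _

lemma indD_eq_zero_iff {X Y : Submodule D V} : indD k X Y = 0 ↔ Y ≤ X := ind_eq_zero_iff

lemma indD_pi {ι : Type*} [Fintype ι] (A X : ι → Submodule D V) :
    indD k (Submodule.pi Set.univ A) (Submodule.pi Set.univ X) = ∑ i, indD k (A i) (X i) :=
  ind_pi (fun i => (A i).restrictScalars k) (fun i => (X i).restrictScalars k)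

lemma indD_cyclic_le {N : Submodule D V} {m : V} {P : Ideal D} (h : ∀ x ∈ P, x • m ∈ N) :
    indD k N (N ⊔ Submodule.span D {m}) ≤ indD k P (⊤ : Ideal D) := by
  refine ind_le_of_surj ((LinearMap.toSpanSingleton D V m).restrictScalars k) ?_ ?_
  · intro x hx _
    exact h x hx
  · intro y hy
    obtain ⟨n, hn, z, hz, rfl⟩ := Submodule.mem_sup.1 hy
    obtain ⟨a, rfl⟩ := Submodule.mem_span_singleton.1 hz
    exact ⟨a, trivial, by simpa using hn⟩

lemma le_indD_cyclic {N : Submodule D V} {m : V} {P : Ideal D} (h : ∀ x, x • m ∈ N → x ∈ P) :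
    indD k P (⊤ : Ideal D) ≤ indD k N (N ⊔ Submodule.span D {m}) := by
  refine ind_le_of_inj ((LinearMap.toSpanSingleton D V m).restrictScalars k) ?_ ?_
  · intro x _ hx
    exact h x hx
  · intro y hy
    exact Submodule.mem_sup_right (Submodule.mem_span_singleton.2 ⟨y, rfl⟩)

/-- Jordan–Hölder style comparison of indices. -/
theorem lemB (Φ : Submodule D V → Submodule D V') (κ : ℕ)
    (hΦ : ∀ (N : Submodule D V) (m : V) (P : Ideal D), P.IsMaximal → (∀ x ∈ P, x • m ∈ N) →
      indD k (Φ N) (Φ (N ⊔ Submodule.span D {m})) ≤ κ * indD k P (⊤ : Ideal D))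
    {N M : Submodule D V} (h : N ≤ M) (hfin : indD k N M ≠ ⊤) :
    indD k (Φ N) (Φ M) ≤ κ * indD k N M := by
  obtain ⟨n, hn⟩ := ENat.ne_top_iff_exists.1 hfin
  induction n using Nat.strong_induction_on generalizing N with
  | _ n ih =>
  by_cases hNM : N = M
  · subst hNM; rw [indD_self]; simp
  have hlt : ∃ m, m ∈ M ∧ m ∉ N := by
    by_contra hcon
    push Not at hcon
    exact hNM (le_antisymm h hcon)
  -- choose a minimal cyclic extension
  have hsupM : ∀ m ∈ M, N ⊔ Submodule.span D {m} ≤ M := fun m hm =>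
    sup_le h ((Submodule.span_singleton_le_iff_mem _ _).2 hm)
  let S : Set ℕ∞ := {a | ∃ m, m ∈ M ∧ m ∉ N ∧ a = indD k N (N ⊔ Submodule.span D {m})}
  have hSne : S.Nonempty := by
    obtain ⟨m, hm, hm'⟩ := hlt
    exact ⟨_, m, hm, hm', rfl⟩
  obtain ⟨m, hm, hm', hmin⟩ : sInf S ∈ S := csInf_mem hSne
  have hmin' : ∀ m' ∈ M, m' ∉ N → indD k N (N ⊔ Submodule.span D {m}) ≤
      indD k N (N ⊔ Submodule.span D {m'}) := by
    intro m' h1 h2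
    rw [← hmin]
    exact csInf_le (OrderBot.bddBelow _) ⟨m', h1, h2, rfl⟩
  let P : Ideal D := N.colon {m}
  have hPm : ∀ x, x ∈ P ↔ x • m ∈ N := fun x => by
    simp only [P, Submodule.mem_colon_singleton]
  have hfin1 : ∀ m ∈ M, indD k N (N ⊔ Submodule.span D {m}) ≠ ⊤ := fun m hm =>
    ne_top_of_le_ne_top hfin (indD_mono k le_rfl (hsupM m hm))
  have hPmax : P.IsMaximal := by
    rw [Ideal.isMaximal_iff]
    refine ⟨fun h1 => hm' (by simpa using (hPm 1).1 h1), ?_⟩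
    intro J x hPJ hxP hxJ
    have hxm : x • m ∉ N := fun hh => hxP ((hPm x).2 hh)
    have h1 := hmin' (x • m) (M.smul_mem x hm) hxm
    have hle : N ⊔ Submodule.span D {x • m} ≤ N ⊔ Submodule.span D {m} :=
      sup_le_sup_left ((Submodule.span_singleton_le_iff_mem _ _).2
        (Submodule.smul_mem _ _ (Submodule.mem_span_singleton_self m))) _
    have h2 := indD_chain k (X := N) (le_sup_left) hle
    have h3 : indD k (N ⊔ Submodule.span D {x • m}) (N ⊔ Submodule.span D {m}) = 0 := by
      have h4 : indD k N (N ⊔ Submodule.span D {x • m}) ≠ ⊤ := hfin1 _ (M.smul_mem x hm)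
      rw [← h2] at h1
      obtain ⟨a, ha⟩ := ENat.ne_top_iff_exists.1 h4
      rw [← ha] at h1
      have h5 : indD k (N ⊔ Submodule.span D {x • m}) (N ⊔ Submodule.span D {m}) ≠ ⊤ := by
        intro hh; rw [hh] at h1; simp at h1
      obtain ⟨b, hb⟩ := ENat.ne_top_iff_exists.1 h5
      rw [← hb] at h1 ⊢
      norm_cast at h1 ⊢
      omega
    rw [indD_eq_zero_iff] at h3
    have h4 : m ∈ N ⊔ Submodule.span D {x • m} :=
      h3 (Submodule.mem_sup_right (Submodule.mem_span_singleton_self m))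
    obtain ⟨u, hu, v, hv, huv⟩ := Submodule.mem_sup.1 h4
    obtain ⟨y, rfl⟩ := Submodule.mem_span_singleton.1 hv
    have h5 : (1 - y * x) ∈ P := by
      rw [hPm, sub_smul, one_smul, mul_smul]
      nth_rewrite 1 [← huv]
      simpa using hu
    have := J.add_mem (hPJ h5) (J.mul_mem_left y hxJ)
    simpa using this
  have h1 := hΦ N m P hPmax (fun x hx => (hPm x).1 hx)
  have h2 : indD k P (⊤ : Ideal D) ≤ indD k N (N ⊔ Submodule.span D {m}) :=
    le_indD_cyclic k (fun x hx => (hPm x).2 hx)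
  have h3 := indD_chain k (X := N) (le_sup_left) (hsupM m hm)
  have hpos : indD k N (N ⊔ Submodule.span D {m}) ≠ 0 := by
    rw [Ne, indD_eq_zero_iff]
    exact fun hh => hm' (hh (Submodule.mem_sup_right (Submodule.mem_span_singleton_self m)))
  obtain ⟨a, ha⟩ := ENat.ne_top_iff_exists.1 (hfin1 m hm)
  have hfin2 : indD k (N ⊔ Submodule.span D {m}) M ≠ ⊤ := 
    ne_top_of_le_ne_top hfin (indD_mono k le_sup_left le_rfl)
  obtain ⟨b, hb⟩ := ENat.ne_top_iff_exists.1 hfin2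
  have hab : a + b = n := by
    rw [← ha, ← hb, ← hn] at h3; exact_mod_cast h3
  have ha0 : a ≠ 0 := by
    rintro rfl; exact hpos (by rw [← ha]; rfl)
  have h4 := ih b (by omega) (hsupM m hm) hfin2 hb
  calc indD k (Φ N) (Φ M) ≤ _ := indD_triangle k _ (Φ (N ⊔ Submodule.span D {m})) _
    _ ≤ κ * indD k N (N ⊔ Submodule.span D {m}) + κ * indD k (N ⊔ Submodule.span D {m}) M :=
      add_le_add (h1.trans (mul_le_mul_right h2 _)) h4
    _ = κ * indD k N M := by rw [← mul_add, h3]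

end Lat
end FThr
end part2


section part3
set_option linter.all false
open scoped nonZeroDivisors

namespace FThr

section Units

variable (k : Type*) {D K : Type*} [Field k] [CommRing D] [Field K] [Algebra k D]
  [Algebra D K] [Algebra k K] [IsScalarTower k D K]
  {V V' : Type*} [AddCommGroup V] [Module D V] [Module k V] [IsScalarTower k D V]
  [Module K V] [IsScalarTower D K V]

lemma mem_one_iff {x : K} : x ∈ (1 : Submodule D K) ↔ ∃ d : D, algebraMap D K d = x := by
  rw [Submodule.mem_one]

/-- image of an ideal in `K` -/
noncomputable def idK (K : Type*) [Field K] [Algebra D K] (P : Ideal D) : Submodule D K :=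
  Submodule.map (Algebra.linearMap D K) P

lemma mem_idK {P : Ideal D} {x : K} : x ∈ idK K P ↔ ∃ d ∈ P, algebraMap D K d = x := Iff.rfl

variable [FaithfulSMul D K]

lemma algebraMap_mem_idK {P : Ideal D} {d : D} : algebraMap D K d ∈ idK K P ↔ d ∈ P := by
  constructor
  · rintro ⟨d', h, h'⟩
    rwa [← FaithfulSMul.algebraMap_injective D K h']
  · intro h; exact ⟨d, h, rfl⟩

lemma indD_idK (P : Ideal D) : indD k (idK K P) (1 : Submodule D K) = indD k P (⊤ : Ideal D) := by
  refine le_antisymm ?_ ?_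
  · refine ind_le_of_surj ((Algebra.linearMap D K).restrictScalars k) ?_ ?_
    · intro x hx _; exact ⟨x, hx, rfl⟩
    · intro y hy
      obtain ⟨d, rfl⟩ := mem_one_iff.1 hy
      exact ⟨d, trivial, by simp⟩
  · refine ind_le_of_inj ((Algebra.linearMap D K).restrictScalars k) ?_ ?_
    · intro x _ hx
      exact algebraMap_mem_idK.1 hx
    · intro y hy
      exact mem_one_iff.2 ⟨y, rfl⟩

lemma exists_mem_not_mem_idK_mul (J : (Submodule D K)ˣ) {P : Ideal D} (hP : P ≠ ⊤) :
    ∃ j ∈ (J : Submodule D K), j ∉ idK K P * J := by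
  by_contra hcon
  push Not at hcon
  have h : (J : Submodule D K) ≤ idK K P * J := hcon
  have h2 : (J : Submodule D K) * (J⁻¹ : (Submodule D K)ˣ) ≤ idK K P * J * (J⁻¹ : (Submodule D K)ˣ) :=
    mul_le_mul' h le_rfl
  rw [mul_assoc, Units.mul_inv, mul_one] at h2
  have h3 : (1 : K) ∈ idK K P := h2 (Submodule.one_le.1 le_rfl)
  rw [← map_one (algebraMap D K), algebraMap_mem_idK] at h3
  exact hP ((Ideal.eq_top_iff_one _).2 h3)

lemma le_span_sup_idK_mul (J : (Submodule D K)ˣ) {P : Ideal D} (hP : P.IsMaximal) {j : K}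
    (hj : j ∈ (J : Submodule D K)) (hj' : j ∉ idK K P * J) :
    (J : Submodule D K) ≤ Submodule.span D {j} ⊔ idK K P * J := by
  set E : Submodule D K := Submodule.span D {j} * (J⁻¹ : (Submodule D K)ˣ) with hE
  have hE1 : E ≤ 1 := by
    rw [hE, ← Units.mul_inv J]
    exact mul_le_mul' ((Submodule.span_singleton_le_iff_mem _ _).2 hj) le_rfl
  have hEJ : E * J = Submodule.span D {j} := by
    rw [hE, mul_assoc, Units.inv_mul, mul_one]
  have h1 : ¬ E ≤ idK K P := by
    intro h
    have h2 : E * J ≤ idK K P * J := mul_le_mul' h le_rfl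
    rw [hEJ] at h2
    exact hj' (h2 (Submodule.mem_span_singleton_self j))
  obtain ⟨x, hx, hx'⟩ := Set.not_subset.1 h1
  obtain ⟨d, rfl⟩ := mem_one_iff.1 (hE1 hx)
  have hd : d ∉ P := fun h => hx' (algebraMap_mem_idK.2 h)
  have h2 : (1 : Submodule D K) ≤ E ⊔ idK K P := by
    obtain ⟨y, i, hi, hyi⟩ := hP.exists_inv hd
    rw [Submodule.one_le]
    have : (1 : K) = y • algebraMap D K d + algebraMap D K i := by
      rw [Algebra.smul_def, ← map_mul, ← map_add, hyi, map_one]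
    rw [this]
    exact Submodule.add_mem_sup (E.smul_mem _ hx) (algebraMap_mem_idK.2 hi)
  calc (J : Submodule D K) = 1 * J := (one_mul _).symm
    _ ≤ (E ⊔ idK K P) * J := mul_le_mul' h2 le_rfl
    _ = _ := by rw [Submodule.sup_mul, hEJ]

lemma indD_smul_le (J : (Submodule D K)ˣ) {N M : Submodule D V} (h : N ≤ M)
    (hfin : indD k N M ≠ ⊤) :
    indD k ((J : Submodule D K) • N) ((J : Submodule D K) • M) ≤ indD k N M := by
  have := lemB k (fun X : Submodule D V => (J : Submodule D K) • X) 1 ?_ h hfin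
  · simpa using this
  intro N m P hP hPm
  obtain ⟨j, hj, hj'⟩ := exists_mem_not_mem_idK_mul J hP.ne_top
  have hle := le_span_sup_idK_mul J hP hj hj'
  rw [Nat.cast_one, one_mul]
  refine le_trans (indD_mono k le_rfl ?_) (indD_cyclic_le k (m := j • m) (P := P) ?_)
  · rw [Submodule.smul_sup]
    refine sup_le le_sup_left ?_
    refine Submodule.smul_le.2 ?_
    intro x hx y hy
    obtain ⟨a, rfl⟩ := Submodule.mem_span_singleton.1 hy
    obtain ⟨u, hu, v, hv, rfl⟩ := Submodule.mem_sup.1 (hle hx)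
    obtain ⟨b, rfl⟩ := Submodule.mem_span_singleton.1 hu
    rw [add_smul]
    refine add_mem ?_ ?_
    · refine Submodule.mem_sup_right ?_
      rw [smul_comm, smul_assoc]
      exact Submodule.smul_mem _ _ (Submodule.smul_mem _ _ (Submodule.mem_span_singleton_self _))
    · refine Submodule.mem_sup_left ?_
      rw [smul_comm]
      refine Submodule.smul_mem _ _ ?_
      refine Submodule.mul_induction_on hv ?_ ?_
      · rintro _ ⟨d, hd, rfl⟩ x hx
        rw [mul_comm, mul_smul]
        refine Submodule.smul_mem_smul hx ?_
        simpa using hPm d hd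
      · intro x y hx hy
        rw [add_smul]; exact add_mem hx hy
  · intro x hx
    rw [smul_comm]
    exact Submodule.smul_mem_smul hj (hPm x hx)

lemma units_smul_smul (A B : (Submodule D K)ˣ) (N : Submodule D V) :
    (A : Submodule D K) • ((B : Submodule D K) • N) = ((A * B : (Submodule D K)ˣ) : Submodule D K) • N := by
  rw [Units.val_mul, ← smul_eq_mul, Submodule.smul_assoc]

lemma indD_smul (J : (Submodule D K)ˣ) {N M : Submodule D V} (h : N ≤ M)
    (hfin : indD k N M ≠ ⊤) :
    indD k ((J : Submodule D K) • N) ((J : Submodule D K) • M) = indD k N M := by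
  refine le_antisymm (indD_smul_le k J h hfin) ?_
  have h1 := indD_smul_le k J⁻¹ (Submodule.smul_mono le_rfl h :
    (J : Submodule D K) • N ≤ (J : Submodule D K) • M)
    (ne_top_of_le_ne_top hfin (indD_smul_le k J h hfin))
  rw [units_smul_smul, units_smul_smul] at h1
  simpa [Submodule.one_smul] using h1

lemma one_le_zpow_mono {J : (Submodule D K)ˣ} (h : (1 : Submodule D K) ≤ J) {a b : ℤ} (hab : a ≤ b) :
    ((J ^ a : (Submodule D K)ˣ) : Submodule D K) ≤ ((J ^ b : (Submodule D K)ˣ) : Submodule D K) := by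
  obtain ⟨n, rfl⟩ := Int.le.dest hab
  have h1 : (1 : Submodule D K) ≤ (J : Submodule D K) ^ n := one_le_pow_of_one_le' h n
  rw [zpow_add, Units.val_mul, zpow_natCast, Units.val_pow_eq_pow_val]
  calc ((J ^ a : (Submodule D K)ˣ) : Submodule D K) = ((J ^ a : (Submodule D K)ˣ) : Submodule D K) * 1 := (mul_one _).symm
    _ ≤ _ := mul_le_mul' le_rfl h1

lemma indD_zpow_smul_le {J : (Submodule D K)ˣ} (h : (1 : Submodule D K) ≤ J) {N : Submodule D V}
    (hfin : indD k N ((J : Submodule D K) • N) ≠ ⊤) (a : ℤ) (n : ℕ) :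
    indD k (((J ^ a : (Submodule D K)ˣ) : Submodule D K) • N)
      (((J ^ (a + n) : (Submodule D K)ˣ) : Submodule D K) • N) =
      n * indD k N ((J : Submodule D K) • N) := by
  have hN : N ≤ (J : Submodule D K) • N := by
    calc N = (1 : Submodule D K) • N := (Submodule.one_smul _).symm
      _ ≤ _ := Submodule.smul_mono h le_rfl
  induction n with
  | zero => simp [indD_self]
  | succ n ih =>
    rw [← indD_chain k (Y := ((J ^ (a + n) : (Submodule D K)ˣ) : Submodule D K) • N), ih]
    · have h2 : ((J ^ (a + (n + 1 : ℕ)) : (Submodule D K)ˣ) : Submodule D K) • N =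
        ((J ^ (a + n) : (Submodule D K)ˣ) : Submodule D K) • ((J : Submodule D K) • N) := by
        rw [units_smul_smul]; congr 2; push_cast; rw [← add_assoc, zpow_add_one]
      rw [h2, indD_smul k _ hN hfin]
      push_cast; ring
    · exact Submodule.smul_mono (one_le_zpow_mono h (by omega)) le_rfl
    · exact Submodule.smul_mono (one_le_zpow_mono h (by push_cast; omega)) le_rfl

lemma indD_zpow {J : (Submodule D K)ˣ} (h : (1 : Submodule D K) ≤ J)
    (hfin : indD k (1 : Submodule D K) J ≠ ⊤) (a : ℤ) (n : ℕ) :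
    indD k ((J ^ a : (Submodule D K)ˣ) : Submodule D K)
      ((J ^ (a + n) : (Submodule D K)ˣ) : Submodule D K) = n * indD k (1 : Submodule D K) J := by
  have := indD_zpow_smul_le k h (N := (1 : Submodule D K)) (by simpa using hfin) a n
  simpa using this

/-- `q`-th powers generate the power -/
lemma span_pow_eq (A : (Submodule D K)ˣ) (q : ℕ) :
    Submodule.span D ((fun x => x ^ q) '' ((A : Submodule D K) : Set K)) = (A : Submodule D K) ^ q := by
  apply le_antisymm
  · rw [Submodule.span_le]
    rintro _ ⟨x, hx, rfl⟩
    exact Submodule.pow_mem_pow _ hx q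
  set B := Submodule.span D ((fun x => x ^ q) '' ((A : Submodule D K) : Set K)) with hB
  have hBA : B ≤ (A : Submodule D K) ^ q := by
    rw [Submodule.span_le]
    rintro _ ⟨x, hx, rfl⟩
    exact Submodule.pow_mem_pow _ hx q
  set C : Submodule D K := ((A⁻¹ ^ q : (Submodule D K)ˣ) : Submodule D K) * B with hC
  have hCA : (A : Submodule D K) ^ q * C = B := by
    rw [hC, ← mul_assoc, ← Units.val_pow_eq_pow_val, ← Units.val_mul, ← mul_pow]; simp
  have hC1 : C ≤ 1 := by
    calc C ≤ ((A⁻¹ ^ q : (Submodule D K)ˣ) : Submodule D K) * (A : Submodule D K) ^ q :=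
          mul_le_mul' le_rfl hBA
      _ = 1 := by rw [← Units.val_pow_eq_pow_val, ← Units.val_mul, ← mul_pow]; simp
  by_contra hcon
  have hne : C.comap (Algebra.linearMap D K) ≠ ⊤ := by
    intro h
    have : C = 1 := by
      refine le_antisymm hC1 ?_
      rw [Submodule.one_le]
      have : (1 : D) ∈ C.comap (Algebra.linearMap D K) := by rw [h]; trivial
      simpa using this
    rw [this, mul_one] at hCA
    exact hcon hCA.le
  obtain ⟨P, hP, hCP⟩ := Ideal.exists_le_maximal _ hne
  have hCP' : C ≤ idK K P := by
    intro x hx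
    obtain ⟨d, rfl⟩ := mem_one_iff.1 (hC1 hx)
    exact algebraMap_mem_idK.2 (hCP hx)
  obtain ⟨x, hx, hx'⟩ := exists_mem_not_mem_idK_mul A hP.ne_top
  apply hx'
  have h1 : Submodule.span D {x} * (A⁻¹ : (Submodule D K)ˣ) ≤ idK K P := by
    rw [Submodule.mul_le]
    intro u hu y hy
    obtain ⟨c, rfl⟩ := Submodule.mem_span_singleton.1 hu
    rw [smul_mul_assoc]
    refine Submodule.smul_mem _ _ ?_
    have hxy : x * y ∈ (1 : Submodule D K) := by
      rw [← Units.mul_inv A]; exact Submodule.mul_mem_mul hx hy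
    obtain ⟨d, hd⟩ := mem_one_iff.1 hxy
    rw [← hd, algebraMap_mem_idK]
    refine hP.isPrime.mem_of_pow_mem q ?_
    rw [← algebraMap_mem_idK (K := K), map_pow, hd, mul_pow, mul_comm]
    apply hCP'
    rw [hC, Units.val_pow_eq_pow_val]
    exact Submodule.mul_mem_mul (Submodule.pow_mem_pow _ hy q) (Submodule.subset_span ⟨x, hx, rfl⟩)
  have h2 : Submodule.span D {x} ≤ idK K P * A := by
    calc Submodule.span D {x} = Submodule.span D {x} * (A⁻¹ : (Submodule D K)ˣ) * A := by
          rw [mul_assoc, Units.inv_mul, mul_one]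
      _ ≤ _ := mul_le_mul' h1 le_rfl
  exact h2 (Submodule.mem_span_singleton_self x)

end Units
end FThr
end part3


section part4
set_option linter.all false
open scoped nonZeroDivisors

namespace FThr

section Frob

variable (k : Type*) {D K : Type*} [Field k] [CommRing D] [Field K] [Algebra k D]
  [Algebra D K] [Algebra k K] [IsScalarTower k D K] [IsFractionRing D K] [IsDedekindDomain D]
  {V : Type*} [AddCommGroup V] [Module D V] [Module k V] [IsScalarTower k D V]
  [Module K V] [IsScalarTower D K V]
  {ι : Type*}

lemma unit_of_fg (A : Submodule D K) (hfg : A.FG) (hne : A ≠ ⊥) :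
    ∃ u : (Submodule D K)ˣ, (u : Submodule D K) = A := by
  let I : FractionalIdeal D⁰ K := ⟨A, FractionalIdeal.isFractional_of_fg hfg⟩
  have hI : I ≠ 0 := by
    intro h
    apply hne
    have : (I : Submodule D K) = ((0 : FractionalIdeal D⁰ K) : Submodule D K) := by rw [h]
    simpa [I] using this
  refine ⟨Units.map (FractionalIdeal.coeSubmoduleHom D⁰ K).toMonoidHom (Units.mk0 I hI), rfl⟩

/-- coordinatewise power -/
def frob (q : ℕ) (x : ι → K) : ι → K := fun i => x i ^ q

/-- Frobenius pullback of a lattice -/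
noncomputable def Fr (q : ℕ) (N : Submodule D (ι → K)) : Submodule D (ι → K) :=
  Submodule.span D (frob q '' (N : Set (ι → K)))

lemma frob_mem_Fr {q : ℕ} {N : Submodule D (ι → K)} {x : ι → K} (h : x ∈ N) :
    frob q x ∈ Fr q N := Submodule.subset_span ⟨x, h, rfl⟩

lemma Fr_mono {q : ℕ} {N M : Submodule D (ι → K)} (h : N ≤ M) : Fr q N ≤ Fr q M :=
  Submodule.span_mono (Set.image_mono h)

lemma frob_smul (q : ℕ) (c : K) (x : ι → K) : frob q (c • x) = c ^ q • frob q x := by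
  funext i; simp [frob, mul_pow]

lemma frob_smulD (q : ℕ) (c : D) (x : ι → K) : frob q (c • x) = c ^ q • frob q x := by
  funext i; simp [frob, smul_pow]

lemma frob_add {q : ℕ} (hq : ∀ x y : K, (x + y) ^ q = x ^ q + y ^ q) (x y : ι → K) :
    frob q (x + y) = frob q x + frob q y := by
  funext i; simp [frob, hq]

lemma Fr_sup_span {q : ℕ} (hq : ∀ x y : K, (x + y) ^ q = x ^ q + y ^ q)
    (N : Submodule D (ι → K)) (m : ι → K) :
    Fr q (N ⊔ Submodule.span D {m}) ≤ Fr q N ⊔ Submodule.span D {frob q m} := by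
  rw [Fr, Submodule.span_le]
  rintro _ ⟨x, hx, rfl⟩
  obtain ⟨n, hn, y, hy, rfl⟩ := Submodule.mem_sup.1 hx
  obtain ⟨a, rfl⟩ := Submodule.mem_span_singleton.1 hy
  rw [frob_add hq, frob_smulD]
  exact Submodule.add_mem_sup (frob_mem_Fr hn)
    (Submodule.smul_mem _ _ (Submodule.mem_span_singleton_self _))

lemma idK_le_one (P : Ideal D) : idK K P ≤ 1 := by
  rintro _ ⟨d, _, rfl⟩
  exact mem_one_iff.2 ⟨d, rfl⟩

lemma indD_pow_le (A : (Submodule D K)ˣ) (hA : (A : Submodule D K) ≤ 1)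
    (hfin : indD k (A : Submodule D K) 1 ≠ ⊤) (q : ℕ) :
    indD k ((A : Submodule D K) ^ q) 1 ≤ q * indD k (A : Submodule D K) 1 := by
  induction q with
  | zero => simp [indD_self]
  | succ n ih =>
    refine (indD_triangle k _ ((A : Submodule D K) ^ n) _).trans ?_
    have h := indD_smul_le k (A ^ n) hA hfin
    simp only [smul_eq_mul, mul_one, Units.val_pow_eq_pow_val] at h
    rw [pow_succ]
    calc _ ≤ indD k (A : Submodule D K) 1 + n * indD k (A : Submodule D K) 1 := add_le_add h ih
      _ = _ := by push_cast; ring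

lemma Fr_step {q : ℕ} (hq0 : q ≠ 0) (hq : ∀ x y : K, (x + y) ^ q = x ^ q + y ^ q)
    (N : Submodule D (ι → K)) (m : ι → K) (P : Ideal D) (hPm : ∀ x ∈ P, x • m ∈ N) :
    indD k (Fr q N) (Fr q (N ⊔ Submodule.span D {m})) ≤ q * indD k P (⊤ : Ideal D) := by
  by_cases htop : indD k P (⊤ : Ideal D) = ⊤
  · rw [htop, ENat.mul_top (by exact_mod_cast hq0)]; exact le_top
  by_cases hP : P = ⊥
  · subst hP
    refine (indD_mono k le_rfl (Fr_sup_span hq N m)).trans ?_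
    refine (indD_cyclic_le k (P := ⊥) ?_).trans ?_
    · intro x hx
      rw [Submodule.mem_bot] at hx
      subst hx; simp
    · exact le_mul_of_one_le_left (zero_le) (by exact_mod_cast Nat.one_le_iff_ne_zero.2 hq0)
  obtain ⟨A, hA⟩ := unit_of_fg (idK K P) (Submodule.FG.map _ (IsNoetherian.noetherian P)) (by
    intro h
    apply hP
    rw [eq_bot_iff]
    intro x hx
    have : algebraMap D K x ∈ idK K P := algebraMap_mem_idK.2 hx
    rw [h, Submodule.mem_bot] at this
    simpa using this)
  have h1 : indD k (Fr q N) (Fr q (N ⊔ Submodule.span D {m})) ≤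
      indD k ((A : Submodule D K) ^ q) 1 := by
    refine (indD_mono k le_rfl (Fr_sup_span hq N m)).trans ?_
    refine ind_le_of_surj ((LinearMap.toSpanSingleton K (ι → K) (frob q m)).restrictScalars k) ?_ ?_
    · intro x hx _
      have hx' : x ∈ (A : Submodule D K) ^ q := hx
      rw [← span_pow_eq] at hx'
      change x • frob q m ∈ Fr q N
      refine Submodule.span_induction (p := fun x _ => x • frob q m ∈ Fr q N) ?_ ?_ ?_ ?_ hx'
      · rintro _ ⟨y, hy, rfl⟩
        have hy' : y ∈ idK K P := by rw [← hA]; exact hy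
        obtain ⟨d, hd, rfl⟩ := hy'
        have := frob_mem_Fr (q := q) (hPm d hd)
        rw [frob_smulD] at this
        simpa [← map_pow] using this
      · simp
      · intro x y _ _ hx hy; rw [add_smul]; exact add_mem hx hy
      · intro a x _ hx; rw [smul_assoc]; exact Submodule.smul_mem _ _ hx
    · intro y hy
      obtain ⟨n, hn, z, hz, rfl⟩ := Submodule.mem_sup.1 hy
      obtain ⟨a, rfl⟩ := Submodule.mem_span_singleton.1 hz
      refine ⟨algebraMap D K a, mem_one_iff.2 ⟨a, rfl⟩, ?_⟩
      simpa using hn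
  refine h1.trans ?_
  have h2 := indD_pow_le k A (by rw [hA]; exact idK_le_one P) (by rw [hA, indD_idK]; exact htop) q
  rwa [hA, indD_idK, ← hA] at h2

lemma indD_Fr_le {q : ℕ} (hq0 : q ≠ 0) (hq : ∀ x y : K, (x + y) ^ q = x ^ q + y ^ q)
    {N M : Submodule D (ι → K)} (h : N ≤ M) (hfin : indD k N M ≠ ⊤) :
    indD k (Fr q N) (Fr q M) ≤ q * indD k N M := by
  have H : ∀ (N : Submodule D (ι → K)) (m : ι → K) (P : Ideal D), P.IsMaximal →
      (∀ x ∈ P, x • m ∈ N) → indD k (Fr q N) (Fr q (N ⊔ Submodule.span D {m})) ≤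
        q * indD k P (⊤ : Ideal D) := fun N m P _ hPm => Fr_step k hq0 hq N m P hPm
  exact lemB k (V := ι → K) (V' := ι → K) (fun N => Fr q N) q H h hfin

variable [Fintype ι]

lemma Fr_pi {q : ℕ} (hq0 : q ≠ 0) (hq : ∀ x y : K, (x + y) ^ q = x ^ q + y ^ q)
    (A : ι → (Submodule D K)ˣ) :
    Fr q (Submodule.pi Set.univ (fun i => (A i : Submodule D K))) =
      Submodule.pi Set.univ (fun i => (A i : Submodule D K) ^ q) := by
  classical
  apply le_antisymm
  · rw [Fr, Submodule.span_le]
    rintro _ ⟨x, hx, rfl⟩ i _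
    exact Submodule.pow_mem_pow _ (hx i trivial) q
  · intro x hx
    have h1 : x = ∑ i, Pi.single i (x i) := (Finset.univ_sum_single x).symm
    rw [h1]
    refine sum_mem fun i _ => ?_
    have hxi : x i ∈ (A i : Submodule D K) ^ q := hx i trivial
    rw [← span_pow_eq] at hxi
    refine Submodule.span_induction (p := fun y _ => (Pi.single i y : ι → K) ∈ Fr q _) ?_ ?_ ?_ ?_ hxi
    · rintro _ ⟨y, hy, rfl⟩
      have h2 : (Pi.single i (y ^ q) : ι → K) = frob q (Pi.single i y) := by
        funext j
        by_cases hj : j = i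
        · subst hj; simp [frob]
        · simp [frob, hj, hq0]
      simp only [h2]
      refine frob_mem_Fr ?_
      intro j _
      by_cases hj : j = i
      · subst hj; simpa using hy
      · simp [hj]
    · simp
    · intro x y _ _ hx hy; rw [Pi.single_add]; exact add_mem hx hy
    · intro a x _ hx; rw [Pi.single_smul]; exact Submodule.smul_mem _ _ hx

/-- the standard lattice -/
noncomputable def stdL (D K ι : Type*) [CommRing D] [Field K] [Algebra D K] :
    Submodule D (ι → K) := Submodule.pi Set.univ (fun _ => 1)

lemma smul_pi (J : (Submodule D K)ˣ) :
    (J : Submodule D K) • stdL D K ι = Submodule.pi Set.univ (fun _ => (J : Submodule D K)) := by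
  classical
  apply le_antisymm
  · rw [Submodule.smul_le]
    intro j hj x hx i _
    have := Submodule.mul_mem_mul hj (hx i trivial)
    simpa using this
  · intro x hx
    rw [← Finset.univ_sum_single x]
    refine sum_mem fun i _ => ?_
    have : (Pi.single i (x i) : ι → K) = x i • Pi.single i 1 := by
      rw [← Pi.single_smul]; simp
    rw [this]
    refine Submodule.smul_mem_smul (hx i trivial) ?_
    intro j _
    by_cases hj : j = i
    · subst hj; simpa using Submodule.one_le.1 le_rfl
    · simp [hj]

lemma Fr_std {q : ℕ} (hq0 : q ≠ 0) (hq : ∀ x y : K, (x + y) ^ q = x ^ q + y ^ q) :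
    Fr q (stdL D K ι) = stdL D K ι := by
  have := Fr_pi (ι := ι) hq0 hq (fun _ => (1 : (Submodule D K)ˣ))
  simpa [stdL] using this

lemma indD_std_pow {A : (Submodule D K)ˣ} (h1 : (1 : Submodule D K) ≤ A)
    (hfin : indD k (1 : Submodule D K) A ≠ ⊤) (q : ℕ) :
    indD k (stdL D K ι) (Submodule.pi Set.univ (fun _ => (A : Submodule D K) ^ q)) =
      q * indD k (stdL D K ι) (Submodule.pi Set.univ (fun _ => (A : Submodule D K))) := by
  rw [stdL, indD_pi, indD_pi]
  have := indD_zpow k h1 hfin 0 q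
  simp only [zpow_zero, Units.val_one, zero_add, zpow_natCast, Units.val_pow_eq_pow_val] at this
  simp only [this, Finset.sum_const, nsmul_eq_mul]
  ring

/-- multiplicativity of the index of lattices under Frobenius -/
theorem indD_Fr_eq {q : ℕ} (hq0 : q ≠ 0) (hq : ∀ x y : K, (x + y) ^ q = x ^ q + y ^ q)
    {A : (Submodule D K)ˣ} (h1 : (1 : Submodule D K) ≤ A)
    (hfin : indD k (1 : Submodule D K) A ≠ ⊤) {M : Submodule D (ι → K)}
    (hM : stdL D K ι ≤ M) (hM' : M ≤ Submodule.pi Set.univ (fun _ => (A : Submodule D K))) :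
    indD k (stdL D K ι) (Fr q M) = q * indD k (stdL D K ι) M := by
  set X := Submodule.pi (Set.univ : Set ι) (fun _ => (A : Submodule D K)) with hX
  have hXfin : indD k (stdL D K ι) X ≠ ⊤ := by
    rw [stdL, hX, indD_pi]
    simp only [Finset.sum_const, nsmul_eq_mul]
    exact WithTop.mul_ne_top (ENat.coe_ne_top _) hfin
  have e1 := indD_chain k hM hM'
  have f1 : indD k (stdL D K ι) M ≠ ⊤ := fun h => by rw [h] at e1; simp at e1; exact hXfin e1.symm
  have f2 : indD k M X ≠ ⊤ := fun h => by rw [h] at e1; simp at e1; exact hXfin e1.symm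
  have g1 := indD_Fr_le k hq0 hq hM f1
  have g2 := indD_Fr_le k hq0 hq hM' f2
  have e2 := indD_chain k (Fr_mono (q := q) hM) (Fr_mono (q := q) hM')
  rw [Fr_std hq0 hq] at g1 e2
  have e3 : indD k (stdL D K ι) (Fr q X) = q * indD k (stdL D K ι) X := by
    rw [hX, Fr_pi hq0 hq, indD_std_pow k h1 hfin]
  rw [e3, ← e1] at e2
  obtain ⟨a, ha⟩ := ENat.ne_top_iff_exists.1 f1
  obtain ⟨b, hb⟩ := ENat.ne_top_iff_exists.1 f2
  rw [← ha, ← hb] at e2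
  rw [← ha] at g1 ⊢
  rw [← hb] at g2
  obtain ⟨c, hc⟩ := ENat.ne_top_iff_exists.1 (ne_top_of_le_ne_top
    (WithTop.mul_ne_top (ENat.coe_ne_top q) (ENat.coe_ne_top a)) g1)
  obtain ⟨d, hd⟩ := ENat.ne_top_iff_exists.1 (ne_top_of_le_ne_top
    (WithTop.mul_ne_top (ENat.coe_ne_top q) (ENat.coe_ne_top b)) g2)
  rw [← hc] at g1 e2 ⊢
  rw [← hd] at g2 e2
  norm_cast at *
  rw [mul_add] at e2
  omega

/-- index of `M ⊂ J M`. -/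
theorem indD_smul_bound {J : (Submodule D K)ˣ} (h1 : (1 : Submodule D K) ≤ J)
    (hfinJ : indD k (1 : Submodule D K) J ≠ ⊤) {M : Submodule D (ι → K)}
    (hM : stdL D K ι ≤ M) (hfin : indD k (stdL D K ι) M ≠ ⊤) :
    indD k M ((J : Submodule D K) • M) ≤ Fintype.card ι * indD k (1 : Submodule D K) J := by
  have hMJ : M ≤ (J : Submodule D K) • M := by
    calc M = (1 : Submodule D K) • M := (Submodule.one_smul _).symm
      _ ≤ _ := Submodule.smul_mono h1 le_rfl
  have e1 := indD_chain k hM hMJ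
  have h2 := indD_triangle k (stdL D K ι) ((J : Submodule D K) • stdL D K ι)
    ((J : Submodule D K) • M)
  rw [← e1, indD_smul k J hM hfin] at h2
  have h3 : indD k (stdL D K ι) ((J : Submodule D K) • stdL D K ι) =
      Fintype.card ι * indD k (1 : Submodule D K) J := by
    rw [smul_pi, stdL, indD_pi]
    simp
  rw [h3, add_comm] at h2
  exact (ENat.add_le_add_iff_right hfin).1 h2

/-- finiteness of the index -/
lemma indD_ne_top (Hfin : ∀ f : D, f ≠ 0 → indD k (Ideal.span {f}) (⊤ : Ideal D) ≠ ⊤)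
    {N M : Submodule D V} (hM : M.FG) {f : D} (hf : f ≠ 0) (h : ∀ x ∈ M, f • x ∈ N) :
    indD k N M ≠ ⊤ := by
  obtain ⟨s, hs⟩ := hM
  have h1 : indD k N M ≤ indD k (Submodule.pi (Set.univ : Set s) (fun _ => Ideal.span {f}))
      (Submodule.pi (Set.univ : Set s) (fun _ => (⊤ : Ideal D))) := by
    refine ind_le_of_surj ((Fintype.linearCombination D (fun x : s => (x : V))).restrictScalars k) ?_ ?_
    · intro x hx _
      simp only [LinearMap.coe_restrictScalars, Fintype.linearCombination_apply]
      refine sum_mem fun i _ => ?_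
      obtain ⟨c, hc⟩ := Ideal.mem_span_singleton.1 (hx i trivial)
      rw [hc, mul_comm, mul_smul]
      refine Submodule.smul_mem _ _ (h _ ?_)
      rw [← hs]; exact Submodule.subset_span i.2
    · intro y hy
      have hy' : y ∈ Submodule.span D (s : Set V) := by rw [hs]; exact hy
      rw [← Subtype.range_coe (s := (s : Set V)), ← Fintype.range_linearCombination] at hy'
      obtain ⟨c, rfl⟩ := hy'
      exact ⟨c, fun i _ => trivial, by erw [sub_self]; exact N.zero_mem⟩
  refine ne_top_of_le_ne_top ?_ h1
  rw [indD_pi]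
  simp only [Finset.sum_const, nsmul_eq_mul]
  exact WithTop.mul_ne_top (ENat.coe_ne_top _) (Hfin f hf)

end Frob
end FThr
end part4


section part5
set_option linter.all false
open scoped nonZeroDivisors

namespace FThr

universe u

/-- An affine chart of a curve together with the invertible module generated by `L`. -/
structure Chart (k : Type*) (K : Type u) [Field k] [Field K] [Algebra k K] (L : Submodule k K) where
  D : Type u
  [cr : CommRing D]
  [algkD : Algebra k D]
  [algDK : Algebra D K]
  [tow : IsScalarTower k D K]
  [ded : IsDedekindDomain D]
  [frac : IsFractionRing D K]
  fin : ∀ f : D, f ≠ 0 → indD k (Ideal.span {f}) (⊤ : Ideal D) ≠ ⊤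
  J : (Submodule D K)ˣ
  hJ : (J : Submodule D K) = Submodule.span D (L : Set K)

attribute [instance] Chart.cr Chart.algkD Chart.algDK Chart.tow Chart.ded Chart.frac

section Num

variable {k : Type*} {K : Type u} [Field k] [Field K] [Algebra k K] {L : Submodule k K} (A B : Chart k K L)
  {κ : Type*} [Fintype κ]

/-- powers of `J` -/
noncomputable def Chart.pw (m : ℤ) : Submodule A.D K := ((A.J ^ m : (Submodule A.D K)ˣ) : Submodule A.D K)

/-- powers of `J` as `k`-spaces -/
noncomputable def Chart.pwk (m : ℤ) : Submodule k K := (A.pw m).restrictScalars k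

lemma Chart.L_le (x : K) (hx : x ∈ L) : x ∈ (A.J : Submodule A.D K) := by
  rw [A.hJ]; exact Submodule.subset_span hx

lemma Chart.one_le (h1 : (1 : K) ∈ L) : (1 : Submodule A.D K) ≤ A.J := by
  rw [Submodule.one_le]; exact A.L_le 1 h1

lemma Chart.exists_den (s : Finset K) : ∃ f : A.D, f ≠ 0 ∧ ∀ x ∈ s, ∃ d : A.D, algebraMap A.D K d = algebraMap A.D K f * x := by
  obtain ⟨b, hb⟩ := IsLocalization.exist_integer_multiples_of_finset A.D⁰ s
  refine ⟨b, nonZeroDivisors.coe_ne_zero b, fun x hx => ?_⟩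
  obtain ⟨d, hd⟩ := hb x hx
  exact ⟨d, by rw [Algebra.smul_def] at hd; exact hd⟩

lemma Chart.fin_of_fg (N : Submodule A.D K) (hN : N.FG) : indD k (1 : Submodule A.D K) N ≠ ⊤ := by
  classical
  obtain ⟨s, rfl⟩ := hN
  obtain ⟨f, hf, h⟩ := A.exists_den s
  refine indD_ne_top k A.fin ⟨s, rfl⟩ hf ?_
  intro x hx
  refine Submodule.span_induction (p := fun x _ => f • x ∈ (1 : Submodule A.D K)) ?_ ?_ ?_ ?_ hx
  · intro x hx
    obtain ⟨d, hd⟩ := h x hx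
    refine mem_one_iff.2 ⟨d, ?_⟩
    rw [Algebra.smul_def]; exact hd
  · simp
  · intro x y _ _ hx hy; rw [smul_add]; exact add_mem hx hy
  · intro a x _ hx; rw [smul_comm]; exact Submodule.smul_mem _ _ hx

lemma unit_fg {D : Type*} [CommRing D] [Algebra D K] (J : (Submodule D K)ˣ) : (J : Submodule D K).FG :=
  Submodule.fg_unit J

lemma Chart.finJ : indD k (1 : Submodule A.D K) A.J ≠ ⊤ := A.fin_of_fg _ (unit_fg _)

/-- the degree -/
noncomputable def Chart.deg : ℕ := (indD k (1 : Submodule A.D K) A.J).toNat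

lemma Chart.coe_deg : (A.deg : ℕ∞) = indD k (1 : Submodule A.D K) A.J := ENat.coe_toNat A.finJ

lemma Chart.pw_mono (h1 : (1 : K) ∈ L) {a b : ℤ} (hab : a ≤ b) : A.pw a ≤ A.pw b :=
  one_le_zpow_mono (A.one_le h1) hab

lemma Chart.pw_mul (a b : ℤ) : A.pw a * A.pw b = A.pw (a + b) := by
  rw [Chart.pw, Chart.pw, Chart.pw, zpow_add, Units.val_mul]

lemma Chart.mul_mem {a b : ℤ} {x y : K} (hx : x ∈ A.pw a) (hy : y ∈ A.pw b) : x * y ∈ A.pw (a + b) := by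
  rw [← A.pw_mul]; exact Submodule.mul_mem_mul hx hy

@[simp] lemma Chart.pw_zero : A.pw 0 = 1 := by simp [Chart.pw]

lemma Chart.smul_smul_pw (a b : ℤ) (N : Submodule A.D (κ → K)) :
    A.pw a • (A.pw b • N) = A.pw (a + b) • N := by
  rw [Chart.pw, Chart.pw, Chart.pw, zpow_add, units_smul_smul]

lemma Chart.ind_pw (h1 : (1 : K) ∈ L) {a b : ℤ} {n : ℕ} (hab : b = a + n) :
    ind (A.pwk a) (A.pwk b) = n * A.deg := by
  rw [A.coe_deg, hab]
  exact indD_zpow k (A.one_le h1) A.finJ a n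

lemma Chart.ind_pw_smul (h1 : (1 : K) ∈ L) {M : Submodule A.D (κ → K)} (hM : stdL A.D K κ ≤ M)
    (hfin : indD k (stdL A.D K κ) M ≠ ⊤) {a b : ℤ} {n : ℕ} (hab : b = a + n) :
    indD k (A.pw a • M) (A.pw b • M) ≤ n * (Fintype.card κ * A.deg) := by
  have h := indD_smul_bound k (A.one_le h1) A.finJ hM hfin
  have h2 := indD_zpow_smul_le k (A.one_le h1) (N := M) (ne_top_of_le_ne_top
    (WithTop.mul_ne_top (ENat.coe_ne_top _) A.finJ) h) a n
  rw [← A.coe_deg] at h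
  rw [hab]
  exact h2.le.trans (mul_le_mul' le_rfl h)

lemma Chart.mem_pw_smul_std {m : ℤ} {x : κ → K} :
    x ∈ A.pw m • stdL A.D K κ ↔ ∀ i, x i ∈ A.pw m := by
  rw [Chart.pw, smul_pi, Submodule.mem_pi]
  simp

theorem num_up (h1 : (1 : K) ∈ L) {C : ℕ}
    (K2 : ∀ x : K, ∃ s ∈ A.pw C, ∃ t ∈ B.pw C, x = s + t)
    {MA : Submodule A.D (κ → K)} (hMA : stdL A.D K κ ≤ MA) (hfA : indD k (stdL A.D K κ) MA ≠ ⊤)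
    {MB : Submodule B.D (κ → K)} (hMB : stdL B.D K κ ≤ MB) (hfB : indD k (stdL B.D K κ) MB ≠ ⊤)
    (Δ : ℕ) (h0 : ∀ x, x ∈ A.pw (-Δ) • MA → x ∈ B.pw (-Δ) • MB → x = 0) :
    indD k (stdL A.D K κ) MA + indD k (stdL B.D K κ) MB ≤
      ((Δ + C) * (Fintype.card κ * (A.deg + B.deg)) : ℕ) := by
  have e1 := ind_inf_le ((A.pw (-Δ) • MA).restrictScalars k) ((A.pw C • MA).restrictScalars k)
    ((B.pw (-Δ) • MB).restrictScalars k) ((B.pw C • MB).restrictScalars k)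
  have e2 : ind ((A.pw (-Δ) • MA).restrictScalars k) ((A.pw C • MA).restrictScalars k) ≤ _ :=
    A.ind_pw_smul h1 hMA hfA (a := -Δ) (b := C) (n := Δ + C) (by push_cast; ring)
  have e3 : ind ((B.pw (-Δ) • MB).restrictScalars k) ((B.pw C • MB).restrictScalars k) ≤ _ :=
    B.ind_pw_smul h1 hMB hfB (a := -Δ) (b := C) (n := Δ + C) (by push_cast; ring)
  have e4 : (A.pw (-Δ) • MA).restrictScalars k ⊓ (B.pw (-Δ) • MB).restrictScalars k ≤
      (A.pw C • stdL A.D K κ).restrictScalars k ⊓ (B.pw C • stdL B.D K κ).restrictScalars k := by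
    intro x hx
    rw [h0 x hx.1 hx.2]
    exact Submodule.zero_mem _
  have e5 := ind_mono e4 (le_refl ((A.pw C • MA).restrictScalars k ⊓ (B.pw C • MB).restrictScalars k))
  have e5a : (A.pw C • stdL A.D K κ) ≤ (A.pw C • MA) := Submodule.smul_mono le_rfl hMA
  have e5b : (B.pw C • stdL B.D K κ) ≤ (B.pw C • MB) := Submodule.smul_mono le_rfl hMB
  have e6 := le_ind_inf (A := (A.pw C • stdL A.D K κ).restrictScalars k)
    (X := (A.pw C • MA).restrictScalars k)
    (A' := (B.pw C • stdL B.D K κ).restrictScalars k)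
    (X' := (B.pw C • MB).restrictScalars k)
    e5a e5b (by
      intro w
      choose s hs t ht hst using K2
      refine ⟨fun i => s (w i), ?_, fun i => t (w i), ?_, ?_⟩
      · exact A.mem_pw_smul_std.2 fun i => hs _
      · exact B.mem_pw_smul_std.2 fun i => ht _
      · funext i; exact hst _)
  have e7 : ind ((A.pw C • stdL A.D K κ).restrictScalars k) ((A.pw C • MA).restrictScalars k) = _ :=
    indD_smul k (A.J ^ (C : ℤ)) hMA hfA
  have e8 : ind ((B.pw C • stdL B.D K κ).restrictScalars k) ((B.pw C • MB).restrictScalars k) = _ :=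
    indD_smul k (B.J ^ (C : ℤ)) hMB hfB
  rw [e7, e8] at e6
  refine e6.trans (e5.trans (e1.trans ((add_le_add e2 e3).trans ?_)))
  push_cast
  ring_nf
  exact le_rfl

theorem num_low (h1 : (1 : K) ∈ L) {C : ℕ}
    (K2 : ∀ x : K, ∃ s ∈ A.pw C, ∃ t ∈ B.pw C, x = s + t)
    {MA : Submodule A.D (κ → K)} {MB : Submodule B.D (κ → K)}
    (Δ : ℕ) (v : κ → κ → K) (hv : LinearIndependent K v)
    (hvA : ∀ i, v i ∈ A.pw (-(Δ + C : ℕ)) • MA) (hvB : ∀ i, v i ∈ B.pw (-(Δ + C : ℕ)) • MB) :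
    ((Δ * (Fintype.card κ * (A.deg + B.deg)) : ℕ) : ℕ∞) ≤
      indD k (stdL A.D K κ) MA + indD k (stdL B.D K κ) MB
        + Fintype.card κ * ind ⊥ (A.pwk 0 ⊓ B.pwk 0) := by
  set E := Δ + C with hE
  have e1 : ind (A.pwk C ⊓ B.pwk C) (A.pwk E ⊓ B.pwk E) ≤ ind ⊥ (A.pwk E ⊓ B.pwk E) :=
    ind_mono bot_le le_rfl
  have e2 := le_ind_inf (A := A.pwk C) (X := A.pwk E) (A' := B.pwk C) (X' := B.pwk E)
    (A.pw_mono h1 (by push_cast [hE]; omega)) (B.pw_mono h1 (by push_cast [hE]; omega)) K2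
  rw [A.ind_pw h1 (n := Δ) (by push_cast [hE]; ring), B.ind_pw h1 (n := Δ) (by push_cast [hE]; ring)] at e2
  have e3 : ind (⊥ : Submodule k (κ → K)) (Submodule.pi Set.univ (fun _ : κ => A.pwk E ⊓ B.pwk E)) ≤
      ind ⊥ (MA.restrictScalars k ⊓ MB.restrictScalars k) := by
    refine ind_le_of_inj ((Fintype.linearCombination K v).restrictScalars k) ?_ ?_
    · intro y _ hy
      rw [Submodule.mem_bot] at hy ⊢
      exact (linearIndependent_iff_injective_fintypeLinearCombination.1 hv) (by rw [map_zero]; exact hy)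
    · intro y hy
      refine ⟨?_, ?_⟩
      · change Fintype.linearCombination K v y ∈ MA
        rw [Fintype.linearCombination_apply]
        refine sum_mem fun i _ => ?_
        have := Submodule.smul_mem_smul (show y i ∈ A.pw E from (hy i trivial).1) (hvA i)
        rw [A.smul_smul_pw, add_neg_cancel, Chart.pw_zero, Submodule.one_smul] at this
        exact this
      · change Fintype.linearCombination K v y ∈ MB
        rw [Fintype.linearCombination_apply]
        refine sum_mem fun i _ => ?_
        have := Submodule.smul_mem_smul (show y i ∈ B.pw E from (hy i trivial).2) (hvB i)
        rw [B.smul_smul_pw, add_neg_cancel, Chart.pw_zero, Submodule.one_smul] at this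
        exact this
  have hbot : (⊥ : Submodule k (κ → K)) = Submodule.pi Set.univ (fun _ : κ => (⊥ : Submodule k K)) := by
    ext x; simp [Submodule.mem_pi, funext_iff]
  have e4 : ind (⊥ : Submodule k (κ → K)) (Submodule.pi Set.univ (fun _ : κ => A.pwk E ⊓ B.pwk E)) =
      Fintype.card κ * ind ⊥ (A.pwk E ⊓ B.pwk E) := by
    rw [hbot, ind_pi]; simp
  have e5 := ind_triangle ⊥ ((stdL A.D K κ).restrictScalars k ⊓ (stdL B.D K κ).restrictScalars k)
    (MA.restrictScalars k ⊓ MB.restrictScalars k)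
  have e6 : ind ⊥ ((stdL A.D K κ).restrictScalars k ⊓ (stdL B.D K κ).restrictScalars k) =
      Fintype.card κ * ind ⊥ (A.pwk 0 ⊓ B.pwk 0) := by
    have : ((stdL A.D K κ).restrictScalars k ⊓ (stdL B.D K κ).restrictScalars k) =
        Submodule.pi Set.univ (fun _ : κ => A.pwk 0 ⊓ B.pwk 0) := by
      ext x
      simp only [Submodule.mem_inf, Submodule.restrictScalars_mem, stdL, Submodule.mem_pi,
        Chart.pwk, Chart.pw_zero]
      exact ⟨fun h i hi => ⟨h.1 i hi, h.2 i hi⟩, fun h => ⟨fun i hi => (h i hi).1, fun i hi => (h i hi).2⟩⟩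
    rw [this, hbot, ind_pi]; simp
  have e7 := ind_inf_le ((stdL A.D K κ).restrictScalars k) (MA.restrictScalars k)
    ((stdL B.D K κ).restrictScalars k) (MB.restrictScalars k)
  rw [e6] at e5
  rw [e4] at e3
  have e8 := (mul_le_mul' (le_refl (Fintype.card κ : ℕ∞)) (e2.trans e1)).trans (e3.trans
    (e5.trans (add_le_add le_rfl e7)))
  rw [add_comm (indD k (stdL A.D K κ) MA + indD k (stdL B.D K κ) MB)]
  refine le_trans (le_of_eq ?_) e8
  push_cast
  ring

end Num
end FThr
end part5


section part6
set_option linter.all false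
open scoped nonZeroDivisors

namespace FThr

universe u
section Syz

variable {k : Type*} {K : Type u} [Field k] [Field K] [Algebra k K] {L : Submodule k K}
  (A B : Chart k K L) {ι : Type*} [Fintype ι]

/-- all relations -/
def Wr (ψ : ι → K) : Submodule K (ι → K) where
  carrier := {a | ∑ i, a i * ψ i = 0}
  zero_mem' := by simp
  add_mem' := by
    intro a b ha hb
    simp only [Set.mem_setOf_eq, Pi.add_apply, add_mul, Finset.sum_add_distrib] at *
    rw [ha, hb, add_zero]
  smul_mem' := by
    intro c a ha
    simp only [Set.mem_setOf_eq, Pi.smul_apply, smul_eq_mul, mul_assoc, ← Finset.mul_sum] at *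
    rw [ha, mul_zero]

lemma mem_Wr {ψ a : ι → K} : a ∈ Wr ψ ↔ ∑ i, a i * ψ i = 0 := Iff.rfl

/-- relations of level `m` -/
noncomputable def Chart.Vs (ψ : ι → K) (e : ι → ℤ) (m : ℤ) : Submodule A.D (ι → K) where
  carrier := {a | a ∈ Wr ψ ∧ ∀ i, a i ∈ A.pw (m - e i)}
  zero_mem' := ⟨zero_mem _, fun i => zero_mem _⟩
  add_mem' := fun ha hb => ⟨add_mem ha.1 hb.1, fun i => add_mem (ha.2 i) (hb.2 i)⟩
  smul_mem' := by
    intro c a ha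
    refine ⟨?_, fun i => Submodule.smul_mem _ _ (ha.2 i)⟩
    rw [← algebraMap_smul K c a]
    exact Submodule.smul_mem _ _ ha.1

lemma Chart.mem_Vs {ψ : ι → K} {e : ι → ℤ} {m : ℤ} {a : ι → K} :
    a ∈ A.Vs ψ e m ↔ a ∈ Wr ψ ∧ ∀ i, a i ∈ A.pw (m - e i) := Iff.rfl

lemma Chart.Vs_mono (h1 : (1 : K) ∈ L) {ψ : ι → K} {e : ι → ℤ} {m m' : ℤ} (h : m ≤ m') :
    A.Vs ψ e m ≤ A.Vs ψ e m' := fun a ha =>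
  ⟨ha.1, fun i => A.pw_mono h1 (by omega) (ha.2 i)⟩

lemma Chart.smul_mem_Vs {ψ : ι → K} {e : ι → ℤ} {m a m' : ℤ} {c : K} (hc : c ∈ A.pw a) {x : ι → K}
    (hx : x ∈ A.Vs ψ e m) (h : a + m = m') : c • x ∈ A.Vs ψ e m' := by
  refine ⟨Submodule.smul_mem _ _ hx.1, fun i => ?_⟩
  have := A.mul_mem hc (hx.2 i)
  rwa [show a + (m - e i) = m' - e i by omega] at this

lemma Chart.pw_smul_Vs (ψ : ι → K) (e : ι → ℤ) (m a : ℤ) :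
    A.pw a • A.Vs ψ e m = A.Vs ψ e (a + m) := by
  have h : ∀ a m, A.pw a • A.Vs ψ e m ≤ A.Vs ψ e (a + m) := by
    intro a m
    rw [Submodule.smul_le]
    intro c hc x hx
    exact A.smul_mem_Vs hc hx rfl
  refine le_antisymm (h a m) ?_
  calc A.Vs ψ e (a + m) = A.pw a • (A.pw (-a) • A.Vs ψ e (a + m)) := by
        rw [A.smul_smul_pw, add_neg_cancel, Chart.pw_zero, Submodule.one_smul]
    _ ≤ A.pw a • A.Vs ψ e (-a + (a + m)) := Submodule.smul_mono le_rfl (h _ _)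
    _ = _ := by rw [neg_add_cancel_left]

lemma Chart.Vs_fg (ψ : ι → K) (e : ι → ℤ) (m : ℤ) : (A.Vs ψ e m).FG := by
  have h1 : (Submodule.pi Set.univ (fun i => A.pw (m - e i)) : Submodule A.D (ι → K)).FG :=
    Submodule.fg_pi (fun i => unit_fg _)
  have : IsNoetherian A.D (Submodule.pi Set.univ (fun i => A.pw (m - e i)) : Submodule A.D (ι → K)) :=
    isNoetherian_of_fg_of_noetherian _ h1
  exact Submodule.FG.of_le h1 (fun a ha i _ => ha.2 i)

lemma sum_single_eq [DecidableEq ι] (j : ι) (f : ι → K) :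
    ∑ i, (Pi.single j (f i) : ι → K) = Pi.single j (∑ i, f i) :=
  (map_sum (AddMonoidHom.single (fun _ : ι => K) j) f Finset.univ).symm

lemma sub_pow_of_hq {q : ℕ} (hq : ∀ x y : K, (x + y) ^ q = x ^ q + y ^ q) (x y : K) :
    (x - y) ^ q = x ^ q - y ^ q := by
  rw [eq_sub_iff_add_eq, ← hq, sub_add_cancel]

lemma sum_pow_of_hq {q : ℕ} (hq0 : q ≠ 0) (hq : ∀ x y : K, (x + y) ^ q = x ^ q + y ^ q) (s : Finset ι)
    (f : ι → K) : (∑ i ∈ s, f i) ^ q = ∑ i ∈ s, f i ^ q := by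
  classical
  induction s using Finset.induction_on with
  | empty => simp [hq0]
  | insert a s ha ih => rw [Finset.sum_insert ha, Finset.sum_insert ha, hq, ih]

lemma Chart.pw_pow (m : ℤ) (q : ℕ) : A.pw m ^ q = A.pw (q * m) := by
  rw [Chart.pw, Chart.pw, ← Units.val_pow_eq_pow_val, ← zpow_natCast, ← zpow_mul, mul_comm]

lemma Chart.pow_mem {m : ℤ} {x : K} (hx : x ∈ A.pw m) (q : ℕ) : x ^ q ∈ A.pw (q * m) := by
  rw [← A.pw_pow]; exact Submodule.pow_mem_pow _ hx q

lemma frob_mem_Wr {q : ℕ} (hq0 : q ≠ 0) (hq : ∀ x y : K, (x + y) ^ q = x ^ q + y ^ q)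
    {ψ a : ι → K} (h : a ∈ Wr ψ) : frob q a ∈ Wr (frob q ψ) := by
  rw [mem_Wr] at *
  simp only [frob, ← mul_pow]
  rw [← sum_pow_of_hq hq0 hq, h, zero_pow hq0]

lemma Chart.frob_mem_Vs {q : ℕ} (hq0 : q ≠ 0) (hq : ∀ x y : K, (x + y) ^ q = x ^ q + y ^ q)
    {ψ : ι → K} {e : ι → ℤ} {m : ℤ} {a : ι → K} (h : a ∈ A.Vs ψ e m) :
    frob q a ∈ A.Vs (frob q ψ) (fun i => q * e i) (q * m) := by
  refine ⟨frob_mem_Wr hq0 hq h.1, fun i => ?_⟩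
  rw [← mul_sub]
  exact A.pow_mem (h.2 i) q

/-- Frobenius pullback of the syzygy lattice -/
theorem Chart.Fr_Vs {q : ℕ} (hq0 : q ≠ 0) (hq : ∀ x y : K, (x + y) ^ q = x ^ q + y ^ q)
    {ψ : ι → K} {e : ι → ℤ} (hψ : ∀ i, ψ i ∈ A.pw (e i)) {β : ι → K} (hβ : ∀ i, β i ∈ A.pw (- e i))
    (hβ1 : ∑ i, β i * ψ i = 1) (m : ℤ) :
    Fr q (A.Vs ψ e m) = A.Vs (frob q ψ) (fun i => q * e i) (q * m) := by
  classical
  apply le_antisymm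
  · rw [Fr, Submodule.span_le]
    rintro _ ⟨x, hx, rfl⟩
    exact A.frob_mem_Vs hq0 hq hx
  · intro a ha
    have h1 : ∑ i, β i ^ q * ψ i ^ q = 1 := by
      simp only [← mul_pow]
      rw [← sum_pow_of_hq hq0 hq, hβ1, one_pow]
    have ha1 : ∑ j, a j * ψ j ^ q = 0 := ha.1
    have key : a = ∑ i, ∑ j, (a j * β i ^ q) • (Pi.single j (ψ i ^ q) - Pi.single i (ψ j ^ q) : ι → K) := by
      have e1 : ∑ i, ∑ j, (a j * β i ^ q) • (Pi.single j (ψ i ^ q) : ι → K) = a := by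
        rw [Finset.sum_comm]
        simp only [← Pi.single_smul, smul_eq_mul]
        have : ∀ j, ∑ i, (Pi.single j (a j * β i ^ q * ψ i ^ q) : ι → K) = Pi.single j (a j) := by
          intro j
          rw [sum_single_eq j (fun i => a j * β i ^ q * ψ i ^ q)]
          simp only [mul_assoc, ← Finset.mul_sum, h1, mul_one]
        simp only [this]
        exact Finset.univ_sum_single a
      have e2 : ∑ i, ∑ j, (a j * β i ^ q) • (Pi.single i (ψ j ^ q) : ι → K) = 0 := by
        refine Finset.sum_eq_zero fun i _ => ?_
        simp only [← Pi.single_smul, smul_eq_mul]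
        rw [sum_single_eq i (fun x => a x * β i ^ q * ψ x ^ q)]
        have : ∑ x, a x * β i ^ q * ψ x ^ q = β i ^ q * ∑ x, a x * ψ x ^ q := by
          rw [Finset.mul_sum]; exact Finset.sum_congr rfl fun _ _ => by ring
        rw [this, ha1, mul_zero, Pi.single_zero]
      simp only [smul_sub, Finset.sum_sub_distrib]
      rw [e1, e2, sub_zero]
    rw [key]
    refine sum_mem fun i _ => sum_mem fun j _ => ?_
    have hc : a j * β i ^ q ∈ (A.pw (m - e j - e i)) ^ q := by
      rw [A.pw_pow]
      have := A.mul_mem (ha.2 j) (A.pow_mem (hβ i) q)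
      rwa [show (q * m - q * e j + q * - e i : ℤ) = q * (m - e j - e i) by ring] at this
    rw [Chart.pw, ← span_pow_eq] at hc
    refine Submodule.span_induction (p := fun c _ => c • (Pi.single j (ψ i ^ q) - Pi.single i (ψ j ^ q) : ι → K) ∈ Fr q (A.Vs ψ e m)) ?_ ?_ ?_ ?_ hc
    · rintro _ ⟨c, hc, rfl⟩
      have hc' : c ∈ A.pw (m - e j - e i) := hc
      have e3 : frob q (c • (Pi.single j (ψ i) - Pi.single i (ψ j) : ι → K)) =
          c ^ q • (Pi.single j (ψ i ^ q) - Pi.single i (ψ j ^ q) : ι → K) := by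
        rw [frob_smul]
        congr 1
        funext l
        simp only [frob, Pi.sub_apply]
        rw [sub_pow_of_hq hq]
        congr 1
        · by_cases h : l = j
          · subst h; simp
          · simp [h, hq0]
        · by_cases h : l = i
          · subst h; simp
          · simp [h, hq0]
      have e4 : c • (Pi.single j (ψ i) - Pi.single i (ψ j) : ι → K) ∈ A.Vs ψ e m := by
        refine ⟨?_, ?_⟩
        · refine Submodule.smul_mem _ _ ?_
          rw [mem_Wr]
          simp only [Pi.sub_apply, sub_mul, Finset.sum_sub_distrib]
          simp [Pi.single_apply, mul_comm]
        · intro l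
          simp only [Pi.smul_apply, Pi.sub_apply, mul_sub, smul_eq_mul]
          refine sub_mem ?_ ?_
          · by_cases h : l = j
            · subst h
              have := A.mul_mem hc' (hψ i)
              simpa using this
            · simp [h]
          · by_cases h : l = i
            · subst h
              have := A.mul_mem hc' (hψ j)
              rw [show m - e j - e l + e j = m - e l by ring] at this
              simpa using this
            · simp [h]
      have := frob_mem_Fr (q := q) e4
      rw [e3] at this
      exact this
    · simp
    · intro x y _ _ hx hy; rw [add_smul]; exact add_mem hx hy
    · intro r x _ hx; rw [smul_assoc]; exact Submodule.smul_mem _ _ hx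

/-- powers of `L`, extended by zero -/
noncomputable def Lz (L : Submodule k K) (m : ℤ) : Submodule k K := if 0 ≤ m then L ^ m.toNat else ⊥

lemma Lz_nat (m : ℕ) : Lz L m = L ^ m := by simp [Lz]

lemma Chart.Lpow_le {m : ℕ} {x : K} (hx : x ∈ L ^ m) : x ∈ A.pw m := by
  have : L ^ m ≤ (A.pw m).restrictScalars k := by
    clear hx
    induction m with
    | zero =>
      rw [pow_zero, Submodule.one_le]
      simp
    | succ n ih =>
      rw [pow_succ, Submodule.mul_le]
      intro a ha b hb
      have hb' : b ∈ A.pw 1 := by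
        rw [Chart.pw, zpow_one]; exact A.L_le b hb
      exact A.mul_mem (ih ha) hb'
  exact this hx

lemma Chart.Lz_le {m : ℤ} {x : K} (hx : x ∈ Lz L m) : x ∈ A.pw m := by
  rw [Lz] at hx
  split_ifs at hx with h
  · have := A.Lpow_le hx
    rwa [Int.toNat_of_nonneg h] at this
  · rw [Submodule.mem_bot] at hx
    rw [hx]; exact zero_mem _

lemma Chart.pw_nat (m : ℕ) : A.pw m = Submodule.span A.D ((L ^ m : Submodule k K) : Set K) := by
  rw [Chart.pw, zpow_natCast, Units.val_pow_eq_pow_val, A.hJ, Submodule.span_pow]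
  apply le_antisymm
  · apply Submodule.span_mono
    exact Submodule.pow_subset_pow _
  · rw [Submodule.span_le, ← Submodule.span_pow]
    intro x hx
    have := A.Lpow_le hx
    rw [Chart.pw, zpow_natCast, Units.val_pow_eq_pow_val, A.hJ] at this
    exact this

/-- degree `m` part of the ideal generated by the `ψ i` -/
def Gz (L : Submodule k K) (ψ : ι → K) (e : ι → ℤ) (m : ℤ) : Submodule k K where
  carrier := {x | ∃ a : ι → K, (∀ i, a i ∈ Lz L (m - e i)) ∧ x = ∑ i, a i * ψ i}
  zero_mem' := ⟨0, fun i => zero_mem _, by simp⟩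
  add_mem' := by
    rintro _ _ ⟨a, ha, rfl⟩ ⟨b, hb, rfl⟩
    exact ⟨a + b, fun i => add_mem (ha i) (hb i), by simp [add_mul, Finset.sum_add_distrib]⟩
  smul_mem' := by
    rintro c _ ⟨a, ha, rfl⟩
    exact ⟨c • a, fun i => Submodule.smul_mem _ _ (ha i), by simp [Finset.smul_sum]⟩

lemma mem_Gz {ψ : ι → K} {e : ι → ℤ} {m : ℤ} {x : K} : x ∈ Gz L ψ e m ↔
  ∃ a : ι → K, (∀ i, a i ∈ Lz L (m - e i)) ∧ x = ∑ i, a i * ψ i := Iff.rfl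

/-- local splitting -/
lemma Chart.exists_beta {ψ : ι → K} {e : ι → ℤ} {m : ℕ} (hgood : L ^ m ≤ Gz L ψ e m) :
    ∃ β : ι → K, (∀ i, β i ∈ A.pw (- e i)) ∧ ∑ i, β i * ψ i = 1 := by
  -- the module of sums
  have h : ∀ x ∈ A.pw m, ∃ β : ι → K, (∀ i, β i ∈ A.pw (m - e i)) ∧ ∑ i, β i * ψ i = x := by
    intro x hx
    rw [A.pw_nat] at hx
    refine Submodule.span_induction (p := fun x _ => ∃ β : ι → K, (∀ i, β i ∈ A.pw (m - e i)) ∧ ∑ i, β i * ψ i = x) ?_ ?_ ?_ ?_ hx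
    · intro x hx
      obtain ⟨a, ha, rfl⟩ := hgood hx
      exact ⟨a, fun i => A.Lz_le (ha i), rfl⟩
    · exact ⟨0, fun i => zero_mem _, by simp⟩
    · rintro x y _ _ ⟨a, ha, rfl⟩ ⟨b, hb, rfl⟩
      exact ⟨a + b, fun i => add_mem (ha i) (hb i), by simp [add_mul, Finset.sum_add_distrib]⟩
    · rintro c x _ ⟨a, ha, rfl⟩
      exact ⟨c • a, fun i => Submodule.smul_mem _ _ (ha i), by simp [Finset.smul_sum]⟩
  have h1 : (1 : K) ∈ A.pw (-m) * A.pw m := by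
    rw [A.pw_mul, neg_add_cancel, Chart.pw_zero]; exact Submodule.one_le.1 le_rfl
  refine Submodule.mul_induction_on (C := fun x => ∃ β : ι → K, (∀ i, β i ∈ A.pw (- e i)) ∧ ∑ i, β i * ψ i = x) h1 ?_ ?_
  · intro c hc x hx
    obtain ⟨β, hβ, rfl⟩ := h x hx
    refine ⟨c • β, fun i => ?_, by simp [Finset.mul_sum, mul_assoc]⟩
    have := A.mul_mem hc (hβ i)
    rwa [show -(m : ℤ) + (m - e i) = - e i by ring] at this
  · rintro x y ⟨a, ha, rfl⟩ ⟨b, hb, rfl⟩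
    exact ⟨a + b, fun i => add_mem (ha i) (hb i), by simp [add_mul, Finset.sum_add_distrib]⟩

/-- from a splitting of powers to a splitting -/
lemma Chart.beta_of_pow {φ : ι → K} {d : ι → ℤ} (hφ : ∀ i, φ i ∈ A.pw (d i)) {q : ℕ} (hq0 : q ≠ 0)
    (h : ∃ β : ι → K, (∀ i, β i ∈ A.pw (- (q * d i))) ∧ ∑ i, β i * frob q φ i = 1) :
    ∃ β : ι → K, (∀ i, β i ∈ A.pw (- d i)) ∧ ∑ i, β i * φ i = 1 := by
  obtain ⟨β, hβ, h1⟩ := h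
  refine ⟨fun i => β i * φ i ^ (q - 1), fun i => ?_, ?_⟩
  · have := A.mul_mem (hβ i) (A.pow_mem (hφ i) (q - 1))
    rwa [Nat.cast_pred (Nat.pos_of_ne_zero hq0), show -((q : ℤ) * d i) + (q - 1) * d i = - d i by ring] at this
  · rw [← h1]
    refine Finset.sum_congr rfl fun i _ => ?_
    rw [mul_assoc, ← pow_succ, Nat.sub_add_cancel (Nat.one_le_iff_ne_zero.2 hq0)]
    rfl

end Syz
end FThr
end part6


section part7
set_option linter.all false
open scoped nonZeroDivisors

namespace FThr

universe u

/-- a curve with two charts -/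
structure Setup (k : Type*) (K : Type u) [Field k] [Field K] [Algebra k K] (L : Submodule k K) where
  A : Chart k K L
  B : Chart k K L
  oneL : (1 : K) ∈ L
  Lfd : Module.Finite k L
  frac : ∀ x : K, ∃ (e : ℕ) (b : K), b ∈ L ^ e ∧ b ≠ 0 ∧ b * x ∈ L ^ e
  C : ℕ
  K2 : ∀ x : K, ∃ s ∈ A.pw C, ∃ t ∈ B.pw C, x = s + t
  h0 : ind ⊥ (A.pwk 0 ⊓ B.pwk 0) ≠ ⊤
  z : K
  hz : z ∉ B.pw 0

section Two

variable {k : Type*} {K : Type u} [Field k] [Field K] [Algebra k K] {L : Submodule k K}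
  (E : Setup k K L) {ι : Type*} [Fintype ι]

lemma Lpow_mono (h1 : (1 : K) ∈ L) {a b : ℕ} (h : a ≤ b) : L ^ a ≤ L ^ b :=
  pow_le_pow_right' (Submodule.one_le.2 h1) h

lemma Lpow_mul {a b : ℕ} {x y : K} (hx : x ∈ L ^ a) (hy : y ∈ L ^ b) : x * y ∈ L ^ (a + b) := by
  rw [pow_add]; exact Submodule.mul_mem_mul hx hy

lemma Setup.frac_fin {k : Type*} {K : Type u} [Field k] [Field K] [Algebra k K] {L : Submodule k K}
    (E : Setup k K L) (s : Finset K) :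
    ∃ (e : ℕ) (b : K), b ∈ L ^ e ∧ b ≠ 0 ∧ ∀ x ∈ s, b * x ∈ L ^ e := by
  classical
  induction s using Finset.induction_on with
  | empty => exact ⟨0, 1, by simp, one_ne_zero, by simp⟩
  | insert a s ha ih =>
    obtain ⟨e, b, hb, hb0, h⟩ := ih
    obtain ⟨e', b', hb', hb0', h'⟩ := E.frac a
    refine ⟨e + e', b * b', Lpow_mul hb hb', mul_ne_zero hb0 hb0', ?_⟩
    intro x hx
    rcases Finset.mem_insert.1 hx with rfl | hx
    · rw [mul_assoc]; exact Lpow_mul hb h'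
    · rw [mul_right_comm]; exact Lpow_mul (h x hx) hb'

/-- sections of level `m` -/
def Setup.sec (ψ : ι → K) (e : ι → ℤ) (m : ℤ) : Set (ι → K) :=
  {a | a ∈ E.A.Vs ψ e m ∧ a ∈ E.B.Vs ψ e m}

/-- span of the sections -/
noncomputable def Setup.U (ψ : ι → K) (e : ι → ℤ) (m : ℤ) : Submodule K (ι → K) :=
  Submodule.span K (E.sec ψ e m)

/-- global sections -/
noncomputable def Setup.Rt (m : ℤ) : Submodule k K := E.A.pwk m ⊓ E.B.pwk m

lemma Setup.mem_Rt {m : ℤ} {x : K} : x ∈ E.Rt m ↔ x ∈ E.A.pw m ∧ x ∈ E.B.pw m := Iff.rfl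

lemma Setup.Rt_mono {a b : ℤ} (h : a ≤ b) : E.Rt a ≤ E.Rt b :=
  inf_le_inf (E.A.pw_mono E.oneL h) (E.B.pw_mono E.oneL h)

lemma Setup.Rt_mul {a b : ℤ} {x y : K} (hx : x ∈ E.Rt a) (hy : y ∈ E.Rt b) : x * y ∈ E.Rt (a + b) :=
  ⟨E.A.mul_mem hx.1 hy.1, E.B.mul_mem hx.2 hy.2⟩

lemma Setup.Lpow_Rt {m : ℕ} {x : K} (hx : x ∈ L ^ m) : x ∈ E.Rt m := ⟨E.A.Lpow_le hx, E.B.Lpow_le hx⟩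

lemma Setup.Lz_Rt {m : ℤ} {x : K} (hx : x ∈ Lz L m) : x ∈ E.Rt m := ⟨E.A.Lz_le hx, E.B.Lz_le hx⟩

lemma Setup.Rt_fin (m : ℕ) : Module.Finite k (E.Rt m) := by
  apply finite_of_ind_ne_top
  have h1 := ind_triangle ⊥ (E.Rt 0) (E.Rt m)
  have h2 := ind_inf_le (E.A.pwk 0) (E.A.pwk m) (E.B.pwk 0) (E.B.pwk m)
  rw [E.A.ind_pw E.oneL (n := m) (by simp), E.B.ind_pw E.oneL (n := m) (by simp)] at h2
  refine ne_top_of_le_ne_top ?_ (h1.trans (add_le_add le_rfl h2))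
  refine WithTop.add_ne_top.2 ⟨E.h0, ?_⟩
  exact_mod_cast ENat.coe_ne_top (m * E.A.deg + m * E.B.deg)

lemma Setup.sec_mono {ψ : ι → K} {e : ι → ℤ} {a b : ℤ} (h : a ≤ b) : E.sec ψ e a ⊆ E.sec ψ e b :=
  fun _ hx => ⟨E.A.Vs_mono E.oneL h hx.1, E.B.Vs_mono E.oneL h hx.2⟩

lemma Setup.U_mono {ψ : ι → K} {e : ι → ℤ} {a b : ℤ} (h : a ≤ b) : E.U ψ e a ≤ E.U ψ e b :=
  Submodule.span_mono (E.sec_mono h)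

lemma Setup.U_le (ψ : ι → K) (e : ι → ℤ) (m : ℤ) : E.U ψ e m ≤ Wr ψ := by
  rw [Setup.U, Submodule.span_le]; exact fun x hx => hx.1.1

lemma Setup.split {ψ : ι → K} {e : ι → ℤ} {m m' : ℤ} (hm : m + E.C ≤ m') {x : ι → K} (hx : x ∈ E.U ψ e m) :
    ∃ a ∈ E.A.Vs ψ e m', ∃ b ∈ E.B.Vs ψ e m', a ∈ E.U ψ e m ∧ b ∈ E.U ψ e m ∧ x = a + b := by
  refine Submodule.closure_induction (p := fun x _ => ∃ a ∈ E.A.Vs ψ e m', ∃ b ∈ E.B.Vs ψ e m', a ∈ E.U ψ e m ∧ b ∈ E.U ψ e m ∧ x = a + b) ?_ ?_ ?_ hx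
  · exact ⟨0, zero_mem _, 0, zero_mem _, zero_mem _, zero_mem _, by simp⟩
  · rintro x y _ _ ⟨a, ha, b, hb, ha', hb', rfl⟩ ⟨c, hc, d, hd, hc', hd', rfl⟩
    exact ⟨a + c, add_mem ha hc, b + d, add_mem hb hd, add_mem ha' hc', add_mem hb' hd', by abel⟩
  · intro c x hx
    obtain ⟨s, hs, t, ht, rfl⟩ := E.K2 c
    have hxU : x ∈ E.U ψ e m := Submodule.subset_span hx
    refine ⟨s • x, E.A.Vs_mono E.oneL hm (E.A.smul_mem_Vs hs hx.1 (add_comm _ _)), t • x,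
      E.B.Vs_mono E.oneL hm (E.B.smul_mem_Vs ht hx.2 (add_comm _ _)), Submodule.smul_mem _ _ hxU,
      Submodule.smul_mem _ _ hxU, add_smul _ _ _⟩

/-- (b1') -/
lemma Setup.b1 {ψ : ι → K} {e : ι → ℤ} {m0 : ℕ} (hgood : L ^ m0 ≤ Gz L ψ e m0) {m M : ℤ}
    (hU : E.U ψ e m = Wr ψ) (hM : m + E.C ≤ M) {g : K} (hg : g ∈ E.Rt M) :
    ∃ γ : ι → K, (∀ i, γ i ∈ E.Rt (M - e i)) ∧ ∑ i, γ i * ψ i = g := by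
  obtain ⟨β, hβ, hβ1⟩ := E.A.exists_beta hgood
  obtain ⟨β', hβ', hβ1'⟩ := E.B.exists_beta hgood
  have e1 : ∑ i, (g • β) i * ψ i = g := by
    simp [mul_assoc, ← Finset.mul_sum, hβ1]
  have e2 : ∑ i, (g • β') i * ψ i = g := by
    simp [mul_assoc, ← Finset.mul_sum, hβ1']
  have h1 : g • β - g • β' ∈ E.U ψ e m := by
    rw [hU, mem_Wr]
    simp only [Pi.sub_apply, sub_mul, Finset.sum_sub_distrib]
    rw [e1, e2, sub_self]
  obtain ⟨a, ha, b, hb, -, -, hab⟩ := E.split hM h1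
  have hab' : g • β - a = g • β' + b := by rw [sub_eq_iff_eq_add] at hab ⊢; rw [hab]; abel
  refine ⟨g • β - a, fun i => ⟨?_, ?_⟩, ?_⟩
  · exact sub_mem (by have := E.A.mul_mem hg.1 (hβ i); rwa [← sub_eq_add_neg] at this) (ha.2 i)
  · rw [hab']
    exact add_mem (by have := E.B.mul_mem hg.2 (hβ' i); rwa [← sub_eq_add_neg] at this) (hb.2 i)
  · simp only [Pi.sub_apply, sub_mul, Finset.sum_sub_distrib]
    rw [e1, (mem_Wr.1 ha.1), sub_zero]

/-- sections generate for large level -/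
lemma Setup.exists_U_eq (ψ : ι → K) (e : ι → ℤ) : ∃ m : ℕ, ∀ m' : ℤ, (m : ℤ) ≤ m' → E.U ψ e m' = Wr ψ := by
  classical
  obtain ⟨s, hs⟩ := (inferInstance : Module.Finite K (Wr ψ)).fg_top
  obtain ⟨N, b, hb, hb0, h⟩ := E.frac_fin ((s ×ˢ (Finset.univ : Finset ι)).image
    (fun p => (p.1 : ι → K) p.2))
  refine ⟨N + ∑ i, (e i).natAbs, fun m' hm' => le_antisymm (E.U_le _ _ _) ?_⟩
  have hs' : Submodule.map (Wr ψ).subtype (Submodule.span K (s : Set (Wr ψ))) = Wr ψ := by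
    rw [hs]; simp
  rw [← hs', Submodule.map_span, Submodule.span_le]
  rintro _ ⟨w, hw, rfl⟩
  have h1 : b • (w : ι → K) ∈ E.sec ψ e m' := by
    have hei : ∀ i, (N : ℤ) ≤ m' - e i := by
      intro i
      have := Finset.single_le_sum (f := fun i => (e i).natAbs) (fun _ _ => Nat.zero_le _) (Finset.mem_univ i)
      push_cast at hm'
      have h3 : (((e i).natAbs : ℕ) : ℤ) ≤ ((∑ i, (e i).natAbs : ℕ) : ℤ) := by exact_mod_cast this
      push_cast at h3
      have : e i ≤ |e i| := le_abs_self _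
      omega
    have hL : ∀ i, b * (w : ι → K) i ∈ L ^ N := fun i => h _ (Finset.mem_image.2 ⟨(w, i), by simpa using hw, rfl⟩)
    exact ⟨⟨Submodule.smul_mem _ _ w.2, fun i => E.A.pw_mono E.oneL (hei i) (E.A.Lpow_le (hL i))⟩,
      ⟨Submodule.smul_mem _ _ w.2, fun i => E.B.pw_mono E.oneL (hei i) (E.B.Lpow_le (hL i))⟩⟩
  have h2 : (w : ι → K) = b⁻¹ • b • (w : ι → K) := by rw [smul_smul, inv_mul_cancel₀ hb0, one_smul]
  simp only [Submodule.subtype_apply]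
  rw [h2]
  exact Submodule.smul_mem _ _ (Submodule.subset_span h1)

/-- global sections are eventually generated by `L` -/
lemma Setup.exists_Rt_gen : ∃ C1 : ℕ, ∀ m : ℕ, E.Rt (m + C1 : ℕ) ≤ L ^ m * E.Rt C1 := by
  classical
  haveI := E.Lfd
  obtain ⟨s, hs⟩ := (Module.Finite.iff_fg.1 E.Lfd)
  set ψ : s → K := fun x => x
  set e : s → ℤ := fun _ => 1
  have hsL : ∀ i, ψ i ∈ L := fun i => by rw [← hs]; exact Submodule.subset_span i.2
  have hgood : L ^ 1 ≤ Gz L ψ e (1 : ℕ) := by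
    rw [pow_one, ← hs, Submodule.span_le]
    intro x hx
    refine ⟨Pi.single ⟨x, hx⟩ 1, fun i => ?_, ?_⟩
    · by_cases h : i = ⟨x, hx⟩
      · subst h; simp [e, Lz]
      · simp [h]
    · simp [Pi.single_apply, ψ]
  obtain ⟨m0, hm0⟩ := E.exists_U_eq ψ e
  have key : ∀ M : ℕ, m0 + E.C ≤ M + 1 → E.Rt (M + 1 : ℕ) ≤ L * E.Rt M := by
    intro M hM g hg
    obtain ⟨γ, hγ, rfl⟩ := E.b1 hgood (hm0 m0 le_rfl) (M := (M + 1 : ℕ)) (by exact_mod_cast hM) hg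
    refine sum_mem fun i _ => ?_
    refine (mul_comm (ψ i) (γ i)) ▸ Submodule.mul_mem_mul (hsL i) ?_
    have := hγ i
    simpa [e] using this
  refine ⟨m0 + E.C, fun m => ?_⟩
  induction m with
  | zero => simp
  | succ m ih =>
    have := key (m + (m0 + E.C)) (by omega)
    rw [show m + 1 + (m0 + E.C) = m + (m0 + E.C) + 1 by ring, pow_succ', mul_assoc]
    exact this.trans (mul_le_mul' le_rfl ih)

/-- conductor -/
lemma Setup.exists_cond : ∃ (e' : ℕ) (v : K), v ∈ L ^ e' ∧ v ≠ 0 ∧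
    ∀ (M : ℕ) (x : K), x ∈ E.Rt M → v * x ∈ L ^ (M + e') := by
  classical
  obtain ⟨C1, h1⟩ := E.exists_Rt_gen
  haveI := E.Rt_fin C1
  obtain ⟨s, hs⟩ := (Module.Finite.iff_fg.1 (E.Rt_fin C1))
  obtain ⟨e', v, hv, hv0, h⟩ := E.frac_fin s
  have h2 : ∀ x ∈ E.Rt C1, v * x ∈ L ^ e' := by
    intro x hx
    rw [← hs] at hx
    refine Submodule.span_induction (p := fun x _ => v * x ∈ L ^ e') (fun x hx => h x hx) (by simp) ?_ ?_ hx
    · intro x y _ _ hx hy; rw [mul_add]; exact add_mem hx hy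
    · intro c x _ hx; rw [mul_smul_comm]; exact Submodule.smul_mem _ _ hx
  refine ⟨e', v, hv, hv0, fun M x hx => ?_⟩
  rcases le_total M C1 with hM | hM
  · exact Lpow_mono E.oneL (by omega) (h2 x (E.Rt_mono (by exact_mod_cast hM) hx))
  · have hx' := h1 (M - C1) (by rwa [Nat.sub_add_cancel hM])
    refine Submodule.mul_induction_on hx' ?_ ?_
    · intro a ha b hb
      rw [mul_left_comm]
      exact Lpow_mono E.oneL (by omega) (Lpow_mul ha (h2 b hb))
    · intro x y hx hy; rw [mul_add]; exact add_mem hx hy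

lemma K2' {m : ℤ} (hm : (E.C : ℤ) ≤ m) (x : K) : ∃ s ∈ E.A.pw m, ∃ t ∈ E.B.pw m, x = s + t := by
  obtain ⟨s, hs, t, ht, h⟩ := E.K2 x
  exact ⟨s, E.A.pw_mono E.oneL hm hs, t, E.B.pw_mono E.oneL hm ht, h⟩

/-- (b2), first half -/
lemma Setup.b2a {C1 : ℕ} (hC1 : ∀ m : ℕ, E.Rt (m + C1 : ℕ) ≤ L ^ m * E.Rt C1)
    {ψ : ι → K} {e : ι → ℤ} (hψ : ∀ i, ψ i ∈ E.Rt (e i)) {m : ℕ} (hgood : L ^ m ≤ Gz L ψ e m)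
    (hm : ∀ i, e i + E.C ≤ m) (w : ι → K) (hw : w ∈ Wr ψ) :
    ∃ a ∈ E.A.Vs ψ e (m + C1 : ℕ), ∃ b ∈ E.B.Vs ψ e (m + C1 : ℕ), w = a + b := by
  have hgood' : ∀ g ∈ E.Rt (m + C1 : ℕ), ∃ γ : ι → K, (∀ i, γ i ∈ E.Rt ((m + C1 : ℕ) - e i)) ∧ ∑ i, γ i * ψ i = g := by
    intro g hg
    refine Submodule.mul_induction_on (C := fun g => ∃ γ : ι → K, (∀ i, γ i ∈ E.Rt ((m + C1 : ℕ) - e i)) ∧ ∑ i, γ i * ψ i = g) (hC1 m hg) ?_ ?_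
    · intro x hx y hy
      obtain ⟨a, ha, rfl⟩ := hgood hx
      refine ⟨y • a, fun i => ?_, ?_⟩
      · have := E.Rt_mul hy (E.Lz_Rt (ha i))
        rwa [show (C1 : ℤ) + (m - e i) = (m + C1 : ℕ) - e i by push_cast; ring] at this
      · simp only [Pi.smul_apply, smul_eq_mul, mul_assoc, ← Finset.mul_sum]
        rw [mul_comm]
    · rintro x y ⟨a, ha, rfl⟩ ⟨b, hb, rfl⟩
      exact ⟨a + b, fun i => add_mem (ha i) (hb i), by simp [add_mul, Finset.sum_add_distrib]⟩
  have h1 : ∀ i, ∃ s ∈ E.A.pw ((m + C1 : ℕ) - e i), ∃ t ∈ E.B.pw ((m + C1 : ℕ) - e i), w i = s + t := by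
    intro i
    exact K2' E (by have := hm i; push_cast; omega) (w i)
  choose s hs t ht hst using h1
  have hg : ∑ i, s i * ψ i = - ∑ i, t i * ψ i := by
    rw [eq_neg_iff_add_eq_zero, ← Finset.sum_add_distrib, ← mem_Wr.1 hw]
    exact Finset.sum_congr rfl fun i _ => by rw [hst, add_mul]
  obtain ⟨γ, hγ, hγ1⟩ := hgood' (∑ i, s i * ψ i) (by
    refine ⟨?_, ?_⟩
    · refine sum_mem fun i _ => ?_
      have := E.A.mul_mem (hs i) (hψ i).1
      rwa [sub_add_cancel] at this
    · rw [hg]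
      refine neg_mem (sum_mem fun i _ => ?_)
      have := E.B.mul_mem (ht i) (hψ i).2
      rwa [sub_add_cancel] at this)
  refine ⟨s - γ, ⟨?_, fun i => sub_mem (hs i) (hγ i).1⟩, t + γ, ⟨?_, fun i => add_mem (ht i) (hγ i).2⟩, ?_⟩
  · rw [mem_Wr]
    simp only [Pi.sub_apply, sub_mul, Finset.sum_sub_distrib]
    rw [hγ1, sub_self]
  · rw [mem_Wr]
    simp only [Pi.add_apply, add_mul, Finset.sum_add_distrib]
    rw [hγ1, hg, add_neg_cancel]
  · funext i
    simp only [Pi.add_apply, Pi.sub_apply]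
    rw [hst]; ring

/-- (b2), second half -/
lemma Setup.b2b {N : ℕ} {a b : K} (ha : a ∈ L ^ N) (hb : b ∈ L ^ N) (hb0 : b ≠ 0) (hz : E.z = a / b)
    {ψ : ι → K} {e : ι → ℤ} {m : ℤ}
    (hW : ∀ w ∈ Wr ψ, ∃ a ∈ E.A.Vs ψ e m, ∃ b ∈ E.B.Vs ψ e m, w = a + b) :
    E.U ψ e (N + m) = Wr ψ := by
  classical
  set U := E.U ψ e (N + m) with hU
  -- first: the image of the B-lattice in the quotient is stable under z
  set Q := (U.mkQ.restrictScalars E.B.D) with hQ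
  set P : Submodule E.B.D ((ι → K) ⧸ U) := Submodule.map Q (E.B.Vs ψ e m) with hP
  have hstab : ∀ x ∈ P, E.z • x ∈ P := by
    rintro _ ⟨w, hw, rfl⟩
    obtain ⟨wa, hwa, wb, hwb, hw2⟩ := hW (E.z • w) (Submodule.smul_mem _ _ hw.1)
    refine ⟨wb, hwb, ?_⟩
    have h1 : b • wa ∈ E.sec ψ e (N + m) := by
      refine ⟨E.A.smul_mem_Vs (E.A.Lpow_le hb) hwa rfl, ?_⟩
      have : b • wa = a • w - b • wb := by
        rw [eq_sub_iff_add_eq, ← smul_add, ← hw2, smul_smul, hz, mul_div_cancel₀ _ hb0]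
      rw [this]
      exact sub_mem (E.B.smul_mem_Vs (E.B.Lpow_le ha) hw rfl) (E.B.smul_mem_Vs (E.B.Lpow_le hb) hwb rfl)
    have h2 : wa ∈ U := by
      have : wa = b⁻¹ • b • wa := by rw [smul_smul, inv_mul_cancel₀ hb0, one_smul]
      rw [this]
      exact Submodule.smul_mem _ _ (Submodule.subset_span h1)
    change U.mkQ wb = E.z • U.mkQ w
    rw [← map_smul, hw2, map_add]
    have h3 : U.mkQ wa = 0 := by simpa using h2
    rw [h3, zero_add]
  have hPfg : P.FG := (E.B.Vs_fg ψ e m).map _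
  have hP0 : P = ⊥ := by
    by_contra hne
    have hint : IsIntegral E.B.D E.z :=
      isIntegral_of_smul_mem_submodule (M := (ι → K) ⧸ U) P hne hPfg E.z hstab
    obtain ⟨y, hy⟩ := IsIntegrallyClosed.isIntegral_iff.1 hint
    apply E.hz
    rw [Chart.pw_zero]
    exact mem_one_iff.2 ⟨y, hy⟩
  refine le_antisymm (E.U_le _ _ _) fun w hw => ?_
  -- scale w into the lattice
  obtain ⟨f, hf0, hf⟩ : ∃ f : K, f ≠ 0 ∧ f • w ∈ E.B.Vs ψ e m := by
    obtain ⟨M, c, hc, hc0, h⟩ := E.frac_fin (Finset.univ.image w)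
    -- an element of very negative level
    have hneg : ∃ g ∈ E.B.pw (m - M - ∑ i, (e i).natAbs), g ≠ 0 := by
      by_contra hcon
      push Not at hcon
      have hbot : E.B.pw (m - M - ∑ i, (e i).natAbs) = ⊥ := by
        rw [eq_bot_iff]; exact hcon
      have := E.B.pw_mul (m - M - ∑ i, (e i).natAbs) (-(m - M - ∑ i, (e i).natAbs))
      rw [hbot, add_neg_cancel, Chart.pw_zero, Submodule.bot_mul] at this
      have h1 : (1 : K) ∈ (⊥ : Submodule E.B.D K) := by rw [this]; exact Submodule.one_le.1 le_rfl
      simp at h1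
    obtain ⟨g, hg, hg0⟩ := hneg
    refine ⟨g * c, mul_ne_zero hg0 hc0, Submodule.smul_mem _ _ hw, fun i => ?_⟩
    have h1 := E.B.mul_mem hg (E.B.Lpow_le (h (w i) (by simp)))
    simp only [Pi.smul_apply, smul_eq_mul, mul_assoc]
    refine E.B.pw_mono E.oneL ?_ h1
    have := Finset.single_le_sum (f := fun i => (e i).natAbs) (fun _ _ => Nat.zero_le _) (Finset.mem_univ i)
    have h3 : (((e i).natAbs : ℕ) : ℤ) ≤ ((∑ i, (e i).natAbs : ℕ) : ℤ) := by exact_mod_cast this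
    push_cast at h3 ⊢
    have : e i ≤ |e i| := le_abs_self _
    omega
  have h1 : Q (f • w) ∈ P := ⟨_, hf, rfl⟩
  rw [hP0, Submodule.mem_bot] at h1
  have h2 : f • w ∈ U := by
    have : U.mkQ (f • w) = 0 := h1
    rwa [Submodule.mkQ_apply, Submodule.Quotient.mk_eq_zero] at this
  have : w = f⁻¹ • f • w := by rw [smul_smul, inv_mul_cancel₀ hf0, one_smul]
  rw [this]
  exact Submodule.smul_mem _ _ h2

/-- (b2) -/
lemma Setup.b2 : ∃ C2 : ℕ, ∀ {ι : Type} [Fintype ι] (ψ : ι → K) (e : ι → ℤ), (∀ i, ψ i ∈ E.Rt (e i)) →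
    ∀ m : ℕ, L ^ m ≤ Gz L ψ e m → (∀ i, e i + E.C ≤ m) → E.U ψ e (m + C2 : ℕ) = Wr ψ := by
  obtain ⟨C1, hC1⟩ := E.exists_Rt_gen
  obtain ⟨N, b, hb, hb0, h⟩ := E.frac E.z
  refine ⟨N + C1, fun {ι} _ ψ e hψ m hgood hm => ?_⟩
  have := E.b2b h hb hb0 (by rw [mul_div_cancel_left₀ _ hb0]) (E.b2a hC1 hψ hgood hm)
  rw [show ((m + (N + C1) : ℕ) : ℤ) = N + (m + C1 : ℕ) by push_cast; ring]
  exact this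

/-- the degree is positive -/
lemma Setup.deg_pos : 0 < E.A.deg + E.B.deg := by
  by_contra hcon
  have hA : E.A.deg = 0 := by omega
  have hB : E.B.deg = 0 := by omega
  have hLA : ∀ n : ℕ, E.A.pw n ≤ E.A.pw 0 := by
    intro n
    have := E.A.ind_pw E.oneL (a := 0) (b := n) (n := n) (by simp)
    rw [hA, Nat.cast_zero, mul_zero, ind_eq_zero_iff] at this
    exact this
  have hLB : ∀ n : ℕ, E.B.pw n ≤ E.B.pw 0 := by
    intro n
    have := E.B.ind_pw E.oneL (a := 0) (b := n) (n := n) (by simp)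
    rw [hB, Nat.cast_zero, mul_zero, ind_eq_zero_iff] at this
    exact this
  have hL : ∀ (n : ℕ) (x : K), x ∈ L ^ n → x ∈ E.Rt 0 := fun n x hx =>
    ⟨hLA n (E.A.Lpow_le hx), hLB n (E.B.Lpow_le hx)⟩
  obtain ⟨N, b, hb, hb0, h⟩ := E.frac E.z
  have hfin : Module.Finite k (E.Rt 0) := E.Rt_fin 0
  let f : E.Rt 0 →ₗ[k] E.Rt 0 := (LinearMap.mulLeft k b).restrict (fun x hx => by
    have := E.Rt_mul (hL N b hb) hx
    simpa using this)
  have hinj : Function.Injective f := by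
    intro x y hxy
    have : b * (x : K) = b * y := congrArg Subtype.val hxy
    exact Subtype.ext (mul_left_cancel₀ hb0 this)
  obtain ⟨x, hx⟩ := (LinearMap.injective_iff_surjective.1 hinj) ⟨1, hL 0 1 (by simp)⟩
  have hx' : b * (x : K) = 1 := congrArg Subtype.val hx
  apply E.hz
  have h3 := E.Rt_mul (hL N _ h) x.2
  rw [mul_right_comm, hx', one_mul] at h3
  exact h3.2

end Two
end FThr
end part7


section part8
set_option linter.all false
open scoped nonZeroDivisors

namespace FThr

universe u

section Lin

variable {K : Type u} [Field K] {ι κ : Type*} [Fintype ι] [Fintype κ]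

/-- Frobenius twist of a linear map -/
noncomputable def frL [DecidableEq ι] (q : ℕ) (π : (ι → K) →ₗ[K] (κ → K)) : (ι → K) →ₗ[K] (κ → K) :=
  Matrix.toLin' ((LinearMap.toMatrix' π).map (fun x => x ^ q))

lemma frL_frob [DecidableEq ι] {q : ℕ} (hq0 : q ≠ 0) (hq : ∀ x y : K, (x + y) ^ q = x ^ q + y ^ q)
    (π : (ι → K) →ₗ[K] (κ → K)) (x : ι → K) : frL q π (frob q x) = frob q (π x) := by
  have h : π x = (LinearMap.toMatrix' π).mulVec x := by
    rw [← Matrix.toLin'_apply, Matrix.toLin'_toMatrix']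
  rw [h, frL, Matrix.toLin'_apply]
  funext j
  simp only [Matrix.mulVec, dotProduct, Matrix.map_apply, frob]
  rw [sum_pow_of_hq hq0 hq]
  simp only [mul_pow]

lemma frob_single [DecidableEq κ] {q : ℕ} (hq0 : q ≠ 0) (i : κ) :
    frob q (Pi.single i (1 : K)) = Pi.single i 1 := by
  funext j
  by_cases h : j = i
  · subst h; simp [frob]
  · simp [frob, h, hq0]

lemma exists_dual [DecidableEq κ] {V : Type*} [AddCommGroup V] [Module K V] {v : κ → V}
    (hv : LinearIndependent K v) : ∃ g : V →ₗ[K] (κ → K), ∀ i, g (v i) = Pi.single i 1 := by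
  obtain ⟨g, hg⟩ := LinearMap.exists_leftInverse_of_injective (Fintype.linearCombination K v)
    (LinearMap.ker_eq_bot.2 (linearIndependent_iff_injective_fintypeLinearCombination.1 hv))
  refine ⟨g, fun i => ?_⟩
  have := LinearMap.congr_fun hg (Pi.single i 1)
  simpa using this

lemma indep_of_dual [DecidableEq κ] {V : Type*} [AddCommGroup V] [Module K V] {v : κ → V}
    (g : V →ₗ[K] (κ → K)) (h : ∀ i, g (v i) = Pi.single i 1) : LinearIndependent K v := by
  refine LinearIndependent.of_comp g ?_
  have : g ∘ v = fun i => Pi.single i (1 : K) := funext h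
  rw [this]
  exact Pi.linearIndependent_single_one κ K

lemma frob_indep {q : ℕ} (hq0 : q ≠ 0) (hq : ∀ x y : K, (x + y) ^ q = x ^ q + y ^ q)
    {v : κ → ι → K} (hv : LinearIndependent K v) : LinearIndependent K (fun i => frob q (v i)) := by
  classical
  obtain ⟨g, hg⟩ := exists_dual hv
  refine indep_of_dual (frL q g) fun i => ?_
  rw [frL_frob hq0 hq, hg, frob_single hq0]

lemma finrank_Wr {ψ : ι → K} (h : ψ ≠ 0) : Module.finrank K (Wr ψ) + 1 = Fintype.card ι := by
  classical
  set f : (ι → K) →ₗ[K] K := Fintype.linearCombination K ψ with hf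
  have h1 : LinearMap.ker f = Wr ψ := by
    ext x
    rw [LinearMap.mem_ker, mem_Wr, hf, Fintype.linearCombination_apply]
    simp
  have h2 : Function.Surjective f := by
    obtain ⟨i, hi⟩ := Function.ne_iff.1 h
    intro c
    refine ⟨Pi.single i (c / ψ i), ?_⟩
    rw [hf, Fintype.linearCombination_apply_single]
    simp only [smul_eq_mul]
    exact div_mul_cancel₀ _ hi
  have h3 := LinearMap.finrank_range_add_finrank_ker f
  rw [LinearMap.range_eq_top.2 h2, finrank_top, Module.finrank_self, h1, Module.finrank_pi] at h3
  omega

lemma exists_proj {U W : Submodule K (ι → K)} (hUW : U ≤ W) {S : Set (ι → K)}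
    (hS : Submodule.span K S = W) {b : ℕ} (hb : Module.finrank K U + b = Module.finrank K W) :
    ∃ (π : (ι → K) →ₗ[K] (Fin b → K)) (u : Fin b → ι → K), (∀ i, u i ∈ S) ∧
      (∀ i, π (u i) = Pi.single i 1) ∧ ∀ x ∈ U, π x = 0 := by
  classical
  have e1 : Submodule.span K (U.mkQ '' S) = W.map U.mkQ := by rw [← hS, Submodule.map_span]
  have e2 : Module.finrank K (Submodule.span K (U.mkQ '' S)) = b := by
    rw [e1]
    have h3 := LinearMap.finrank_range_add_finrank_ker (U.mkQ.domRestrict W)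
    have h4 : LinearMap.range (U.mkQ.domRestrict W) = W.map U.mkQ := by
      rw [LinearMap.domRestrict, LinearMap.range_comp, Submodule.range_subtype]
    have h5 : LinearMap.ker (U.mkQ.domRestrict W) = U.comap W.subtype := by
      rw [LinearMap.domRestrict, LinearMap.ker_comp, Submodule.ker_mkQ]
    rw [h4, h5, (Submodule.comapSubtypeEquivOfLe hUW).finrank_eq] at h3
    omega
  obtain ⟨f, hf, -, hli⟩ := Submodule.exists_fun_fin_finrank_span_eq K (U.mkQ '' S)
  generalize Module.finrank K (Submodule.span K (U.mkQ '' S)) = b' at *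
  subst e2
  choose u hu huf using hf
  obtain ⟨g, hg⟩ := exists_dual hli
  refine ⟨g.comp U.mkQ, u, hu, fun i => ?_, fun x hx => ?_⟩
  · rw [LinearMap.comp_apply, huf, hg]
  · rw [LinearMap.comp_apply]
    have : U.mkQ x = 0 := by simpa using hx
    rw [this, map_zero]

lemma exists_indep_of_span {b : ℕ} {S : Set (Fin b → K)} (hS : Submodule.span K S = ⊤) :
    ∃ v : Fin b → Fin b → K, (∀ i, v i ∈ S) ∧ LinearIndependent K v := by
  obtain ⟨f, hf, -, hli⟩ := Submodule.exists_fun_fin_finrank_span_eq K S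
  have e2 : Module.finrank K (Submodule.span K S) = b := by rw [hS]; simp
  exact ⟨f ∘ Fin.cast e2.symm, fun i => hf _, hli.comp _ (Fin.cast_injective _)⟩

lemma ker_inf_eq {U W : Submodule K (ι → K)} (hUW : U ≤ W) {b : ℕ}
    (hb : Module.finrank K U + b = Module.finrank K W) (π : (ι → K) →ₗ[K] (Fin b → K))
    (hπU : ∀ x ∈ U, π x = 0) (hπW : W.map π = ⊤) {x : ι → K} (hx : x ∈ W) (h0 : π x = 0) : x ∈ U := by
  have h3 := LinearMap.finrank_range_add_finrank_ker (π.domRestrict W)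
  have h4 : LinearMap.range (π.domRestrict W) = ⊤ := by
    rw [LinearMap.domRestrict, LinearMap.range_comp, Submodule.range_subtype, hπW]
  rw [h4, finrank_top, Module.finrank_pi, Fintype.card_fin] at h3
  have h5 : U.comap W.subtype ≤ LinearMap.ker (π.domRestrict W) := by
    intro y hy
    rw [LinearMap.mem_ker]
    exact hπU _ hy
  have h6 : U.comap W.subtype = LinearMap.ker (π.domRestrict W) := by
    apply Submodule.eq_of_le_of_finrank_eq h5
    rw [(Submodule.comapSubtypeEquivOfLe hUW).finrank_eq]
    omega
  have h7 : (⟨x, hx⟩ : W) ∈ LinearMap.ker (π.domRestrict W) := by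
    rw [LinearMap.mem_ker]; exact h0
  rw [← h6] at h7
  exact h7

end Lin

section Lat

variable {k : Type*} {K : Type u} [Field k] [Field K] [Algebra k K] {L : Submodule k K}
  (A B : Chart k K L) {ι κ : Type*} [Fintype ι] [Fintype κ]

/-- image of a lattice under a linear map -/
noncomputable def Chart.mp (π : (ι → K) →ₗ[K] (κ → K)) (N : Submodule A.D (ι → K)) :
    Submodule A.D (κ → K) := Submodule.map (π.restrictScalars A.D) N

lemma Chart.mem_mp {π : (ι → K) →ₗ[K] (κ → K)} {N : Submodule A.D (ι → K)} {y : κ → K} :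
    y ∈ A.mp π N ↔ ∃ x ∈ N, π x = y := Iff.rfl

lemma Chart.mp_smul (π : (ι → K) →ₗ[K] (κ → K)) (N : Submodule A.D (ι → K)) (a : ℤ) :
    A.mp π (A.pw a • N) = A.pw a • A.mp π N := by
  apply le_antisymm
  · rw [Chart.mp, Submodule.map_le_iff_le_comap, Submodule.smul_le]
    intro r hr n hn
    rw [Submodule.mem_comap]
    change π (r • n) ∈ _
    rw [map_smul]
    exact Submodule.smul_mem_smul hr ⟨n, hn, rfl⟩
  · rw [Submodule.smul_le]
    rintro r hr _ ⟨n, hn, rfl⟩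
    exact ⟨r • n, Submodule.smul_mem_smul hr hn, map_smul π r n⟩

lemma Chart.mp_Fr [DecidableEq ι] {q : ℕ} (hq0 : q ≠ 0) (hq : ∀ x y : K, (x + y) ^ q = x ^ q + y ^ q)
    (π : (ι → K) →ₗ[K] (κ → K)) (N : Submodule A.D (ι → K)) :
    A.mp (frL q π) (Fr q N) = Fr q (A.mp π N) := by
  rw [Chart.mp, Fr, Submodule.map_span, Fr]
  congr 1
  ext y
  constructor
  · rintro ⟨_, ⟨x, hx, rfl⟩, rfl⟩
    exact ⟨π x, ⟨x, hx, rfl⟩, (frL_frob hq0 hq π x).symm⟩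
  · rintro ⟨_, ⟨x, hx, rfl⟩, rfl⟩
    exact ⟨frob q x, ⟨x, hx, rfl⟩, frL_frob hq0 hq π x⟩

lemma Chart.fg_le_pi {M : Submodule A.D (κ → K)} (hM : M.FG) :
    ∃ J : (Submodule A.D K)ˣ, (1 : Submodule A.D K) ≤ J ∧ indD k (1 : Submodule A.D K) J ≠ ⊤ ∧
      M ≤ Submodule.pi Set.univ (fun _ => (J : Submodule A.D K)) := by
  classical
  have h1 : (1 : Submodule A.D K).FG := by
    have := unit_fg (1 : (Submodule A.D K)ˣ)
    simpa using this
  obtain ⟨J, hJ⟩ := unit_of_fg (D := A.D) (K := K) (1 ⊔ ⨆ i : κ, M.map (LinearMap.proj i : (κ → K) →ₗ[A.D] K))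
    (h1.sup (Submodule.fg_iSup _ fun i => hM.map _)) (by
      intro h
      have : (1 : K) ∈ (1 ⊔ ⨆ i : κ, M.map (LinearMap.proj i : (κ → K) →ₗ[A.D] K)) :=
        Submodule.mem_sup_left (Submodule.one_le.1 le_rfl)
      rw [h] at this
      simp at this)
  refine ⟨J, by rw [hJ]; exact le_sup_left, A.fin_of_fg _ (unit_fg _), ?_⟩
  intro x hx i _
  rw [hJ]
  exact Submodule.mem_sup_right (Submodule.mem_iSup_of_mem i ⟨x, hx, rfl⟩)

lemma Chart.std_le [DecidableEq κ] {M : Submodule A.D (κ → K)} (h : ∀ i, Pi.single i (1 : K) ∈ M) :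
    stdL A.D K κ ≤ M := by
  intro x hx
  rw [← Finset.univ_sum_single x]
  refine sum_mem fun i _ => ?_
  obtain ⟨d, hd⟩ := mem_one_iff.1 (hx i trivial)
  have : (Pi.single i (x i) : κ → K) = d • Pi.single i 1 := by
    rw [← Pi.single_smul, ← hd, Algebra.smul_def, mul_one]
  rw [this]
  exact Submodule.smul_mem _ _ (h i)

/-- everything about the index of Frobenius pullbacks -/
lemma Chart.ind_Fr {M : Submodule A.D (κ → K)} (hstd : stdL A.D K κ ≤ M) (hM : M.FG) :
    ∃ δ : ℕ, ∀ q : ℕ, q ≠ 0 → (∀ x y : K, (x + y) ^ q = x ^ q + y ^ q) →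
      stdL A.D K κ ≤ Fr q M ∧ indD k (stdL A.D K κ) (Fr q M) = (q * δ : ℕ) := by
  obtain ⟨J, h1, hfin, hMJ⟩ := A.fg_le_pi hM
  have hf : indD k (stdL A.D K κ) M ≠ ⊤ := by
    refine ne_top_of_le_ne_top ?_ (indD_mono k le_rfl hMJ)
    rw [stdL, indD_pi]
    simp only [Finset.sum_const, nsmul_eq_mul]
    exact WithTop.mul_ne_top (ENat.coe_ne_top _) hfin
  refine ⟨(indD k (stdL A.D K κ) M).toNat, fun q hq0 hq => ⟨?_, ?_⟩⟩
  · rw [← Fr_std hq0 hq]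
    exact Fr_mono hstd
  · rw [indD_Fr_eq k hq0 hq h1 hfin hstd hMJ]
    push_cast
    rw [ENat.coe_toNat hf]

end Lat
end FThr
end part8


section part9
set_option linter.all false
open scoped nonZeroDivisors

namespace FThr

universe u

section Block

variable {k : Type*} {K : Type u} [Field k] [Field K] [Algebra k K] {L : Submodule k K}
  (E : Setup k K L) {ι : Type*} [Fintype ι]

lemma frob_zero {q : ℕ} (hq0 : q ≠ 0) {κ : Type*} : frob q (0 : κ → K) = 0 := by
  funext i; simp [frob, hq0]

lemma frob_ne_zero {q : ℕ} {ψ : ι → K} (h : ψ ≠ 0) : frob q ψ ≠ 0 := by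
  obtain ⟨i, hi⟩ := Function.ne_iff.1 h
  exact Function.ne_iff.2 ⟨i, pow_ne_zero _ hi⟩

lemma Setup.frob_sec {q : ℕ} (hq0 : q ≠ 0) (hq : ∀ x y : K, (x + y) ^ q = x ^ q + y ^ q)
    {ψ : ι → K} {e : ι → ℤ} {m : ℤ} {a : ι → K} (h : a ∈ E.sec ψ e m) :
    frob q a ∈ E.sec (frob q ψ) (fun i => q * e i) (q * m) :=
  ⟨E.A.frob_mem_Vs hq0 hq h.1, E.B.frob_mem_Vs hq0 hq h.2⟩

/-- ranks of spans of sections go up under Frobenius -/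
lemma Setup.exists_frob_span (ψ : ι → K) (e : ι → ℤ) (m : ℤ) :
    ∃ f : Fin (Module.finrank K (E.U ψ e m)) → ι → K, (∀ i, f i ∈ E.sec ψ e m) ∧
      ∀ q : ℕ, q ≠ 0 → (∀ x y : K, (x + y) ^ q = x ^ q + y ^ q) →
        Submodule.span K (Set.range fun i => frob q (f i)) ≤ E.U (frob q ψ) (fun i => q * e i) (q * m) ∧
        Module.finrank K (Submodule.span K (Set.range fun i => frob q (f i))) =
          Module.finrank K (E.U ψ e m) := by
  obtain ⟨f, hf, -, hli⟩ := Submodule.exists_fun_fin_finrank_span_eq K (E.sec ψ e m)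
  refine ⟨f, hf, fun q hq0 hq => ⟨?_, ?_⟩⟩
  · rw [Submodule.span_le]
    rintro _ ⟨i, rfl⟩
    exact Submodule.subset_span (E.frob_sec hq0 hq (hf i))
  · exact (finrank_span_eq_card (frob_indep hq0 hq hli)).trans (Fintype.card_fin _)

lemma Setup.finrank_frob_le {q : ℕ} (hq0 : q ≠ 0) (hq : ∀ x y : K, (x + y) ^ q = x ^ q + y ^ q)
    (ψ : ι → K) (e : ι → ℤ) (m : ℤ) :
    Module.finrank K (E.U ψ e m) ≤ Module.finrank K (E.U (frob q ψ) (fun i => q * e i) (q * m)) := by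
  obtain ⟨f, -, h⟩ := E.exists_frob_span ψ e m
  obtain ⟨h1, h2⟩ := h q hq0 hq
  rw [← h2]
  exact Submodule.finrank_mono h1

theorem Setup.block {ψ : ι → K} {e : ι → ℤ} (hψ : ∀ i, ψ i ∈ E.Rt (e i))
    (hβA : ∃ β : ι → K, (∀ i, β i ∈ E.A.pw (- e i)) ∧ ∑ i, β i * ψ i = 1)
    (hβB : ∃ β : ι → K, (∀ i, β i ∈ E.B.pw (- e i)) ∧ ∑ i, β i * ψ i = 1)
    {m00 m0 : ℤ} {b : ℕ} (hU : E.U ψ e m0 = Wr ψ)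
    (hb : Module.finrank K (E.U ψ e m00) + b = Module.finrank K (Wr ψ)) :
    ∃ δ c0 : ℕ, ∀ q : ℕ, q ≠ 0 → (∀ x y : K, (x + y) ^ q = x ^ q + y ^ q) →
      (∀ (m : ℤ) (Δ : ℕ), q * m00 + E.C ≤ m → m + Δ = q * m0 →
        Module.finrank K (E.U (frob q ψ) (fun i => q * e i) m) ≤ Module.finrank K (E.U ψ e m00) →
        q * δ ≤ (Δ + E.C) * (b * (E.A.deg + E.B.deg))) ∧
      (∀ (m : ℤ) (Δ : ℕ), m + (Δ + E.C) = q * m0 →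
        E.U (frob q ψ) (fun i => q * e i) m = Wr (frob q ψ) →
        Δ * (b * (E.A.deg + E.B.deg)) ≤ q * δ + c0) := by
  classical
  obtain ⟨π, u, hu, hπu, hπU⟩ := exists_proj (E.U_le ψ e m00) (S := E.sec ψ e m0) hU hb
  obtain ⟨f, hf, hfq⟩ := E.exists_frob_span ψ e m00
  have hψ0 : ψ ≠ 0 := by
    rintro rfl
    obtain ⟨β, -, h⟩ := hβA
    simp at h
  have hstdA : stdL E.A.D K (Fin b) ≤ E.A.mp π (E.A.Vs ψ e m0) :=
    E.A.std_le fun i => ⟨u i, (hu i).1, hπu i⟩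
  have hstdB : stdL E.B.D K (Fin b) ≤ E.B.mp π (E.B.Vs ψ e m0) :=
    E.B.std_le fun i => ⟨u i, (hu i).2, hπu i⟩
  obtain ⟨δA, hδA⟩ := E.A.ind_Fr hstdA ((E.A.Vs_fg ψ e m0).map _)
  obtain ⟨δB, hδB⟩ := E.B.ind_Fr hstdB ((E.B.Vs_fg ψ e m0).map _)
  refine ⟨δA + δB, b * (ind ⊥ (E.A.pwk 0 ⊓ E.B.pwk 0)).toNat, fun q hq0 hq => ?_⟩
  obtain ⟨hA1, hA2⟩ := hδA q hq0 hq
  obtain ⟨hB1, hB2⟩ := hδB q hq0 hq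
  obtain ⟨hV1, hV2⟩ := hfq q hq0 hq
  set V := Submodule.span K (Set.range fun i => frob q (f i)) with hV
  set πq := frL q π with hπq
  have keyA : ∀ (m : ℤ) (Δ : ℤ), m + Δ = q * m0 →
      E.A.mp πq (E.A.Vs (frob q ψ) (fun i => q * e i) m) = E.A.pw (-Δ) • Fr q (E.A.mp π (E.A.Vs ψ e m0)) := by
    intro m Δ h
    obtain ⟨β, hβ, hβ1⟩ := hβA
    rw [← E.A.mp_Fr hq0 hq, E.A.Fr_Vs hq0 hq (fun i => (hψ i).1) hβ hβ1, ← E.A.mp_smul, E.A.pw_smul_Vs]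
    congr 2
    linarith
  have keyB : ∀ (m : ℤ) (Δ : ℤ), m + Δ = q * m0 →
      E.B.mp πq (E.B.Vs (frob q ψ) (fun i => q * e i) m) = E.B.pw (-Δ) • Fr q (E.B.mp π (E.B.Vs ψ e m0)) := by
    intro m Δ h
    obtain ⟨β, hβ, hβ1⟩ := hβB
    rw [← E.B.mp_Fr hq0 hq, E.B.Fr_Vs hq0 hq (fun i => (hψ i).2) hβ hβ1, ← E.B.mp_smul, E.B.pw_smul_Vs]
    congr 2
    linarith
  have hπV : ∀ x ∈ V, πq x = 0 := by
    intro x hx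
    have : V ≤ LinearMap.ker πq := by
      rw [hV, Submodule.span_le]
      rintro _ ⟨i, rfl⟩
      change πq _ = 0
      rw [hπq, frL_frob hq0 hq, hπU _ (Submodule.subset_span (hf i)), frob_zero hq0]
    exact this hx
  have hmapW : (Wr (frob q ψ)).map πq = ⊤ := by
    rw [eq_top_iff]
    intro x _
    rw [← Finset.univ_sum_single x]
    refine sum_mem fun i _ => ?_
    refine ⟨x i • frob q (u i), Submodule.smul_mem _ _ (frob_mem_Wr hq0 hq (hu i).1.1), ?_⟩
    change πq _ = _
    rw [map_smul, hπq, frL_frob hq0 hq, hπu, frob_single hq0, ← Pi.single_smul]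
    simp
  have hWW : Module.finrank K (Wr (frob q ψ)) = Module.finrank K (Wr ψ) := by
    have h1 := finrank_Wr hψ0
    have h2 := finrank_Wr (frob_ne_zero (q := q) hψ0)
    omega
  constructor
  · intro m Δ hm hΔ hfr
    have hVU : V = E.U (frob q ψ) (fun i => q * e i) m := by
      apply Submodule.eq_of_le_of_finrank_le
      · exact hV1.trans (E.U_mono (by omega))
      · rw [hV2]; exact hfr
    have hVU0 : V = E.U (frob q ψ) (fun i => q * e i) (q * m00) := by
      apply le_antisymm hV1
      rw [hVU]; exact E.U_mono (by omega)
    have := num_up E.A E.B E.oneL E.K2 hA1 (by rw [hA2]; exact ENat.coe_ne_top _) hB1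
      (by rw [hB2]; exact ENat.coe_ne_top _) Δ (by
        intro y hyA hyB
        rw [← keyA m Δ hΔ] at hyA
        rw [← keyB m Δ hΔ] at hyB
        obtain ⟨α, hα, rfl⟩ := E.A.mem_mp.1 hyA
        obtain ⟨β, hβ, hβy⟩ := E.B.mem_mp.1 hyB
        have h1 : α - β ∈ V := by
          refine ker_inf_eq (W := Wr (frob q ψ)) (b := b) (hV1.trans (E.U_le _ _ _)) (by rw [hV2, hWW]; exact hb) πq hπV hmapW
            (sub_mem hα.1 hβ.1) ?_
          rw [map_sub, hβy, sub_self]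
        rw [hVU0] at h1
        obtain ⟨xa, hxa, xb, hxb, hxa', hxb', hx⟩ := E.split hm h1
        have h2 : α - xa ∈ E.sec (frob q ψ) (fun i => q * e i) m := by
          refine ⟨sub_mem hα hxa, ?_⟩
          have : α - xa = β + xb := by
            have : α = xa + xb + β := by rw [← hx]; abel
            rw [this]; abel
          rw [this]
          exact add_mem hβ hxb
        have h3 : α - xa ∈ V := by rw [hVU]; exact Submodule.subset_span h2
        have h4 : α ∈ V := by
          rw [← hVU0] at hxa'
          have := add_mem h3 hxa'
          simpa using this
        exact hπV _ h4)
    rw [hA2, hB2, Fintype.card_fin] at this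
    have h5 : q * δA + q * δB ≤ (Δ + E.C) * (b * (E.A.deg + E.B.deg)) := by exact_mod_cast this
    rwa [mul_add]
  · intro m Δ hΔ hUm
    have hsp : Submodule.span K (πq '' (E.sec (frob q ψ) (fun i => q * e i) m)) = ⊤ := by
      rw [← Submodule.map_span, ← hmapW, ← hUm]; rfl
    obtain ⟨v, hv, hvi⟩ := exists_indep_of_span hsp
    have := num_low E.A E.B E.oneL E.K2 (MA := Fr q (E.A.mp π (E.A.Vs ψ e m0)))
      (MB := Fr q (E.B.mp π (E.B.Vs ψ e m0))) Δ v hvi (by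
        intro i
        obtain ⟨x, hx, hxv⟩ := hv i
        rw [← keyA m ((Δ + E.C : ℕ)) (by push_cast; exact hΔ)]
        exact ⟨x, hx.1, hxv⟩) (by
        intro i
        obtain ⟨x, hx, hxv⟩ := hv i
        rw [← keyB m ((Δ + E.C : ℕ)) (by push_cast; exact hΔ)]
        exact ⟨x, hx.2, hxv⟩)
    rw [hA2, hB2, Fintype.card_fin, ← ENat.coe_toNat E.h0] at this
    have h5 : Δ * (b * (E.A.deg + E.B.deg)) ≤ q * δA + q * δB + b * (ind ⊥ (E.A.pwk 0 ⊓ E.B.pwk 0)).toNat := by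
      exact_mod_cast this
    rwa [mul_add q δA δB]

end Block
end FThr
end part9


section part10
set_option linter.all false
open scoped nonZeroDivisors

namespace FThr

universe u

lemma ev_ge {p : ℕ} (hp : p.Prime) {t : ℝ} (ht : 0 < t) (B : ℝ) : ∀ᶠ n : ℕ in atTop, B ≤ t * (p : ℝ) ^ n := by
  have h1 : Tendsto (fun n : ℕ => (p : ℝ) ^ n) atTop atTop :=
    tendsto_pow_atTop_atTop_of_one_lt (by exact_mod_cast hp.one_lt)
  exact (h1.const_mul_atTop ht).eventually_ge_atTop B

lemma coeff_le {p : ℕ} (hp : p.Prime) {a B : ℝ} (h : ∀ᶠ n : ℕ in atTop, (p : ℝ) ^ n * a ≤ B) : a ≤ 0 := by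
  by_contra ha
  push Not at ha
  obtain ⟨n, h1, h2⟩ := (h.and (ev_ge hp ha (B + 1))).exists
  rw [mul_comm] at h1
  linarith

section Main

variable {k : Type*} {K : Type u} [Field k] [Field K] [Algebra k K] {L : Submodule k K}
  {ι : Type} [Fintype ι]

/-- the ideal `(φ)^{[p^n]}` contains everything of degree `m` -/
def gd (L : Submodule k K) (p : ℕ) (φ : ι → K) (d : ι → ℕ) (n m : ℕ) : Prop :=
  L ^ m ≤ Gz L (frob (p ^ n) φ) (fun i => ((p ^ n : ℕ) : ℤ) * (d i : ℤ)) m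

/-- dimension-one property -/
def Dim1 (L : Submodule k K) (p : ℕ) (φ : ι → K) (d : ι → ℕ) : Prop :=
  ∀ (e' : ℕ) (v : K), v ∈ L ^ e' → v ≠ 0 → ∃ C2 : ℕ, ∀ n M : ℕ, (∀ i, p ^ n * d i + C2 ≤ M) →
    ∀ x ∈ L ^ (M + e'), ∃ y ∈ L ^ M,
      x - v * y ∈ Gz L (frob (p ^ n) φ) (fun i => ((p ^ n : ℕ) : ℤ) * (d i : ℤ)) (M + e' : ℕ)

variable (E : Setup k K L)

theorem Setup.S1 {p : ℕ} (hp : p.Prime) {φ : ι → K} {d : ι → ℕ} (hφ : ∀ i, φ i ∈ L ^ (d i)) {c : ℝ}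
    (hc : 0 < c) (hd : ∀ i, (d i : ℝ) < c)
    (hup : ∀ x > c, ∀ᶠ n : ℕ in atTop, ∀ m : ℕ, x * (p : ℝ) ^ n ≤ m → gd L p φ d n m)
    {x : ℝ} (hx : c < x) : ∀ᶠ n : ℕ in atTop, ∀ m : ℤ, x * (p : ℝ) ^ n ≤ m →
      E.U (frob (p ^ n) φ) (fun i => ((p ^ n : ℕ) : ℤ) * (d i : ℤ)) m = Wr (frob (p ^ n) φ) := by
  obtain ⟨C2, hb2⟩ := E.b2
  obtain ⟨x', hx1, hx2⟩ := exists_between hx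
  have h1 : ∀ᶠ n : ℕ in atTop, ∀ i, ((E.C + C2 : ℕ) : ℝ) ≤ (x - d i) * (p : ℝ) ^ n :=
    eventually_all.2 fun i => ev_ge hp (by linarith [hd i]) _
  filter_upwards [hup x' hx1, h1, ev_ge hp (sub_pos.2 hx2) C2, ev_ge hp (hc.trans hx) C2] with n g1 g2 g3 g4 m hm
  have hm0 : (C2 : ℤ) ≤ m := by
    have : (C2 : ℝ) ≤ (m : ℝ) := by linarith
    exact_mod_cast this
  obtain ⟨m', hm'⟩ := Int.eq_ofNat_of_zero_le (sub_nonneg.2 hm0)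
  have hmm : m = (m' + C2 : ℕ) := by push_cast; omega
  subst hmm
  push_cast at hm
  refine hb2 _ _ (fun i => ?_) m' (g1 m' (by rw [sub_mul] at g3; linarith)) (fun i => ?_)
  · have := Submodule.pow_mem_pow _ (hφ i) (p ^ n)
    rw [← pow_mul] at this
    replace this := E.Lpow_Rt this
    have e : (((d i * p ^ n : ℕ) : ℤ)) = ((p ^ n : ℕ) : ℤ) * (d i : ℤ) := by push_cast; ring
    rwa [e] at this
  · have := g2 i
    rw [sub_mul] at this
    push_cast at this
    have h : ((p : ℝ) ^ n * d i + E.C ≤ m') := by linarith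
    push_cast
    exact_mod_cast h

theorem Setup.S2 {p : ℕ} (hp : p.Prime) {φ : ι → K} {d : ι → ℕ} {c : ℝ}
    (hc : 0 < c) (hd : ∀ i, (d i : ℝ) < c)
    (hup : ∀ x > c, ∀ᶠ n : ℕ in atTop, ∀ m : ℕ, x * (p : ℝ) ^ n ≤ m → gd L p φ d n m)
    (hlow : ∀ x < c, ∀ᶠ n : ℕ in atTop, ∀ m : ℕ, m ≤ x * (p : ℝ) ^ n → ¬ gd L p φ d n m)
    (hD : Dim1 L p φ d)
    {x : ℝ} (hx : x < c) : ∀ᶠ n : ℕ in atTop, ∀ m : ℤ, m ≤ x * (p : ℝ) ^ n →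
      E.U (frob (p ^ n) φ) (fun i => ((p ^ n : ℕ) : ℤ) * (d i : ℤ)) m ≠ Wr (frob (p ^ n) φ) := by
  obtain ⟨e', v, hv, hv0, hcond⟩ := E.exists_cond
  obtain ⟨C2, hC2⟩ := hD e' v hv hv0
  obtain ⟨y, hxy, hy0, hyd, hyc⟩ : ∃ y, x < y ∧ 0 < y ∧ (∀ i, (d i : ℝ) < y) ∧ y < c := by
    have h1 : ∀ᶠ y in nhdsWithin c (Set.Iio c), x < y ∧ 0 < y ∧ (∀ i, (d i : ℝ) < y) ∧ y < c := by
      refine ((eventually_nhdsWithin_of_eventually_nhds (lt_mem_nhds hx)).and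
        ((eventually_nhdsWithin_of_eventually_nhds (lt_mem_nhds hc)).and
        ((eventually_all.2 fun i => eventually_nhdsWithin_of_eventually_nhds (lt_mem_nhds (hd i))).and ?_)))
      exact self_mem_nhdsWithin
    exact h1.exists
  obtain ⟨y', hy1, hy2⟩ := exists_between hyc
  have h1 : ∀ᶠ n : ℕ in atTop, ∀ i, ((C2 + 1 : ℕ) : ℝ) ≤ (y - d i) * (p : ℝ) ^ n :=
    eventually_all.2 fun i => ev_ge hp (by linarith [hyd i]) _
  filter_upwards [hup (c + 1) (by linarith), hlow y' hy2, h1, ev_ge hp (sub_pos.2 hy1) (E.C + e' : ℕ)]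
    with n g1 g2 g3 g4 m hm hU
  have hpn : (0 : ℝ) < (p : ℝ) ^ n := pow_pos (by exact_mod_cast hp.pos) n
  set m1 : ℕ := ⌊y * (p : ℝ) ^ n⌋₊ with hm1
  have hm1a : (m1 : ℝ) ≤ y * (p : ℝ) ^ n := Nat.floor_le (by positivity)
  have hm1b : y * (p : ℝ) ^ n < m1 + 1 := Nat.lt_floor_add_one _
  have hmm1 : m ≤ m1 := by
    have : (m : ℝ) < m1 + 1 := by nlinarith
    have : m < m1 + 1 := by exact_mod_cast this
    omega
  have hU1 := le_antisymm (E.U_le (frob (p ^ n) φ) (fun i => ((p ^ n : ℕ) : ℤ) * (d i : ℤ)) m1)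
    (hU ▸ E.U_mono hmm1)
  have hin : ∀ i, p ^ n * d i + C2 ≤ m1 := by
    intro i
    have := g3 i
    rw [sub_mul] at this
    push_cast at this
    have h : ((p : ℝ) ^ n * d i + C2 ≤ m1) := by linarith
    exact_mod_cast h
  have hbig := g1 ⌈(c + 1) * (p : ℝ) ^ n⌉₊ (Nat.le_ceil _)
  have hM : ((m1 : ℤ) + E.C ≤ (m1 + E.C : ℕ)) := by push_cast; rfl
  refine g2 (m1 + E.C + e') ?_ ?_
  · rw [sub_mul] at g4
    push_cast at g4 ⊢
    linarith
  · intro w hw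
    obtain ⟨y, hy, hwy⟩ := hC2 n (m1 + E.C) (fun i => (hin i).trans (by omega)) w hw
    have : w = (w - v * y) + v * y := by ring
    rw [this]
    refine add_mem hwy ?_
    obtain ⟨γ, hγ, hγ1⟩ := E.b1 hbig hU1 hM (E.Lpow_Rt hy)
    refine ⟨fun i => v * γ i, fun i => ?_, ?_⟩
    · have hle : p ^ n * d i ≤ m1 + E.C := by have := hin i; omega
      have e1 : (((m1 + E.C : ℕ) : ℤ) - ((p ^ n : ℕ) : ℤ) * (d i : ℤ)) = ((m1 + E.C - p ^ n * d i : ℕ) : ℤ) := by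
        rw [Nat.cast_sub hle]; push_cast; ring
      have h3 := hγ i
      rw [e1] at h3
      have h4 := hcond _ _ h3
      have e2 : (((m1 + E.C + e' : ℕ) : ℤ) - ((p ^ n : ℕ) : ℤ) * (d i : ℤ)) = ((m1 + E.C - p ^ n * d i + e' : ℕ) : ℤ) := by
        push_cast [Nat.cast_sub hle]; ring
      rw [e2, Lz_nat]
      exact h4
    · rw [← hγ1, Finset.mul_sum]
      simp only [mul_assoc]

lemma frob_frob (φ : ι → K) (p n j : ℕ) : frob (p ^ j) (frob (p ^ n) φ) = frob (p ^ (n + j)) φ := by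
  funext i
  simp only [frob]
  rw [← pow_mul, pow_add]

theorem Setup.main (E : Setup k K L) {p : ℕ} (hp : p.Prime) [CharP K p] {φ : ι → K} {d : ι → ℕ}
    (hφ : ∀ i, φ i ∈ L ^ (d i)) {c : ℝ} (hd : ∀ i, (d i : ℝ) < c)
    (hup : ∀ x > c, ∀ᶠ n : ℕ in atTop, ∀ m : ℕ, x * (p : ℝ) ^ n ≤ m → gd L p φ d n m)
    (hlow : ∀ x < c, ∀ᶠ n : ℕ in atTop, ∀ m : ℕ, m ≤ x * (p : ℝ) ^ n → ¬ gd L p φ d n m)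
    (hD : Dim1 L p φ d) : ∃ r : ℚ, (r : ℝ) = c := by
  haveI := Fact.mk hp
  have hp0 : ∀ n : ℕ, p ^ n ≠ 0 := fun n => pow_ne_zero _ hp.ne_zero
  have hpR : ∀ n : ℕ, (0 : ℝ) < (p : ℝ) ^ n := fun n => pow_pos (by exact_mod_cast hp.pos) n
  have hq : ∀ (n : ℕ) (x y : K), (x + y) ^ p ^ n = x ^ p ^ n + y ^ p ^ n := fun n x y => add_pow_char_pow x y p n
  obtain ⟨n1, m1, hgood⟩ : ∃ n m, gd L p φ d n m := by
    obtain ⟨n, hn⟩ := (hup (c + 1) (by linarith)).exists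
    exact ⟨n, _, hn _ (Nat.le_ceil _)⟩
  have hne : Nonempty ι := by
    by_contra h
    rw [not_nonempty_iff] at h
    have h1 : (1 : K) ∈ L ^ m1 := by
      have := Submodule.pow_mem_pow _ E.oneL m1
      rwa [one_pow] at this
    obtain ⟨a, -, ha⟩ := hgood h1
    simp at ha
  have hc : 0 < c := lt_of_le_of_lt (Nat.cast_nonneg _) (hd hne.some)
  have hRt : ∀ n i, frob (p ^ n) φ i ∈ E.Rt (((p ^ n : ℕ) : ℤ) * (d i : ℤ)) := by
    intro n i
    have := Submodule.pow_mem_pow _ (hφ i) (p ^ n)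
    rw [← pow_mul] at this
    replace this := E.Lpow_Rt this
    have e : (((d i * p ^ n : ℕ) : ℤ)) = ((p ^ n : ℕ) : ℤ) * (d i : ℤ) := by push_cast; ring
    rwa [e] at this
  obtain ⟨βA, hβA, hβA1⟩ := E.A.beta_of_pow (d := fun i => (d i : ℤ)) (fun i => E.A.Lpow_le (hφ i)) (hp0 n1)
    (E.A.exists_beta hgood)
  obtain ⟨βB, hβB, hβB1⟩ := E.B.beta_of_pow (d := fun i => (d i : ℤ)) (fun i => E.B.Lpow_le (hφ i)) (hp0 n1)
    (E.B.exists_beta hgood)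
  have hφ0 : φ ≠ 0 := by rintro rfl; simp at hβA1
  have hW : ∀ n, Module.finrank K (Wr (frob (p ^ n) φ)) + 1 = Fintype.card ι :=
    fun n => finrank_Wr (frob_ne_zero hφ0)
  set Un : ℕ → ℤ → Submodule K (ι → K) := fun n m =>
    E.U (frob (p ^ n) φ) (fun i => ((p ^ n : ℕ) : ℤ) * (d i : ℤ)) m with hUn
  have hS1 : ∀ x, c < x → ∀ᶠ n : ℕ in atTop, ∀ m : ℤ, x * (p : ℝ) ^ n ≤ m → Un n m = Wr (frob (p ^ n) φ) :=
    fun x hx => E.S1 hp hφ hc hd hup hx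
  have hS2 : ∀ x, x < c → ∀ᶠ n : ℕ in atTop, ∀ m : ℤ, m ≤ x * (p : ℝ) ^ n → Un n m ≠ Wr (frob (p ^ n) φ) :=
    fun x hx => E.S2 hp hc hd hup hlow hD hx
  have hUfr : ∀ (n j : ℕ) (m : ℤ), E.U (frob (p ^ j) (frob (p ^ n) φ))
      (fun i => ((p ^ j : ℕ) : ℤ) * (((p ^ n : ℕ) : ℤ) * (d i : ℤ))) m = Un (n + j) m := by
    intro n j m
    rw [hUn, frob_frob]
    congr 1
    funext i
    push_cast
    ring
  -- maximal rank
  obtain ⟨n0, m00, hm00, hmax⟩ : ∃ (n0 : ℕ) (m00 : ℤ), (m00 : ℝ) < c * (p : ℝ) ^ n0 ∧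
      ∀ (n : ℕ) (m : ℤ), (m : ℝ) < c * (p : ℝ) ^ n → Module.finrank K (Un n m) ≤ Module.finrank K (Un n0 m00) := by
    set P : Set ℕ := {a | ∃ (n : ℕ) (m : ℤ), (m : ℝ) < c * (p : ℝ) ^ n ∧ Module.finrank K (Un n m) = a} with hP
    have hPne : P.Nonempty := ⟨_, 0, 0, by simpa using hc, rfl⟩
    have hPb : BddAbove P := by
      refine ⟨Fintype.card ι, ?_⟩
      rintro _ ⟨n, m, -, rfl⟩
      have := Submodule.finrank_le (Un n m)
      rwa [Module.finrank_pi] at this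
    obtain ⟨n0, m00, h1, h2⟩ := Nat.sSup_mem hPne hPb
    refine ⟨n0, m00, h1, fun n m h => ?_⟩
    rw [h2]
    exact le_csSup hPb ⟨n, m, h, rfl⟩
  have hle : Module.finrank K (Un n0 m00) ≤ Module.finrank K (Wr (frob (p ^ n0) φ)) :=
    Submodule.finrank_mono (E.U_le _ _ _)
  obtain ⟨b, hb⟩ := Nat.exists_eq_add_of_le hle
  have hshift : ∀ {P : ℕ → Prop}, (∀ᶠ n in atTop, P n) → ∀ᶠ j in atTop, P (n0 + j) := by
    intro P h
    have := (tendsto_add_atTop_nat n0).eventually h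
    simpa only [add_comm] using this
  have hx0 : (m00 : ℝ) / (p : ℝ) ^ n0 < c := by rwa [div_lt_iff₀ (hpR n0)]
  have hb0 : 0 < b := by
    by_contra hb0
    have hb0 : b = 0 := by omega
    obtain ⟨j, hj⟩ := (hshift (hS2 _ hx0)).exists
    refine hj ((p ^ j : ℕ) * m00) ?_ ?_
    · push_cast
      rw [pow_add]
      have := (hpR n0).ne'
      field_simp
      exact le_rfl
    · apply Submodule.eq_of_le_of_finrank_le (E.U_le _ _ _)
      have h1 := E.finrank_frob_le (hp0 j) (hq j) (frob (p ^ n0) φ) (fun i => ((p ^ n0 : ℕ) : ℤ) * (d i : ℤ)) m00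
      rw [hUfr] at h1
      have h2 := hW n0
      have h3 := hW (n0 + j)
      have h4 : Module.finrank K (Un n0 m00) ≤ Module.finrank K (Un (n0 + j) ((p ^ j : ℕ) * m00)) := h1
      change _ ≤ Module.finrank K (Un (n0 + j) ((p ^ j : ℕ) * m00))
      omega
  obtain ⟨N, hN⟩ := E.exists_U_eq (frob (p ^ n0) φ) (fun i => ((p ^ n0 : ℕ) : ℤ) * (d i : ℤ))
  set m0 : ℕ := N + ⌈(c + 1) * (p : ℝ) ^ n0⌉₊ with hm0
  have hm0' : (c + 1) * (p : ℝ) ^ n0 ≤ m0 := by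
    rw [hm0]; push_cast
    have := Nat.le_ceil ((c + 1) * (p : ℝ) ^ n0)
    linarith [(Nat.cast_nonneg N : (0 : ℝ) ≤ N)]
  obtain ⟨δ, c0, hblock⟩ := E.block (hRt n0)
    (by
      refine ⟨frob (p ^ n0) βA, fun i => ?_, ?_⟩
      · have := E.A.pow_mem (hβA i) (p ^ n0)
        rwa [mul_neg] at this
      · simp only [frob, ← mul_pow]
        rw [← sum_pow_of_hq (hp0 n0) (hq n0), hβA1, one_pow])
    (by
      refine ⟨frob (p ^ n0) βB, fun i => ?_, ?_⟩
      · have := E.B.pow_mem (hβB i) (p ^ n0)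
        rwa [mul_neg] at this
      · simp only [frob, ← mul_pow]
        rw [← sum_pow_of_hq (hp0 n0) (hq n0), hβB1, one_pow])
    (m00 := m00) (hN m0 (by omega)) hb.symm
  set D := E.A.deg + E.B.deg with hDdef
  have hDpos : 0 < D := E.deg_pos
  have hbD : (0 : ℝ) < b * D := by positivity
  have hs : (0 : ℝ) < b * D * (p : ℝ) ^ n0 := mul_pos hbD (hpR n0)
  set r : ℝ := (m0 * (b * D) - δ) / (b * D * (p : ℝ) ^ n0) with hr
  have hcr : c ≤ r := by
    refine le_of_forall_lt_imp_le_of_dense fun x hx => ?_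
    obtain ⟨y, hy1, hy2⟩ := exists_between (max_lt (max_lt hx hx0) hc)
    rw [max_lt_iff, max_lt_iff] at hy1
    obtain ⟨⟨hy1, hy3⟩, hy4⟩ := hy1
    refine hy1.le.trans ?_
    rw [hr, le_div_iff₀ hs]
    suffices h : (δ : ℝ) - (m0 - y * (p : ℝ) ^ n0) * (b * D) ≤ 0 by linarith
    refine coeff_le hp (B := (1 + E.C) * (b * D)) ?_
    rw [div_lt_iff₀ (hpR n0)] at hy3
    filter_upwards [ev_ge hp (sub_pos.2 hy3) (E.C + 1)] with j hj
    set m := ⌊y * (p : ℝ) ^ (n0 + j)⌋ with hm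
    have hma : (m : ℝ) ≤ y * (p : ℝ) ^ (n0 + j) := Int.floor_le _
    have hmb : y * (p : ℝ) ^ (n0 + j) < m + 1 := Int.lt_floor_add_one _
    have hpnj : (p : ℝ) ^ (n0 + j) = (p : ℝ) ^ n0 * (p : ℝ) ^ j := pow_add _ _ _
    have hlt : y * (p : ℝ) ^ (n0 + j) < c * (p : ℝ) ^ (n0 + j) := mul_lt_mul_of_pos_right hy2 (hpR _)
    have h1 : m ≤ (p ^ j : ℕ) * (m0 : ℤ) := by
      have : (m : ℝ) ≤ (p : ℝ) ^ j * m0 := by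
        rw [hpnj] at hlt hma
        have := mul_le_mul_of_nonneg_right hm0' (hpR j).le
        nlinarith [mul_pos (hpR n0) (hpR j)]
      exact_mod_cast this
    obtain ⟨Δ, hΔ⟩ := Int.eq_ofNat_of_zero_le (sub_nonneg.2 h1)
    have h2 : ((p ^ j : ℕ) : ℤ) * m00 + E.C ≤ m := by
      have : ((p : ℝ) ^ j * m00 + E.C ≤ m) := by
        rw [hpnj] at hmb
        rw [sub_mul] at hj
        nlinarith
      exact_mod_cast this
    have h3 := (hblock (p ^ j) (hp0 j) (hq j)).1 m Δ h2 (by omega) (by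
      rw [hUfr]; exact hmax _ _ (by linarith))
    have h4 : ((p : ℝ) ^ j * δ) ≤ (Δ + E.C) * (b * D) := by exact_mod_cast h3
    have h5 : ((p : ℝ) ^ j * m0 - m) = Δ := by
      have : (((p ^ j : ℕ) : ℤ) : ℝ) * ((m0 : ℤ) : ℝ) - m = ((Δ : ℤ) : ℝ) := by exact_mod_cast hΔ
      push_cast at this
      exact this
    have h6 : (Δ : ℝ) ≤ (p : ℝ) ^ j * m0 - y * ((p : ℝ) ^ n0 * (p : ℝ) ^ j) + 1 := by
      rw [hpnj] at hmb; linarith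
    have h7 := mul_le_mul_of_nonneg_right (add_le_add_left h6 (E.C : ℝ)) hbD.le
    nlinarith
  have hrc : r ≤ c := by
    refine le_of_forall_gt_imp_ge_of_dense fun x hx => ?_
    obtain ⟨y, hy1, hy2⟩ := exists_between (lt_min hx (lt_add_one c))
    rw [lt_min_iff] at hy2
    refine le_trans ?_ hy2.1.le
    rw [hr, div_le_iff₀ hs]
    suffices h : (m0 - y * (p : ℝ) ^ n0) * (b * D) - (δ : ℝ) ≤ 0 by linarith
    refine coeff_le hp (B := (1 + E.C) * (b * D) + c0) ?_
    filter_upwards [hshift (hS1 y hy1), ev_ge hp (mul_pos (sub_pos.2 hy2.2) (hpR n0)) (E.C + 1)] with j hj1 hj2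
    set m := ⌈y * (p : ℝ) ^ (n0 + j)⌉ with hm
    have hma : y * (p : ℝ) ^ (n0 + j) ≤ m := Int.le_ceil _
    have hmb : m < y * (p : ℝ) ^ (n0 + j) + 1 := Int.ceil_lt_add_one _
    have hpnj : (p : ℝ) ^ (n0 + j) = (p : ℝ) ^ n0 * (p : ℝ) ^ j := pow_add _ _ _
    have h1 : m + E.C ≤ (p ^ j : ℕ) * (m0 : ℤ) := by
      have : (m : ℝ) + E.C ≤ (p : ℝ) ^ j * m0 := by
        rw [hpnj] at hmb
        have := mul_le_mul_of_nonneg_right hm0' (hpR j).le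
        nlinarith
      exact_mod_cast this
    obtain ⟨Δ, hΔ⟩ := Int.eq_ofNat_of_zero_le (sub_nonneg.2 h1)
    have h3 := (hblock (p ^ j) (hp0 j) (hq j)).2 m Δ (by omega) (by
      rw [hUfr, hj1 m hma, frob_frob])
    have h4 : (Δ * (b * D) : ℝ) ≤ (p : ℝ) ^ j * δ + c0 := by exact_mod_cast h3
    have h5 : ((p : ℝ) ^ j * m0 - (m + E.C)) = Δ := by
      have : (((p ^ j : ℕ) : ℤ) : ℝ) * ((m0 : ℤ) : ℝ) - (m + ((E.C : ℤ) : ℝ)) = ((Δ : ℤ) : ℝ) := by exact_mod_cast hΔ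
      push_cast at this
      exact this
    have h6 : (p : ℝ) ^ j * m0 - y * ((p : ℝ) ^ n0 * (p : ℝ) ^ j) ≤ Δ + (1 + E.C) := by
      rw [hpnj] at hmb; linarith
    have h7 := mul_le_mul_of_nonneg_right h6 hbD.le
    nlinarith
  refine ⟨(m0 * (b * D) - δ) / (b * D * (p : ℚ) ^ n0), ?_⟩
  rw [le_antisymm hcr hrc, hr]
  push_cast
  rfl

end Main
end FThr
end part10


section part11
set_option linter.all false
open scoped nonZeroDivisors

namespace FThr

universe u

section Good

variable {k : Type*} {K : Type u} [Field k] [Field K] [Algebra k K] {L : Submodule k K}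
  {ι : Type} [Fintype ι]

lemma Lz_mul {a b : ℤ} {x y : K} (hx : x ∈ Lz L a) (hy : y ∈ Lz L b) : x * y ∈ Lz L (a + b) := by
  rw [Lz] at hx hy
  split_ifs at hx with h
  · split_ifs at hy with h'
    · rw [Lz, if_pos (add_nonneg h h'), Int.toNat_add h h']
      exact Lpow_mul hx hy
    · rw [Submodule.mem_bot] at hy; rw [hy, mul_zero]; exact zero_mem _
  · rw [Submodule.mem_bot] at hx; rw [hx, zero_mul]; exact zero_mem _

lemma Lz_pow {a : ℤ} {x : K} (hx : x ∈ Lz L a) (n : ℕ) (hn : n ≠ 0) : x ^ n ∈ Lz L (n * a) := by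
  induction n with
  | zero => exact absurd rfl hn
  | succ n ih =>
    rcases eq_or_ne n 0 with rfl | h
    · simpa using hx
    · have := Lz_mul (ih h) hx
      rw [pow_succ]
      convert this using 2
      push_cast; ring

lemma Gz_mul {ψ : ι → K} {e : ι → ℤ} {m n : ℤ} {x y : K} (hx : x ∈ Lz L n) (hy : y ∈ Gz L ψ e m) :
    x * y ∈ Gz L ψ e (n + m) := by
  obtain ⟨a, ha, rfl⟩ := hy
  refine ⟨fun i => x * a i, fun i => ?_, ?_⟩
  · rw [add_sub_assoc]; exact Lz_mul hx (ha i)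
  · rw [Finset.mul_sum]; simp only [mul_assoc]

lemma Lpow_mul_le_Gz {ψ : ι → K} {e : ι → ℤ} {m : ℤ} {n : ℕ} {X : Submodule k K} (h : X ≤ Gz L ψ e m) :
    L ^ n * X ≤ Gz L ψ e (n + m) := by
  rw [Submodule.mul_le]
  intro x hx y hy
  exact Gz_mul (by rwa [Lz_nat]) (h hy)

lemma gd_mono {p : ℕ} {φ : ι → K} {d : ι → ℕ} {n m m' : ℕ} (h : m ≤ m') (hg : gd L p φ d n m) :
    gd L p φ d n m' := by
  obtain ⟨a, rfl⟩ := Nat.exists_eq_add_of_le' h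
  have := Lpow_mul_le_Gz (n := a) hg
  rw [← pow_add] at this
  rw [gd]
  exact_mod_cast this

/-- span of `q`-th powers -/
def Fq (q : ℕ) (X : Submodule k K) : Submodule k K := Submodule.span k ((fun x => x ^ q) '' (X : Set K))

lemma Fq_pow (q : ℕ) (m : ℕ) : (Fq q L) ^ m ≤ Fq q (L ^ m) := by
  induction m with
  | zero =>
    rw [pow_zero, pow_zero]
    rw [Submodule.one_le]
    exact Submodule.subset_span ⟨1, Submodule.one_le.1 le_rfl, one_pow _⟩
  | succ m ih =>
    rw [pow_succ, pow_succ]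
    refine (mul_le_mul' ih le_rfl).trans ?_
    rw [Fq, Fq, Submodule.span_mul_span, Submodule.span_le]
    rintro _ ⟨_, ⟨x, hx, rfl⟩, _, ⟨y, hy, rfl⟩, rfl⟩
    exact Submodule.subset_span ⟨x * y, Submodule.mul_mem_mul hx hy, mul_pow _ _ _⟩

lemma sum_le_of {α : Type*} (s : Finset α) (f : α → Submodule k K) (X : Submodule k K) (h : ∀ i ∈ s, f i ≤ X) :
    ∑ i ∈ s, f i ≤ X := by
  classical
  induction s using Finset.induction_on with
  | empty => simp
  | insert a s ha ih =>
    rw [Finset.sum_insert ha]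
    exact sup_le (h a (Finset.mem_insert_self _ _)) (ih fun i hi => h i (Finset.mem_insert_of_mem hi))

lemma pigeon (q : ℕ) (s : Finset K) (hs : (s : Set K) ⊆ L) :
    ∃ C : ℕ, q ≤ C ∧ ∀ N, C ≤ N → (Submodule.span k (s : Set K)) ^ N ≤ Fq q L * L ^ (N - q) := by
  classical
  induction s using Finset.induction_on with
  | empty =>
    refine ⟨q + 1, by omega, fun N hN => ?_⟩
    simp only [Finset.coe_empty, Submodule.span_empty]
    rw [← Nat.succ_pred_eq_of_pos (show 0 < N by omega), pow_succ]
    simp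
  | insert a s ha ih =>
    obtain ⟨C, hqC, hC⟩ := ih (fun x hx => hs (by simp [hx]))
    have haL : a ∈ L := hs (by simp)
    have hsL : Submodule.span k (s : Set K) ≤ L := Submodule.span_le.2 (fun x hx => hs (by simp [hx]))
    have haL' : Submodule.span k {a} ≤ L := by rw [Submodule.span_singleton_le_iff_mem]; exact haL
    refine ⟨q + C, by omega, fun N hN => ?_⟩
    rw [Finset.coe_insert, Submodule.span_insert]
    change (Submodule.span k {a} + Submodule.span k (s : Set K)) ^ N ≤ _
    rw [add_pow]
    refine sum_le_of _ _ _ fun i hi => ?_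
    have hi : i ≤ N := by simpa [Nat.lt_succ_iff] using hi
    have h1 : Submodule.span k {a} ^ i * Submodule.span k (s : Set K) ^ (N - i) ≤ Fq q L * L ^ (N - q) := by
      by_cases hiq : q ≤ i
      · have e1 : Submodule.span k {a} ^ q ≤ Fq q L := by
          rw [Submodule.span_pow, Set.singleton_pow, Submodule.span_singleton_le_iff_mem]
          exact Submodule.subset_span ⟨a, haL, rfl⟩
        calc Submodule.span k {a} ^ i * Submodule.span k (s : Set K) ^ (N - i)
            = Submodule.span k {a} ^ q * (Submodule.span k {a} ^ (i - q) * Submodule.span k (s : Set K) ^ (N - i)) := by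
              rw [← mul_assoc, ← pow_add, Nat.add_sub_cancel' hiq]
          _ ≤ Fq q L * (L ^ (i - q) * L ^ (N - i)) := by
              gcongr
          _ = Fq q L * L ^ (N - q) := by
              rw [← pow_add]; congr 2; omega
      · calc Submodule.span k {a} ^ i * Submodule.span k (s : Set K) ^ (N - i)
            ≤ L ^ i * (Fq q L * L ^ (N - i - q)) := by
              gcongr
              exact hC _ (by omega)
          _ = Fq q L * L ^ (N - q) := by
              rw [mul_left_comm, ← pow_add]; congr 2; omega
    refine le_trans ?_ h1
    rw [mul_comm]
    rw [Submodule.mul_le]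
    intro x hx y hy
    have hx' : x ∈ (1 : Submodule k K) := by
      have : ((N.choose i : ℕ) : Submodule k K) ≤ 1 := by
        generalize N.choose i = c
        induction c with
        | zero => simp
        | succ c ih => rw [Nat.cast_succ]; exact sup_le ih le_rfl
      exact this hx
    obtain ⟨r, rfl⟩ := Submodule.mem_one.1 hx'
    rw [← Algebra.smul_def]
    exact Submodule.smul_mem _ _ hy

lemma pigeon' (q : ℕ) (hL : Module.Finite k L) : ∃ C : ℕ, ∀ m, L ^ (q * m + C) ≤ L ^ C * (Fq q (L ^ m)) := by
  obtain ⟨s, hs⟩ := Module.Finite.iff_fg.1 hL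
  obtain ⟨C, hqC, hC⟩ := pigeon (k := k) (L := L) q s (by rw [← hs]; exact Submodule.subset_span)
  rw [hs] at hC
  refine ⟨C, fun m => ?_⟩
  have : L ^ (q * m + C) ≤ L ^ C * (Fq q L) ^ m := by
    induction m with
    | zero => simp
    | succ m ih =>
      refine (hC _ (by nlinarith)).trans ?_
      rw [show q * (m + 1) + C - q = q * m + C by rw [mul_add]; omega, pow_succ]
      refine (mul_le_mul' le_rfl ih).trans ?_
      rw [mul_comm, mul_assoc]
  exact this.trans (mul_le_mul' le_rfl (Fq_pow _ _))

theorem gd_succ {p : ℕ} (hp : p.Prime) [CharP K p] (hL : Module.Finite k L) : ∃ C : ℕ, ∀ {ι : Type} [Fintype ι]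
    (φ : ι → K) (d : ι → ℕ) (n m : ℕ), gd L p φ d n m → gd L p φ d (n + 1) (p * m + C) := by
  haveI := Fact.mk hp
  obtain ⟨C, hC⟩ := pigeon' p hL
  refine ⟨C, fun {ι} _ φ d n m h => ?_⟩
  refine (hC m).trans ?_
  have : Fq p (L ^ m) ≤ Gz L (frob (p ^ (n + 1)) φ) (fun i => ((p ^ (n + 1) : ℕ) : ℤ) * (d i : ℤ)) (p * m : ℕ) := by
    rw [Fq, Submodule.span_le]
    rintro _ ⟨x, hx, rfl⟩
    obtain ⟨a, ha, rfl⟩ := h hx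
    refine ⟨fun i => a i ^ p, fun i => ?_, ?_⟩
    · have := Lz_pow (ha i) p hp.ne_zero
      convert this using 2
      push_cast; ring
    · simp only
      rw [sum_pow_of_hq hp.ne_zero (fun x y => add_pow_char x y p)]
      simp only [frob, mul_pow, ← pow_mul, pow_succ]
  have := Lpow_mul_le_Gz (n := C) this
  rw [show ((p * m + C : ℕ) : ℤ) = C + (p * m : ℕ) by push_cast; ring]
  exact this

end Good
end FThr
end part11


section part12
set_option linter.all false
open scoped nonZeroDivisors

namespace FThr

universe u

lemma seq_stab {h : ℕ → ℕ} {H d : ℕ} (hH : ∀ m, h m ≤ H) (hm : ∀ m, h m ≤ h (m + d)) :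
    ∃ C, ∀ m, C ≤ m → h (m + d) = h m := by
  rcases Nat.eq_zero_or_pos d with rfl | hd
  · exact ⟨0, fun m _ => rfl⟩
  -- potential : sum over a window
  set S : ℕ → ℕ := fun m => ∑ i ∈ Finset.range d, h (m + i) with hS
  have hstep : ∀ m, S (m + 1) + h m = S m + h (m + d) := by
    intro m
    have h1 := Finset.sum_range_succ (fun i => h (m + i)) d
    have h2 := Finset.sum_range_succ' (fun i => h (m + i)) d
    simp only [hS]
    have e : ∑ i ∈ Finset.range d, h (m + 1 + i) = ∑ i ∈ Finset.range d, h (m + (i + 1)) :=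
      Finset.sum_congr rfl fun i _ => by rw [add_assoc, add_comm 1 i]
    rw [e]
    simp only [add_zero] at h2
    omega
  have hmono : Monotone S := monotone_nat_of_le_succ fun m => by
    have := hstep m; have := hm m; omega
  have hb : ∀ m, S m ≤ d * H := by
    intro m
    have := Finset.sum_le_card_nsmul (Finset.range d) (fun i => h (m + i)) H (fun i _ => hH _)
    simpa using this
  have hbd : BddAbove (Set.range S) := ⟨d * H, by rintro _ ⟨m, rfl⟩; exact hb m⟩
  obtain ⟨C, hC⟩ := Nat.sSup_mem (Set.range_nonempty S) hbd
  refine ⟨C, fun m hCm => ?_⟩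
  have h1 := hstep m
  have h2 : S (m + 1) ≤ S C := by rw [hC]; exact le_csSup hbd ⟨_, rfl⟩
  have h3 := hmono hCm
  have h4 := hm m
  omega

section D1

variable {k : Type*} {K : Type u} [Field k] [Field K] [Algebra k K] {L : Submodule k K}
  {ι : Type} [Fintype ι]

/-- the ideal generated by `v` -/
noncomputable def Vv (L : Submodule k K) (e' : ℕ) (v : K) (m : ℕ) : Submodule k K :=
  (Lz L ((m : ℤ) - e')).map (LinearMap.mulLeft k v)

lemma mem_Vv {e' m : ℕ} {v x : K} : x ∈ Vv L e' v m ↔ ∃ y ∈ Lz L ((m : ℤ) - e'), v * y = x := Iff.rfl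

lemma Vv_le {e' : ℕ} {v : K} (hv : v ∈ L ^ e') (m : ℕ) : Vv L e' v m ≤ L ^ m := by
  rintro _ ⟨y, hy, rfl⟩
  have := Lz_mul (by rwa [Lz_nat] : v ∈ Lz L (e' : ℤ)) hy
  rw [add_sub_cancel, Lz_nat] at this
  exact this

lemma Vv_mul {e' m a : ℕ} {v x y : K} (hx : x ∈ L ^ a) (hy : y ∈ Vv L e' v m) : x * y ∈ Vv L e' v (m + a) := by
  obtain ⟨z, hz, rfl⟩ := hy
  refine ⟨x * z, ?_, by simp; ring⟩
  have := Lz_mul (by rwa [Lz_nat] : x ∈ Lz L (a : ℤ)) hz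
  have e : ((m + a : ℕ) : ℤ) - e' = a + (m - e') := by push_cast; ring
  rw [e]
  exact this

/-- partial torsion -/
def BZ (L : Submodule k K) (φ : ι → K) (d : ι → ℕ) (e' : ℕ) (v : K) (Z : Finset ι) (m : ℕ) : Submodule k K where
  carrier := {r | r ∈ L ^ m ∧ ∀ i ∈ Z, ∃ J, ∀ j ≥ J, φ i ^ j * r ∈ Vv L e' v (m + j * d i)}
  zero_mem' := ⟨zero_mem _, fun i _ => ⟨0, fun j _ => by rw [mul_zero]; exact zero_mem _⟩⟩
  add_mem' := by
    rintro a b ⟨ha, ha'⟩ ⟨hb, hb'⟩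
    refine ⟨add_mem ha hb, fun i hi => ?_⟩
    obtain ⟨J, hJ⟩ := ha' i hi
    obtain ⟨J', hJ'⟩ := hb' i hi
    refine ⟨max J J', fun j hj => ?_⟩
    rw [mul_add]
    exact add_mem (hJ j (le_of_max_le_left hj)) (hJ' j (le_of_max_le_right hj))
  smul_mem' := by
    rintro c a ⟨ha, ha'⟩
    refine ⟨Submodule.smul_mem _ _ ha, fun i hi => ?_⟩
    obtain ⟨J, hJ⟩ := ha' i hi
    exact ⟨J, fun j hj => by rw [mul_smul_comm]; exact Submodule.smul_mem _ _ (hJ j hj)⟩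

variable {φ : ι → K} {d : ι → ℕ} {e' : ℕ} {v : K}

lemma BZ_le (Z : Finset ι) (m : ℕ) : BZ L φ d e' v Z m ≤ L ^ m := fun _ h => h.1

lemma Vv_le_BZ (hφ : ∀ i, φ i ∈ L ^ (d i)) (hv : v ∈ L ^ e') (Z : Finset ι) (m : ℕ) :
    Vv L e' v m ≤ BZ L φ d e' v Z m := by
  intro x hx
  refine ⟨Vv_le hv m hx, fun i _ => ⟨0, fun j _ => Vv_mul ?_ hx⟩⟩
  have := Submodule.pow_mem_pow _ (hφ i) j
  rwa [← pow_mul, mul_comm] at this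

lemma BZ_anti [DecidableEq ι] (Z : Finset ι) (i : ι) (m : ℕ) : BZ L φ d e' v (insert i Z) m ≤ BZ L φ d e' v Z m :=
  fun _ h => ⟨h.1, fun j hj => h.2 j (Finset.mem_insert_of_mem hj)⟩

lemma BZ_mul (Z : Finset ι) {m a : ℕ} {x y : K} (hx : x ∈ L ^ a) (hy : y ∈ BZ L φ d e' v Z m) :
    x * y ∈ BZ L φ d e' v Z (m + a) := by
  refine ⟨by rw [add_comm]; exact Lpow_mul hx hy.1, fun i hi => ?_⟩
  obtain ⟨J, hJ⟩ := hy.2 i hi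
  refine ⟨J, fun j hj => ?_⟩
  have := Vv_mul hx (hJ j hj)
  rw [mul_left_comm, show m + a + j * d i = m + j * d i + a by ring]
  exact this

lemma BZ_inj [DecidableEq ι] (Z : Finset ι) {m : ℕ} {i : ι} {r : K} (hr : r ∈ BZ L φ d e' v Z m)
    (h : φ i * r ∈ BZ L φ d e' v (insert i Z) (m + d i)) : r ∈ BZ L φ d e' v (insert i Z) m := by
  refine ⟨hr.1, fun l hl => ?_⟩
  rcases Finset.mem_insert.1 hl with rfl | hl
  · obtain ⟨J, hJ⟩ := h.2 l (Finset.mem_insert_self _ _)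
    refine ⟨J + 1, fun j hj => ?_⟩
    obtain ⟨j, rfl⟩ := Nat.exists_eq_add_of_le' (show 1 ≤ j by omega)
    have := hJ j (by omega)
    rw [← mul_assoc, ← pow_succ] at this
    rw [show m + (j + 1) * d l = m + d l + j * d l by ring]
    exact this
  · exact hr.2 l hl

lemma Lpow_fin (hL : Module.Finite k L) (m : ℕ) : Module.Finite k (L ^ m : Submodule k K) :=
  Module.Finite.iff_fg.2 ((Module.Finite.iff_fg.1 hL).pow m)

lemma map_mul_finrank {x : K} (hx : x ≠ 0) (X : Submodule k K) :
    Module.finrank k (X.map (LinearMap.mulLeft k x)) = Module.finrank k X :=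
  ((Submodule.equivMapOfInjective _ (mul_right_injective₀ hx) X).finrank_eq).symm

lemma Setup.finrank_Rt (E : Setup k K L) (a b : ℕ) :
    Module.finrank k (E.Rt (a + b : ℕ)) ≤ Module.finrank k (E.Rt a) + b * (E.A.deg + E.B.deg) := by
  have hf : ∀ m : ℕ, (ind ⊥ (E.Rt m)) = (Module.finrank k (E.Rt m) : ℕ∞) := by
    intro m
    haveI := E.Rt_fin m
    rw [ind_bot, Module.length_eq_finrank]
  have h1 := ind_triangle ⊥ (E.Rt a) (E.Rt (a + b : ℕ))
  have h2 := ind_inf_le (E.A.pwk a) (E.A.pwk (a + b : ℕ)) (E.B.pwk a) (E.B.pwk (a + b : ℕ))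
  rw [E.A.ind_pw E.oneL (n := b) (by push_cast; ring), E.B.ind_pw E.oneL (n := b) (by push_cast; ring)] at h2
  rw [hf, hf] at h1
  have h3 := h1.trans (add_le_add le_rfl h2)
  rw [mul_add]
  exact_mod_cast h3

lemma Setup.bdd (E : Setup k K L) (hv0 : v ≠ 0) (e' : ℕ) :
    ∃ H : ℕ, ∀ m, Module.finrank k (L ^ m : Submodule k K) ≤ Module.finrank k (Vv L e' v m) + H := by
  obtain ⟨e0, v0, hv, hv00, hcond⟩ := E.exists_cond
  refine ⟨Module.finrank k (L ^ (e' + e0) : Submodule k K) + (e' + e0) * (E.A.deg + E.B.deg), fun m => ?_⟩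
  haveI := E.Lfd
  by_cases hm : m ≤ e' + e0
  · haveI := Lpow_fin E.Lfd (e' + e0)
    have := Submodule.finrank_mono (Lpow_mono (k := k) E.oneL hm)
    omega
  · obtain ⟨a, rfl⟩ := Nat.exists_eq_add_of_le (le_of_not_ge hm)
    haveI := E.Rt_fin (a + (e' + e0))
    haveI := Lpow_fin E.Lfd (a + e0)
    have h1 : Module.finrank k (L ^ (e' + e0 + a) : Submodule k K) ≤ Module.finrank k (E.Rt (a + (e' + e0) : ℕ)) := by
      apply Submodule.finrank_mono
      intro x hx
      rw [add_comm] at hx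
      exact E.Lpow_Rt hx
    have h2 := E.finrank_Rt a (e' + e0)
    have h3 : Module.finrank k (E.Rt a) ≤ Module.finrank k (L ^ (a + e0) : Submodule k K) := by
      rw [← map_mul_finrank hv00]
      apply Submodule.finrank_mono
      rintro _ ⟨x, hx, rfl⟩
      exact hcond a x hx
    have h4 : Module.finrank k (Vv L e' v (e' + e0 + a)) = Module.finrank k (L ^ (a + e0) : Submodule k K) := by
      rw [Vv, map_mul_finrank hv0, show (((e' + e0 + a : ℕ) : ℤ) - e') = (a + e0 : ℕ) by push_cast; ring, Lz_nat]
    omega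

lemma Setup.BZ_step [DecidableEq ι] (E : Setup k K L) (hφ : ∀ i, φ i ∈ L ^ (d i)) (hv : v ∈ L ^ e') (hv0 : v ≠ 0)
    (Z : Finset ι) (i : ι) : ∃ C : ℕ, ∀ m, C ≤ m → ∀ r ∈ BZ L φ d e' v Z (m + d i),
      ∃ r' ∈ BZ L φ d e' v Z m, r - φ i * r' ∈ BZ L φ d e' v (insert i Z) (m + d i) := by
  by_cases h0 : φ i = 0
  · refine ⟨0, fun m _ r hr => ⟨0, zero_mem _, ?_⟩⟩
    rw [mul_zero, sub_zero]
    refine ⟨hr.1, fun l hl => ?_⟩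
    rcases Finset.mem_insert.1 hl with rfl | hl
    · refine ⟨1, fun j hj => ?_⟩
      rw [h0, zero_pow (by omega), zero_mul]
      exact zero_mem _
    · exact hr.2 l hl
  obtain ⟨H, hH⟩ := E.bdd hv0 e'
  haveI hfin : ∀ m, Module.Finite k (L ^ m : Submodule k K) := fun m => Lpow_fin E.Lfd m
  have hfB : ∀ Z m, Module.Finite k (BZ L φ d e' v Z m) := fun Z m =>
    Submodule.finiteDimensional_of_le (BZ_le Z m)
  set Z' := insert i Z with hZ'
  set f : ℕ → ℕ := fun m => Module.finrank k (BZ L φ d e' v Z m) with hf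
  set f' : ℕ → ℕ := fun m => Module.finrank k (BZ L φ d e' v Z' m) with hf'
  have hff : ∀ m, f' m ≤ f m := fun m => Submodule.finrank_mono (BZ_anti Z i m)
  -- the sum
  set X : ℕ → Submodule k K := fun m => (BZ L φ d e' v Z m).map (LinearMap.mulLeft k (φ i)) with hX
  haveI : ∀ m, Module.Finite k (X m) := fun m => by rw [hX]; infer_instance
  have hXle : ∀ m, X m ⊔ BZ L φ d e' v Z' (m + d i) ≤ BZ L φ d e' v Z (m + d i) := by
    intro m
    refine sup_le ?_ (BZ_anti Z i _)
    rintro _ ⟨r, hr, rfl⟩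
    exact BZ_mul Z (hφ i) hr
  have hsum : ∀ m, Module.finrank k (X m ⊔ BZ L φ d e' v Z' (m + d i) : Submodule k K) + f' m = f m + f' (m + d i) := by
    intro m
    have h1 := Submodule.finrank_sup_add_finrank_inf_eq (X m) (BZ L φ d e' v Z' (m + d i))
    have h2 : X m ⊓ BZ L φ d e' v Z' (m + d i) = (BZ L φ d e' v Z' m).map (LinearMap.mulLeft k (φ i)) := by
      apply le_antisymm
      · rintro _ ⟨⟨r, hr, rfl⟩, hr'⟩
        exact ⟨r, BZ_inj Z hr hr', rfl⟩
      · rintro _ ⟨r, hr, rfl⟩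
        exact ⟨⟨r, BZ_anti Z i m hr, rfl⟩, BZ_mul Z' (hφ i) hr⟩
    rw [h2, map_mul_finrank h0, map_mul_finrank h0] at h1
    exact h1
  obtain ⟨C, hC⟩ := seq_stab (h := fun m => f m - f' m) (H := H) (d := d i) (by
    intro m
    have h1 := hH m
    have h2 : f m ≤ _ := Submodule.finrank_mono (BZ_le (φ := φ) (d := d) (e' := e') (v := v) Z m)
    have h3 : _ ≤ f' m := Submodule.finrank_mono (Vv_le_BZ hφ hv Z' m)
    omega) (by
    intro m
    have h1 := hsum m
    have h2 : _ ≤ f (m + d i) := Submodule.finrank_mono (hXle m)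
    have := hff m
    have := hff (m + d i)
    omega)
  refine ⟨C, fun m hm r hr => ?_⟩
  have heq : X m ⊔ BZ L φ d e' v Z' (m + d i) = BZ L φ d e' v Z (m + d i) := by
    apply Submodule.eq_of_le_of_finrank_le (hXle m)
    have h1 := hsum m
    have h2 := hC m hm
    have := hff m
    have := hff (m + d i)
    change f (m + d i) ≤ _
    omega
  rw [← heq] at hr
  obtain ⟨_, ⟨r', hr', rfl⟩, w, hw, rfl⟩ := Submodule.mem_sup.1 hr
  refine ⟨r', hr', ?_⟩
  simpa using hw

lemma Setup.BZ_step_pow [DecidableEq ι] (E : Setup k K L) (hφ : ∀ i, φ i ∈ L ^ (d i)) (hv : v ∈ L ^ e') (hv0 : v ≠ 0)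
    (Z : Finset ι) (i : ι) : ∃ C : ℕ, ∀ q m, C ≤ m → ∀ r ∈ BZ L φ d e' v Z (m + q * d i),
      ∃ r' ∈ BZ L φ d e' v Z m, r - φ i ^ q * r' ∈ BZ L φ d e' v (insert i Z) (m + q * d i) := by
  obtain ⟨C, hC⟩ := E.BZ_step hφ hv hv0 Z i
  refine ⟨C, fun q m hm => ?_⟩
  induction q with
  | zero =>
    intro r hr
    refine ⟨r, by simpa using hr, ?_⟩
    simp
  | succ q ih =>
    intro r hr
    have e : m + (q + 1) * d i = m + q * d i + d i := by ring
    rw [e] at hr ⊢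
    obtain ⟨r1, hr1, h1⟩ := hC _ (by omega) r hr
    obtain ⟨r2, hr2, h2⟩ := ih r1 hr1
    refine ⟨r2, hr2, ?_⟩
    have := add_mem h1 (BZ_mul (insert i Z) (hφ i) h2)
    convert this using 1
    ring

lemma Setup.BZ_all (E : Setup k K L) (hφ : ∀ i, φ i ∈ L ^ (d i)) (hv : v ∈ L ^ e') (hv0 : v ≠ 0)
    (p : ℕ) (Z : Finset ι) : ∃ C : ℕ, ∀ n M, (∀ i, p ^ n * d i + C ≤ M) →
      ∀ x ∈ L ^ M, ∃ r ∈ BZ L φ d e' v Z M,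
        x - r ∈ Gz L (frob (p ^ n) φ) (fun i => ((p ^ n : ℕ) : ℤ) * (d i : ℤ)) M := by
  classical
  induction Z using Finset.induction_on with
  | empty =>
    refine ⟨0, fun n M _ x hx => ⟨x, ⟨hx, by simp⟩, by rw [sub_self]; exact zero_mem _⟩⟩
  | insert i Z hi ih =>
    obtain ⟨C, hC⟩ := ih
    obtain ⟨C', hC'⟩ := E.BZ_step_pow hφ hv hv0 Z i
    refine ⟨C + C', fun n M hM x hx => ?_⟩
    obtain ⟨r, hr, hxr⟩ := hC n M (fun i => by have := hM i; omega) x hx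
    obtain ⟨m, rfl⟩ := Nat.exists_eq_add_of_le' (show p ^ n * d i ≤ M by have := hM i; omega)
    obtain ⟨r', hr', h2⟩ := hC' (p ^ n) m (by have := hM i; omega) r hr
    refine ⟨_, h2, ?_⟩
    have h3 : φ i ^ p ^ n * r' ∈ Gz L (frob (p ^ n) φ) (fun i => ((p ^ n : ℕ) : ℤ) * (d i : ℤ)) (m + p ^ n * d i : ℕ) := by
      refine ⟨Pi.single i r', fun l => ?_, ?_⟩
      · by_cases hl : l = i
        · subst hl
          rw [Pi.single_eq_same, show (((m + p ^ n * d l : ℕ) : ℤ) - ((p ^ n : ℕ) : ℤ) * (d l : ℤ)) = (m : ℕ) by push_cast; ring, Lz_nat]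
          exact hr'.1
        · rw [Pi.single_eq_of_ne hl]; exact zero_mem _
      · rw [Finset.sum_eq_single i]
        · rw [Pi.single_eq_same, frob, mul_comm]
        · intro l _ hl; rw [Pi.single_eq_of_ne hl, zero_mul]
        · simp
    have := add_mem hxr h3
    convert this using 1
    ring

end D1
end FThr
end part12


section part13
set_option linter.all false
open scoped nonZeroDivisors

namespace FThr

universe u

section Sat

open Polynomial

variable {k : Type*} {K : Type u} [Field k] [Field K] [Algebra k K] {L : Submodule k K}
  {ι : Type} [Fintype ι]

/-- the graded ring of `L` -/
noncomputable def RL (L : Submodule k K) : Subalgebra k K[X] where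
  carrier := {f | ∀ m, f.coeff m ∈ L ^ m}
  mul_mem' := by
    intro f g hf hg m
    rw [Polynomial.coeff_mul]
    refine sum_mem fun x hx => ?_
    rw [← Finset.HasAntidiagonal.mem_antidiagonal.1 hx]
    exact Lpow_mul (hf _) (hg _)
  add_mem' := by
    intro f g hf hg m
    rw [Polynomial.coeff_add]
    exact add_mem (hf m) (hg m)
  algebraMap_mem' := by
    intro r m
    rw [Polynomial.algebraMap_apply, Polynomial.coeff_C]
    split_ifs with h
    · subst h
      rw [pow_zero, Algebra.algebraMap_eq_smul_one]
      exact Submodule.smul_mem _ _ (Submodule.one_le.1 le_rfl)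
    · exact zero_mem _

lemma RL_mon {m : ℕ} {r : K} (hr : r ∈ L ^ m) : monomial m r ∈ RL L := by
  intro n
  rw [coeff_monomial]
  split_ifs with h
  · subst h; exact hr
  · exact zero_mem _

lemma RL_noeth (hL : Module.Finite k L) : IsNoetherianRing (RL L) := by
  obtain ⟨s, hs⟩ := Module.Finite.iff_fg.1 hL
  have key : RL L = Algebra.adjoin k ((fun a : K => monomial 1 a) '' (s : Set K)) := by
    apply le_antisymm
    · have h1 : ∀ a ∈ L, monomial 1 a ∈ Algebra.adjoin k ((fun a : K => monomial 1 a) '' (s : Set K)) := by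
        intro a ha
        rw [← hs] at ha
        refine Submodule.span_induction (p := fun a _ => monomial 1 a ∈ Algebra.adjoin k ((fun a : K => monomial 1 a) '' (s : Set K))) ?_ ?_ ?_ ?_ ha
        · intro x hx; exact Algebra.subset_adjoin ⟨x, hx, rfl⟩
        · rw [map_zero]; exact zero_mem _
        · intro x y _ _ hx hy; rw [map_add]; exact add_mem hx hy
        · intro c x _ hx
          rw [← smul_monomial]; exact Subalgebra.smul_mem _ hx c
      have h2 : ∀ m, ∀ a ∈ L ^ m, monomial m a ∈ Algebra.adjoin k ((fun a : K => monomial 1 a) '' (s : Set K)) := by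
        intro m
        induction m with
        | zero =>
          intro a ha
          rw [pow_zero] at ha
          obtain ⟨r, rfl⟩ := Submodule.mem_one.1 ha
          exact Subalgebra.algebraMap_mem _ r
        | succ m ih =>
          intro a ha
          rw [pow_succ] at ha
          refine Submodule.mul_induction_on (C := fun a => monomial (m + 1) a ∈ Algebra.adjoin k ((fun a : K => monomial 1 a) '' (s : Set K))) ha ?_ ?_
          · intro x hx y hy
            rw [← monomial_mul_monomial]
            exact mul_mem (ih x hx) (h1 y hy)
          · intro x y hx hy; rw [map_add]; exact add_mem hx hy
      intro f hf
      rw [← Polynomial.sum_monomial_eq f, Polynomial.sum]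
      exact sum_mem fun m _ => h2 m _ (hf m)
    · rw [Algebra.adjoin_le_iff]
      rintro _ ⟨a, ha, rfl⟩
      apply RL_mon
      rw [pow_one, ← hs]
      exact Submodule.subset_span ha
  have hfg : (RL L).FG := by
    rw [key]
    classical
    exact ⟨s.image (fun a : K => monomial 1 a), by rw [Finset.coe_image]⟩
  haveI : Algebra.FiniteType k (RL L) := (Subalgebra.fg_iff_finiteType _).1 hfg
  exact Algebra.FiniteType.isNoetherianRing k _

variable {φ : ι → K} {d : ι → ℕ} {e' : ℕ} {v : K}

lemma gd_large {p : ℕ} (hp : p.Prime) [CharP K p] (hL : Module.Finite k L) {n1 : ℕ}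
    (h : ∃ m, gd L p φ d n1 m) {n : ℕ} (hn : n1 ≤ n) : ∃ m, gd L p φ d n m := by
  obtain ⟨C, hC⟩ := gd_succ (L := L) hp hL
  induction n, hn using Nat.le_induction with
  | base => exact h
  | succ n hn ih =>
    obtain ⟨m, hm⟩ := ih
    exact ⟨_, hC φ d n m hm⟩

lemma BZ_tors {p : ℕ} (hp : p.Prime) [CharP K p] (hL : Module.Finite k L) {n1 : ℕ}
    (h : ∃ m, gd L p φ d n1 m) {m : ℕ} {r : K} (hr : r ∈ BZ L φ d e' v Finset.univ m) :
    ∃ J : ℕ, ∀ x ∈ L ^ J, x * r ∈ Vv L e' v (m + J) := by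
  choose J hJ using fun i => hr.2 i (Finset.mem_univ i)
  have hn : ∃ n, n1 ≤ n ∧ ∀ i, J i ≤ p ^ n := by
    refine ⟨n1 + ∑ i, J i, by omega, fun i => ?_⟩
    have h1 : J i ≤ ∑ i, J i := Finset.single_le_sum (fun _ _ => Nat.zero_le _) (Finset.mem_univ i)
    have h2 := Nat.lt_pow_self hp.one_lt (n := n1 + ∑ i, J i)
    omega
  obtain ⟨n, hn1, hn2⟩ := hn
  obtain ⟨M, hM⟩ := gd_large hp hL h hn1
  refine ⟨M, fun x hx => ?_⟩
  obtain ⟨a, ha, rfl⟩ := hM hx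
  rw [Finset.sum_mul]
  refine sum_mem fun i _ => ?_
  have h1 := hJ i (p ^ n) (hn2 i)
  have h2 := ha i
  rw [Lz] at h2
  split_ifs at h2 with h3
  · have h4 := Vv_mul h2 h1
    rw [mul_assoc]
    convert h4 using 2
    beta_reduce at h3
    have h5 : (0 : ℤ) ≤ (M : ℤ) - ((p ^ n * d i : ℕ) : ℤ) := by push_cast at h3 ⊢; exact h3
    have h6 : ((M : ℤ) - ((p ^ n : ℕ) : ℤ) * (d i : ℤ)) = (M : ℤ) - ((p ^ n * d i : ℕ) : ℤ) := by push_cast; ring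
    rw [h6]
    omega
    rfl
  · rw [Submodule.mem_bot] at h2
    rw [h2, zero_mul, zero_mul]
    exact zero_mem _

lemma BZ_sat {p : ℕ} (hp : p.Prime) [CharP K p] (hL : Module.Finite k L) {n1 : ℕ}
    (h : ∃ m, gd L p φ d n1 m) : ∃ N : ℕ, ∀ M, N ≤ M → BZ L φ d e' v Finset.univ M ≤ Vv L e' v M := by
  haveI := RL_noeth hL
  set S : Set (RL L) := {f | ∃ m, ∃ r ∈ BZ L φ d e' v Finset.univ m, (f : K[X]) = monomial m r} with hS
  obtain ⟨s, hsS, hs⟩ := Submodule.fg_span_iff_fg_span_finset_subset S |>.1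
    (IsNoetherian.noetherian (Submodule.span (RL L) S))
  have h1 : ∀ g ∈ S, ∃ N : ℕ, ∀ M, N ≤ M → ∀ a : RL L, ((a : K[X]) * (g : K[X])).coeff M ∈ Vv L e' v M := by
    rintro g ⟨m, r, hr, hg⟩
    obtain ⟨J, hJ⟩ := BZ_tors hp hL h hr
    refine ⟨m + J, fun M hM a => ?_⟩
    obtain ⟨b, rfl⟩ := Nat.exists_eq_add_of_le hM
    rw [hg, show m + J + b = (J + b) + m by ring, coeff_mul_monomial]
    have ha := a.2 (J + b)
    rw [show L ^ (J + b) = L ^ b * L ^ J by rw [← pow_add, add_comm]] at ha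
    refine Submodule.mul_induction_on (C := fun x => x * r ∈ Vv L e' v (J + b + m)) ha ?_ ?_
    · intro x hx y hy
      rw [mul_assoc, show J + b + m = m + J + b by ring]
      exact Vv_mul hx (hJ y hy)
    · intro x y hx hy; rw [add_mul]; exact add_mem hx hy
  choose! N hN using h1
  refine ⟨∑ g ∈ s, N g, fun M hM r hr => ?_⟩
  have h2 : (⟨monomial M r, RL_mon hr.1⟩ : RL L) ∈ Submodule.span (RL L) (s : Set (RL L)) := by
    rw [← hs]
    exact Submodule.subset_span ⟨M, r, hr, rfl⟩
  have h3 : ∀ f ∈ Submodule.span (RL L) (s : Set (RL L)), (f : K[X]).coeff M ∈ Vv L e' v M := by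
    intro f hf
    refine Submodule.closure_induction (p := fun (f : RL L) _ => (f : K[X]).coeff M ∈ Vv L e' v M) ?_ ?_ ?_ hf
    · simp
    · intro x y _ _ hx hy
      rw [Subalgebra.coe_add, coeff_add]; exact add_mem hx hy
    · intro a g hg
      have hgN : N g ≤ M := le_trans (Finset.single_le_sum (f := N) (fun _ _ => Nat.zero_le _) hg) hM
      have := hN g (hsS hg) M hgN a
      rwa [smul_eq_mul, Subalgebra.coe_mul]
  have := h3 _ h2
  simpa using this

theorem Setup.dim1 (E : Setup k K L) {p : ℕ} (hp : p.Prime) [CharP K p] (hφ : ∀ i, φ i ∈ L ^ (d i)) {n1 : ℕ}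
    (h : ∃ m, gd L p φ d n1 m) : Dim1 L p φ d := by
  intro e' v hv hv0
  obtain ⟨C, hC⟩ := E.BZ_all hφ hv hv0 p Finset.univ
  obtain ⟨N, hN⟩ := BZ_sat (φ := φ) (d := d) (e' := e') (v := v) hp E.Lfd h
  refine ⟨C + N, fun n M hM x hx => ?_⟩
  have hne : Nonempty ι := by
    by_contra hc
    rw [not_nonempty_iff] at hc
    obtain ⟨m, hm⟩ := h
    have h1 : (1 : K) ∈ L ^ m := by
      have := Submodule.pow_mem_pow _ E.oneL m
      rwa [one_pow] at this
    obtain ⟨a, -, ha⟩ := hm h1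
    simp at ha
  obtain ⟨r, hr, hxr⟩ := hC n (M + e') (fun i => by have := hM i; omega) x hx
  have hr' := hN (M + e') (by have := hM hne.some; omega) hr
  obtain ⟨y, hy, rfl⟩ := mem_Vv.1 hr'
  refine ⟨y, ?_, hxr⟩
  rwa [show (((M + e' : ℕ) : ℤ) - e') = (M : ℕ) by push_cast; ring, Lz_nat] at hy

end Sat

section Limit

variable {k : Type*} {K : Type u} [Field k] [Field K] [Algebra k K] {L : Submodule k K}

theorem Setup.rat_aux (E : Setup k K L) {p : ℕ} (hp : p.Prime) [CharP K p] (N : ℕ) :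
    ∀ (ι : Type) [Fintype ι], Fintype.card ι = N → ∀ (φ : ι → K) (d : ι → ℕ), (∀ i, φ i ∈ L ^ (d i)) → ∀ c : ℝ, 0 ≤ c →
    (∀ x > c, ∀ᶠ n : ℕ in atTop, ∀ m : ℕ, x * (p : ℝ) ^ n ≤ m → gd L p φ d n m) →
    (∀ x < c, ∀ᶠ n : ℕ in atTop, ∀ m : ℕ, m ≤ x * (p : ℝ) ^ n → ¬ gd L p φ d n m) →
    ∃ r : ℚ, (r : ℝ) = c := by
  classical
  induction N with
  | zero =>
    intro ι _ hcard φ d hφ c hc0 hup hlow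
    have := Fintype.card_eq_zero_iff.1 hcard
    obtain ⟨n, hn⟩ := (hup (c + 1) (by linarith)).exists
    exact E.main hp hφ (fun i => this.elim i) hup hlow (E.dim1 hp hφ ⟨_, hn _ (Nat.le_ceil _)⟩)
  | succ N ih =>
    intro ι _ hcard φ d hφ c hc0 hup hlow
    by_cases hd : ∀ i, (d i : ℝ) < c
    · obtain ⟨n, hn⟩ := (hup (c + 1) (by linarith)).exists
      exact E.main hp hφ hd hup hlow (E.dim1 hp hφ ⟨_, hn _ (Nat.le_ceil _)⟩)
    push Not at hd
    obtain ⟨i0, hi0⟩ := hd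
    rcases hi0.eq_or_lt with heq | hlt
    · exact ⟨d i0, by rw [heq]; simp⟩
    have hpR : ∀ n : ℕ, (0 : ℝ) < (p : ℝ) ^ n := fun n => pow_pos (by exact_mod_cast hp.pos) n
    have hsub : ∀ n m, gd L p (fun i : {i // i ≠ i0} => φ i) (fun i => d i) n m → gd L p φ d n m := by
      intro n m h x hx
      obtain ⟨a, ha, rfl⟩ := h hx
      refine ⟨fun i => if hi : i ≠ i0 then a ⟨i, hi⟩ else 0, fun i => ?_, ?_⟩
      · simp only
        split_ifs with hi
        · exact ha ⟨i, hi⟩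
        · exact zero_mem _
      · rw [Fintype.sum_eq_add_sum_subtype_ne (fun i => (if hi : i ≠ i0 then a ⟨i, hi⟩ else 0) * frob (p ^ n) φ i) i0]
        rw [dif_neg (by simp), zero_mul, zero_add]
        refine Finset.sum_congr rfl fun i _ => ?_
        rw [dif_pos i.2]
        rfl
    have hsub' : ∀ n m, m < p ^ n * d i0 → gd L p φ d n m → gd L p (fun i : {i // i ≠ i0} => φ i) (fun i => d i) n m := by
      intro n m hm h x hx
      obtain ⟨a, ha, rfl⟩ := h hx
      refine ⟨fun i => a i, fun i => ha i, ?_⟩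
      have h0 : a i0 = 0 := by
        have := ha i0
        rw [Lz, if_neg, Submodule.mem_bot] at this
        · exact this
        · push Not
          have : (m : ℤ) < ((p ^ n * d i0 : ℕ) : ℤ) := by exact_mod_cast hm
          push_cast at this ⊢
          omega
      have h5 := Fintype.sum_eq_add_sum_subtype_ne (fun i => a i * frob (p ^ n) φ i) i0
      rw [h0, zero_mul, zero_add] at h5
      rw [h5]
      rfl
    refine ih {i // i ≠ i0} (by simp [hcard]) (fun i => φ i) (fun i => d i) (fun i => hφ i) c hc0 ?_ ?_
    · intro x hx
      obtain ⟨y, hy1, hy2⟩ := exists_between (lt_min hx hlt)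
      rw [lt_min_iff] at hy2
      obtain ⟨y', hy3, hy4⟩ := exists_between hy1
      filter_upwards [hup y' hy3, ev_ge hp (sub_pos.2 hy4) 1, ev_ge hp (sub_pos.2 hy2.2) 1] with n h1 h2 h3 m hm
      have hc : (⌈y' * (p : ℝ) ^ n⌉ : ℝ) < y' * (p : ℝ) ^ n + 1 := Int.ceil_lt_add_one _
      rw [sub_mul] at h2 h3
      by_cases hmd : m < p ^ n * d i0
      · exact hsub' n m hmd (h1 m (by nlinarith [hpR n]))
      · have hpos : 0 < p ^ n * d i0 := by
          refine Nat.mul_pos (pow_pos hp.pos n) ?_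
          have : (0 : ℝ) < d i0 := lt_of_le_of_lt hc0 hlt
          exact_mod_cast this
        refine gd_mono (m := p ^ n * d i0 - 1) (by omega) (hsub' n _ (by omega) (h1 _ ?_))
        rw [Nat.cast_sub hpos]
        push_cast
        linarith
    · intro x hx
      filter_upwards [hlow x hx] with n h m hm hg
      exact h m hm (hsub n m hg)

theorem Setup.rational (E : Setup k K L) {p : ℕ} (hp : p.Prime) [CharP K p] {ι : Type} [Fintype ι]
    (φ : ι → K) (d : ι → ℕ) (hφ : ∀ i, φ i ∈ L ^ (d i)) (hne : ∃ m, gd L p φ d 0 m) :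
    ∃ c : ℚ, Tendsto (fun n : ℕ => ((sInf {m | gd L p φ d n m} : ℕ) : ℝ) / (p : ℝ) ^ n) atTop (nhds (c : ℝ)) := by
  obtain ⟨C, hC⟩ := gd_succ (L := L) hp E.Lfd
  have hN : ∀ n, (sInf {m | gd L p φ d n m}) ∈ {m | gd L p φ d n m} := fun n =>
    Nat.sInf_mem (gd_large hp E.Lfd hne (Nat.zero_le n))
  set ν : ℕ → ℕ := fun n => sInf {m | gd L p φ d n m} with hν
  have hνd : ∀ n, sInf {m | gd L p φ d n m} = ν n := fun n => rfl
  have hpR : ∀ n : ℕ, (0 : ℝ) < (p : ℝ) ^ n := fun n => pow_pos (by exact_mod_cast hp.pos) n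
  have hp2 : (2 : ℝ) ≤ p := by exact_mod_cast hp.two_le
  have hstep : ∀ n, ν (n + 1) ≤ p * ν n + C := fun n => Nat.sInf_le (hC φ d n _ (hN n))
  have hanti : Antitone (fun n => ((ν n : ℝ) + C) / (p : ℝ) ^ n) := by
    apply antitone_nat_of_succ_le
    intro n
    rw [div_le_div_iff₀ (hpR _) (hpR _), pow_succ]
    have h1 : (ν (n + 1) : ℝ) ≤ p * ν n + C := by exact_mod_cast hstep n
    have h2 : (ν (n + 1) : ℝ) + C ≤ (ν n + C) * p := by
      have : (0 : ℝ) ≤ C := Nat.cast_nonneg C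
      nlinarith
    calc ((ν (n + 1) : ℝ) + C) * (p : ℝ) ^ n ≤ ((ν n + C) * p) * (p : ℝ) ^ n :=
          mul_le_mul_of_nonneg_right h2 (hpR n).le
      _ = _ := by ring
  have hbdd : BddBelow (Set.range (fun n => ((ν n : ℝ) + C) / (p : ℝ) ^ n)) :=
    ⟨0, by rintro _ ⟨n, rfl⟩; have := hpR n; positivity⟩
  have hlim := tendsto_atTop_ciInf hanti hbdd
  set c := ⨅ n, ((ν n : ℝ) + C) / (p : ℝ) ^ n with hc
  have hlim0 : Tendsto (fun n : ℕ => (C : ℝ) / (p : ℝ) ^ n) atTop (nhds 0) :=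
    tendsto_const_nhds.div_atTop (tendsto_pow_atTop_atTop_of_one_lt (by linarith))
  have hlim2 : Tendsto (fun n : ℕ => (ν n : ℝ) / (p : ℝ) ^ n) atTop (nhds c) := by
    have := hlim.sub hlim0
    rw [sub_zero] at this
    refine this.congr fun n => ?_
    rw [add_div]; ring
  have hc0 : 0 ≤ c := ge_of_tendsto' hlim2 fun n => by have := hpR n; positivity
  obtain ⟨r, hr⟩ := E.rat_aux hp (Fintype.card ι) ι rfl φ d hφ c hc0 (by
    intro x hx
    filter_upwards [hlim2.eventually_lt_const hx] with n hn m hm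
    rw [div_lt_iff₀ (hpR n)] at hn
    refine gd_mono ?_ (hN n)
    have : (ν n : ℝ) ≤ m := by linarith
    exact_mod_cast this) (by
    intro x hx
    filter_upwards [hlim2.eventually_const_lt hx] with n hn m hm hg
    rw [lt_div_iff₀ (hpR n)] at hn
    have h1 : ν n ≤ m := Nat.sInf_le hg
    have : (ν n : ℝ) ≤ m := by exact_mod_cast h1
    linarith)
  exact ⟨r, by rw [hr]; exact hlim2⟩

end Limit
end FThr
end part13


section part14
set_option linter.all false
open scoped nonZeroDivisors

namespace FThr

universe u

section MkChart

lemma ind_ne_top_of_quot {k V : Type*} [Field k] [AddCommGroup V] [Module k V] {X Y : Submodule k V}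
    (h : Module.Finite k (V ⧸ X)) : ind X Y ≠ ⊤ := by
  rw [ind_eq_length_range]
  haveI := h
  haveI : Module.Finite k (LinearMap.range (X.mkQ.comp Y.subtype)) := inferInstance
  rw [← ind_bot]
  exact ind_ne_top_of_finite

theorem mkChart {k A F : Type*} {K : Type u} [Field k] [CommRing A] [IsDomain A] [IsDedekindDomain A] [Algebra k A]
    [Field F] [Algebra A F] [IsFractionRing A F] [Field K] [Algebra F K] [Algebra A K] [IsScalarTower A F K]
    [FiniteDimensional F K] [Algebra.IsSeparable F K] [Algebra k K] [IsScalarTower k A K]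
    (hA : ∀ f : A, f ≠ 0 → Module.Finite k (A ⧸ Ideal.span {f}))
    (L : Submodule k K) (oneL : (1 : K) ∈ L) (Lfd : Module.Finite k L) :
    ∃ c : Chart k K L, ∀ x : K, x ∈ c.pw 0 ↔ IsIntegral A x := by
  haveI : IsDedekindDomain (integralClosure A K) := integralClosure.isDedekindDomain A F K
  haveI : IsFractionRing (integralClosure A K) K := integralClosure.isFractionRing_of_finite_extension F K
  haveI : Module.Finite A (integralClosure A K) := IsIntegralClosure.finite A F K _
  obtain ⟨J, hJ⟩ := unit_of_fg (Submodule.span (integralClosure A K) (L : Set K)) (by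
    obtain ⟨s, hs⟩ := Module.Finite.iff_fg.1 Lfd
    refine ⟨s, ?_⟩
    apply le_antisymm
    · refine Submodule.span_mono ?_
      rw [← hs]; exact Submodule.subset_span
    · rw [Submodule.span_le, ← hs]
      exact Submodule.span_le_restrictScalars k _ _) (by
    intro h
    have h1 : (1 : K) ∈ Submodule.span (integralClosure A K) (L : Set K) := Submodule.subset_span oneL
    rw [h, Submodule.mem_bot] at h1
    exact one_ne_zero h1)
  refine ⟨{ D := integralClosure A K, J := J, hJ := hJ, fin := ?_ }, fun x => ?_⟩
  · intro f hf
    have h1 := Ideal.comap_ne_bot_of_integral_mem (R := A) (I := Ideal.span {f}) hf (Ideal.mem_span_singleton_self f)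
      (Algebra.IsIntegral.isIntegral f)
    obtain ⟨a, ha, ha0⟩ := Submodule.exists_mem_ne_zero_of_ne_bot h1
    have hle : Ideal.span {a} ≤ (Ideal.span {f}).comap (algebraMap A (integralClosure A K)) := by
      rw [Ideal.span_singleton_le_iff_mem]; exact ha
    haveI := hA a ha0
    letI := Ideal.Quotient.algebraQuotientOfLEComap hle
    haveI : IsScalarTower A (A ⧸ Ideal.span {a}) (integralClosure A K ⧸ Ideal.span {f}) :=
      IsScalarTower.of_algebraMap_eq fun _ => rfl
    haveI : Module.Finite (A ⧸ Ideal.span {a}) (integralClosure A K ⧸ Ideal.span {f}) :=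
      Module.Finite.of_restrictScalars_finite A _ _
    haveI : IsScalarTower k (A ⧸ Ideal.span {a}) (integralClosure A K ⧸ Ideal.span {f}) :=
      IsScalarTower.of_algebraMap_eq fun x => by
        rw [IsScalarTower.algebraMap_apply k A (A ⧸ Ideal.span {a}),
          ← IsScalarTower.algebraMap_apply A (A ⧸ Ideal.span {a}) (integralClosure A K ⧸ Ideal.span {f}),
          IsScalarTower.algebraMap_apply A (integralClosure A K) (integralClosure A K ⧸ Ideal.span {f}),
          ← IsScalarTower.algebraMap_apply k A (integralClosure A K),
          ← IsScalarTower.algebraMap_apply k (integralClosure A K) (integralClosure A K ⧸ Ideal.span {f})]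
    have h3 : Module.Finite k (integralClosure A K ⧸ Ideal.span {f}) := Module.Finite.trans (A ⧸ Ideal.span {a}) _
    apply ind_ne_top_of_quot
    exact Module.Finite.equiv (Submodule.Quotient.restrictScalarsEquiv k (Ideal.span {f})).symm
  · rw [Chart.pw_zero, mem_one_iff]
    constructor
    · rintro ⟨d, rfl⟩
      exact d.2
    · intro h
      exact ⟨⟨x, h⟩, rfl⟩

end MkChart
end FThr
end part14


section part15
set_option linter.all false
open scoped nonZeroDivisors

namespace FThr

section Ainf

variable (k : Type*) [Field k]

lemma intDegree_mul_le {k : Type*} [Field k] {x y : RatFunc k} {a b : ℤ} (hab : 0 ≤ a + b) (hx : x.intDegree ≤ a) (hy : y.intDegree ≤ b) :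
    (x * y).intDegree ≤ a + b := by
  by_cases h : x = 0
  · simp [h, hab]
  by_cases h' : y = 0
  · simp [h', hab]
  rw [RatFunc.intDegree_mul h h']
  omega

/-- functions regular at infinity -/
noncomputable def Ainf : Subalgebra k (RatFunc k) where
  carrier := {x | x.intDegree ≤ 0}
  mul_mem' := by
    intro x y hx hy
    exact intDegree_mul_le (a := 0) (b := 0) le_rfl hx hy
  add_mem' := by
    intro x y hx hy
    by_cases h : y = 0
    · rw [h, add_zero]; exact hx
    by_cases h' : x + y = 0
    · simp [h']
    exact (RatFunc.intDegree_add_le h h').trans (max_le hx hy)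
  algebraMap_mem' := by
    intro r
    change (algebraMap k (RatFunc k) r).intDegree ≤ 0
    rw [RatFunc.algebraMap_eq_C, RatFunc.intDegree_C]

variable {k}

lemma mem_Ainf {x : RatFunc k} : x ∈ Ainf k ↔ x.intDegree ≤ 0 := Iff.rfl

lemma intDegree_Xpow (n : ℕ) : ((RatFunc.X : RatFunc k) ^ n).intDegree = n := by
  induction n with
  | zero => simp
  | succ n ih =>
    rw [pow_succ, RatFunc.intDegree_mul (pow_ne_zero _ RatFunc.X_ne_zero) RatFunc.X_ne_zero, ih, RatFunc.intDegree_X]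
    push_cast; ring

lemma Ainf_isUnit {x : Ainf k} (h0 : (x : RatFunc k) ≠ 0) (h : (x : RatFunc k).intDegree = 0) : IsUnit x := by
  refine IsUnit.of_mul_eq_one ⟨(x : RatFunc k)⁻¹, ?_⟩ ?_
  · rw [mem_Ainf, RatFunc.intDegree_inv, h]; simp
  · apply Subtype.ext
    exact mul_inv_cancel₀ h0

lemma Ainf_degree_of_isUnit {x : Ainf k} (h : IsUnit x) : (x : RatFunc k).intDegree = 0 := by
  obtain ⟨y, hy⟩ := h.exists_right_inv
  have hy' : (x : RatFunc k) * (y : RatFunc k) = 1 := by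
    rw [← Subalgebra.coe_mul, hy, Subalgebra.coe_one]
  have hx0 : (x : RatFunc k) ≠ 0 := left_ne_zero_of_mul_eq_one hy'
  have hy0 : (y : RatFunc k) ≠ 0 := right_ne_zero_of_mul_eq_one hy'
  have h1 := RatFunc.intDegree_mul hx0 hy0
  rw [hy', RatFunc.intDegree_one] at h1
  have h2 := mem_Ainf.1 x.2
  have h3 := mem_Ainf.1 y.2
  omega

lemma Xinv_mem : (RatFunc.X : RatFunc k)⁻¹ ∈ Ainf k := by
  rw [mem_Ainf, RatFunc.intDegree_inv, RatFunc.intDegree_X]; norm_num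

instance Ainf_dvr : IsDiscreteValuationRing (Ainf k) := by
  apply IsDiscreteValuationRing.ofHasUnitMulPowIrreducibleFactorization
  refine ⟨⟨_, Xinv_mem⟩, ⟨?_, ?_⟩, ?_⟩
  · intro h
    have := Ainf_degree_of_isUnit h
    change ((RatFunc.X : RatFunc k)⁻¹).intDegree = 0 at this
    rw [RatFunc.intDegree_inv, RatFunc.intDegree_X] at this
    omega
  · intro a b hab
    have hab' : (a : RatFunc k) * (b : RatFunc k) = (RatFunc.X : RatFunc k)⁻¹ := by
      rw [← Subalgebra.coe_mul, ← hab]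
    have hX : (RatFunc.X : RatFunc k)⁻¹ ≠ 0 := inv_ne_zero RatFunc.X_ne_zero
    have ha0 : (a : RatFunc k) ≠ 0 := fun h => hX (by rw [← hab', h, zero_mul])
    have hb0 : (b : RatFunc k) ≠ 0 := fun h => hX (by rw [← hab', h, mul_zero])
    have h1 := RatFunc.intDegree_mul ha0 hb0
    rw [hab', RatFunc.intDegree_inv, RatFunc.intDegree_X] at h1
    have h2 := mem_Ainf.1 a.2
    have h3 := mem_Ainf.1 b.2
    rcases (by omega : (a : RatFunc k).intDegree = 0 ∨ (b : RatFunc k).intDegree = 0) with h | h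
    · exact Or.inl (Ainf_isUnit ha0 h)
    · exact Or.inr (Ainf_isUnit hb0 h)
  · intro x hx
    have hx0 : (x : RatFunc k) ≠ 0 := fun h => hx (Subtype.ext h)
    have h2 := mem_Ainf.1 x.2
    obtain ⟨n, hn⟩ := Int.eq_ofNat_of_zero_le (a := -(x : RatFunc k).intDegree) (by omega)
    have hdeg : ((x : RatFunc k) * RatFunc.X ^ n).intDegree = 0 := by
      rw [RatFunc.intDegree_mul hx0 (pow_ne_zero _ RatFunc.X_ne_zero), intDegree_Xpow]; omega
    have hu : IsUnit (⟨(x : RatFunc k) * RatFunc.X ^ n, mem_Ainf.2 hdeg.le⟩ : Ainf k) :=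
      Ainf_isUnit (mul_ne_zero hx0 (pow_ne_zero _ RatFunc.X_ne_zero)) hdeg
    refine ⟨n, hu.unit, ?_⟩
    apply Subtype.ext
    change ((RatFunc.X : RatFunc k)⁻¹) ^ n * ((x : RatFunc k) * RatFunc.X ^ n) = (x : RatFunc k)
    have hX : (RatFunc.X : RatFunc k) ≠ 0 := RatFunc.X_ne_zero
    rw [inv_pow]
    field_simp

instance Ainf_frac : IsFractionRing (Ainf k) (RatFunc k) := by
  apply IsFractionRing.of_field
  intro z
  by_cases h : z.intDegree ≤ 0
  · exact ⟨⟨z, h⟩, 1, by rw [map_one, div_one]; rfl⟩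
  · refine ⟨1, ⟨z⁻¹, ?_⟩, ?_⟩
    · rw [mem_Ainf, RatFunc.intDegree_inv]; omega
    · rw [map_one]
      change z = 1 / z⁻¹
      rw [one_div, inv_inv]

open Polynomial

/-- polynomial part -/
lemma poly_part (x : RatFunc k) : ∃ q : k[X], (q.natDegree : ℤ) ≤ max 0 x.intDegree ∧ x - algebraMap k[X] (RatFunc k) q ∈ Ainf k := by
  refine ⟨x.num / x.denom, ?_, ?_⟩
  · by_cases hlt : x.num.degree < x.denom.degree
    · rw [(Polynomial.div_eq_zero_iff x.denom_ne_zero).2 hlt, natDegree_zero]; simp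
    · push Not at hlt
      have h1 := degree_add_div x.denom_ne_zero hlt
      have h2 := congrArg (fun d => d.unbotD 0) h1
      by_cases hq : x.num / x.denom = 0
      · rw [hq, natDegree_zero]; simp
      have hn : x.num ≠ 0 := fun h => hq (by rw [h, EuclideanDomain.zero_div])
      rw [degree_eq_natDegree hn, degree_eq_natDegree hq, degree_eq_natDegree x.denom_ne_zero] at h1
      have h3 : x.denom.natDegree + (x.num / x.denom).natDegree = x.num.natDegree := by exact_mod_cast h1
      rw [RatFunc.intDegree]
      omega
  · have hd : algebraMap k[X] (RatFunc k) x.denom ≠ 0 := RatFunc.algebraMap_ne_zero x.denom_ne_zero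
    have h1 : x - algebraMap k[X] (RatFunc k) (x.num / x.denom) = algebraMap k[X] (RatFunc k) (x.num % x.denom) / algebraMap k[X] (RatFunc k) x.denom := by
      nth_rewrite 1 [← RatFunc.num_div_denom x]
      rw [EuclideanDomain.mod_eq_sub_mul_div, map_sub, map_mul]
      field_simp
    rw [h1, mem_Ainf]
    by_cases h0 : x.num % x.denom = 0
    · rw [h0, map_zero, zero_div, RatFunc.intDegree_zero]
    · rw [RatFunc.intDegree_div (RatFunc.algebraMap_ne_zero h0) hd, RatFunc.intDegree_polynomial, RatFunc.intDegree_polynomial]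
      have := natDegree_le_natDegree (degree_mod_lt x.num x.denom_ne_zero).le
      omega

lemma Ainf_fin (f : Ainf k) (hf : f ≠ 0) : Module.Finite k (Ainf k ⧸ Ideal.span {f}) := by
  have hf0 : (f : RatFunc k) ≠ 0 := fun h => hf (Subtype.ext h)
  have h2 := mem_Ainf.1 f.2
  obtain ⟨n, hn⟩ := Int.eq_ofNat_of_zero_le (a := -(f : RatFunc k).intDegree) (by omega)
  have hmem : ∀ q ∈ degreeLT k (n + 1), (RatFunc.X : RatFunc k)⁻¹ ^ n * algebraMap k[X] (RatFunc k) q ∈ Ainf k := by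
    intro q hq
    rw [mem_Ainf]
    by_cases h0 : q = 0
    · simp [h0]
    rw [RatFunc.intDegree_mul (pow_ne_zero _ (inv_ne_zero RatFunc.X_ne_zero)) (RatFunc.algebraMap_ne_zero h0), inv_pow,
      RatFunc.intDegree_inv, intDegree_Xpow, RatFunc.intDegree_polynomial]
    rw [mem_degreeLT, degree_eq_natDegree h0] at hq
    have : q.natDegree < n + 1 := by exact_mod_cast hq
    omega
  let Φ : degreeLT k (n + 1) →ₗ[k] Ainf k :=
    { toFun := fun q => ⟨_, hmem q q.2⟩
      map_add' := by
        intro x y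
        apply Subtype.ext
        simp [mul_add]
      map_smul' := by
        intro c x
        apply Subtype.ext
        change (RatFunc.X : RatFunc k)⁻¹ ^ n * algebraMap k[X] (RatFunc k) (c • (x : k[X])) = c • ((RatFunc.X : RatFunc k)⁻¹ ^ n * algebraMap k[X] (RatFunc k) x)
        rw [← mul_smul_comm]
        congr 1
        rw [Algebra.smul_def, Algebra.smul_def, map_mul, ← IsScalarTower.algebraMap_apply] }
  have hsurj : Function.Surjective ((Ideal.Quotient.mkₐ k (Ideal.span {f})).toLinearMap.comp Φ) := by
    intro y
    obtain ⟨x, rfl⟩ := Ideal.Quotient.mk_surjective y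
    obtain ⟨q, hq, hr⟩ := poly_part ((x : RatFunc k) * RatFunc.X ^ n)
    have hxd : ((x : RatFunc k) * RatFunc.X ^ n).intDegree ≤ 0 + (n : ℤ) :=
      intDegree_mul_le (by omega) x.2 (intDegree_Xpow n).le
    refine ⟨⟨q, ?_⟩, ?_⟩
    · rw [mem_degreeLT]
      refine lt_of_le_of_lt degree_le_natDegree ?_
      have : q.natDegree < n + 1 := by
        have := le_trans hq (max_le (by omega : (0 : ℤ) ≤ n) (by omega))
        omega
      exact_mod_cast this
    · have hy : (f : RatFunc k)⁻¹ * (RatFunc.X : RatFunc k)⁻¹ ^ n * ((x : RatFunc k) * RatFunc.X ^ n - algebraMap k[X] (RatFunc k) q) ∈ Ainf k := by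
        refine mul_mem ?_ hr
        rw [mem_Ainf, RatFunc.intDegree_mul (inv_ne_zero hf0) (pow_ne_zero _ (inv_ne_zero RatFunc.X_ne_zero)), inv_pow, RatFunc.intDegree_inv,
          RatFunc.intDegree_inv, intDegree_Xpow]
        omega
      change Ideal.Quotient.mk (Ideal.span {f}) (Φ ⟨q, _⟩) = Ideal.Quotient.mk (Ideal.span {f}) x
      symm
      rw [Ideal.Quotient.eq, Ideal.mem_span_singleton]
      refine ⟨⟨_, hy⟩, ?_⟩
      apply Subtype.ext
      change (x : RatFunc k) - (RatFunc.X : RatFunc k)⁻¹ ^ n * algebraMap k[X] (RatFunc k) q = (f : RatFunc k) * ((f : RatFunc k)⁻¹ * (RatFunc.X : RatFunc k)⁻¹ ^ n * ((x : RatFunc k) * RatFunc.X ^ n - algebraMap k[X] (RatFunc k) q))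
      have hX : (RatFunc.X : RatFunc k) ≠ 0 := RatFunc.X_ne_zero
      rw [inv_pow]
      field_simp
  exact Module.Finite.of_surjective _ hsurj

lemma poly_fin (f : k[X]) (hf : f ≠ 0) : Module.Finite k (k[X] ⧸ Ideal.span {f}) :=
  (AdjoinRoot.powerBasis hf).finite

end Ainf
end FThr
end part15


section part16
set_option linter.all false
open scoped nonZeroDivisors

namespace FThr

universe u
open Polynomial

lemma Chart.Lpow_mul_mem {k : Type*} {K : Type u} [Field k] [Field K] [Algebra k K] {L : Submodule k K} (A : Chart k K L)
    {e : ℕ} {b s : K} (hb : b ∈ L ^ e) (hs : s ∈ A.pw 0) : b * s ∈ A.pw (e : ℤ) := by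
  have := A.mul_mem (A.Lpow_le hb) hs
  rwa [add_zero] at this

theorem mkSetup {k : Type*} {K : Type u} [Field k] [Field K] [Algebra k K] [Algebra k[X] K] [Algebra (RatFunc k) K]
    [IsScalarTower k k[X] K] [IsScalarTower k[X] (RatFunc k) K] [IsScalarTower k (RatFunc k) K]
    [FiniteDimensional (RatFunc k) K] [Algebra.IsSeparable (RatFunc k) K]
    (L : Submodule k K) (oneL : (1 : K) ∈ L) (Lfd : Module.Finite k L)
    (frac : ∀ x : K, ∃ (e : ℕ) (b : K), b ∈ L ^ e ∧ b ≠ 0 ∧ b * x ∈ L ^ e) : Nonempty (Setup k K L) := by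
  classical
  obtain ⟨A, hA⟩ := mkChart (F := RatFunc k) poly_fin L oneL Lfd
  obtain ⟨B, hB⟩ := mkChart (F := RatFunc k) Ainf_fin L oneL Lfd
  set z : K := algebraMap (RatFunc k) K RatFunc.X with hz
  have hz0 : z ≠ 0 := by
    rw [hz, Ne, map_eq_zero]; exact RatFunc.X_ne_zero
  obtain ⟨s, b, hb⟩ := FiniteDimensional.exists_is_basis_integral k[X] (RatFunc k) K
  obtain ⟨y, hy0, hy⟩ := exists_integral_multiples (Ainf k) (RatFunc k) (Finset.univ.image b)
  have hy0' : (y : RatFunc k) ≠ 0 := fun h => hy0 (Subtype.ext h)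
  have hyd := mem_Ainf.1 y.2
  obtain ⟨c, hc⟩ := Int.eq_ofNat_of_zero_le (a := -(y : RatFunc k).intDegree) (by omega)
  -- `b i * y` is integral at infinity
  have hby : ∀ i, IsIntegral (Ainf k) (algebraMap (RatFunc k) K (y : RatFunc k) * b i) := by
    intro i
    have := hy (b i) (Finset.mem_image_of_mem _ (Finset.mem_univ i))
    rwa [Algebra.smul_def] at this
  have hbz : ∀ i, ∃ t, IsIntegral (Ainf k) t ∧ b i = z ^ c * t := by
    intro i
    have hu : (RatFunc.X : RatFunc k)⁻¹ ^ c * (y : RatFunc k)⁻¹ ∈ Ainf k := by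
      rw [mem_Ainf, RatFunc.intDegree_mul (pow_ne_zero _ (inv_ne_zero RatFunc.X_ne_zero)) (inv_ne_zero hy0'), inv_pow,
        RatFunc.intDegree_inv, RatFunc.intDegree_inv, intDegree_Xpow]
      omega
    refine ⟨algebraMap (Ainf k) K ⟨_, hu⟩ * (algebraMap (RatFunc k) K (y : RatFunc k) * b i), isIntegral_algebraMap.mul (hby i), ?_⟩
    change b i = z ^ c * (algebraMap (RatFunc k) K ((RatFunc.X : RatFunc k)⁻¹ ^ c * (y : RatFunc k)⁻¹) * (algebraMap (RatFunc k) K (y : RatFunc k) * b i))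
    have hyK : algebraMap (RatFunc k) K (y : RatFunc k) ≠ 0 := by rwa [Ne, map_eq_zero]
    rw [map_mul, map_pow, map_inv₀, map_inv₀, ← hz, inv_pow]
    field_simp
  have hST : ∀ x : K, ∃ s t, IsIntegral k[X] s ∧ IsIntegral (Ainf k) t ∧ x = s + z ^ c * t := by
    intro x
    choose q hq1 hq2 using fun i => poly_part (b.repr x i)
    choose t ht1 ht2 using hbz
    refine ⟨∑ i, algebraMap k[X] K (q i) * b i, ∑ i, algebraMap (Ainf k) K ⟨_, hq2 i⟩ * t i, ?_, ?_, ?_⟩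
    · exact IsIntegral.sum _ fun i _ => isIntegral_algebraMap.mul (hb i)
    · exact IsIntegral.sum _ fun i _ => isIntegral_algebraMap.mul (ht1 i)
    · rw [Finset.mul_sum, ← Finset.sum_add_distrib]
      nth_rewrite 1 [← b.sum_repr x]
      refine Finset.sum_congr rfl fun i _ => ?_
      change b.repr x i • b i = algebraMap k[X] K (q i) * b i + z ^ c * (algebraMap (RatFunc k) K (b.repr x i - algebraMap k[X] (RatFunc k) (q i)) * t i)
      rw [map_sub, ← IsScalarTower.algebraMap_apply k[X] (RatFunc k) K, Algebra.smul_def, mul_left_comm, ← ht2 i]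
      ring
  obtain ⟨e, v, hv1, hv0, hv2⟩ := frac (z ^ c)
  refine ⟨{ A := A, B := B, oneL := oneL, Lfd := Lfd, frac := frac, C := e, K2 := ?_, h0 := ?_, z := z, hz := ?_ }⟩
  · intro x
    obtain ⟨s, t, hs, ht, hx⟩ := hST (x / v)
    refine ⟨v * s, A.Lpow_mul_mem hv1 ((hA s).2 hs), (v * z ^ c) * t, B.Lpow_mul_mem hv2 ((hB t).2 ht), ?_⟩
    rw [mul_assoc, ← mul_add, ← hx]
    field_simp
  · -- trace argument
    let W : Submodule k (RatFunc k) := (degreeLT k (c + 1)).map (IsScalarTower.toAlgHom k k[X] (RatFunc k)).toLinearMap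
    haveI : Module.Finite k W := inferInstance
    let Φ : K →ₗ[k] (s → RatFunc k) := LinearMap.pi fun i => 
      ((Algebra.trace (RatFunc k) K).restrictScalars k).comp (LinearMap.mulRight k (b i))
    have hΦ : Function.Injective Φ := by
      rw [injective_iff_map_eq_zero]
      intro x hx
      refine (traceForm_nondegenerate (RatFunc k) K).1 x fun y => ?_
      have h1 : ∀ i, Algebra.trace (RatFunc k) K (x * b i) = 0 := fun i => congrFun hx i
      have h2 : Algebra.traceForm (RatFunc k) K x = 0 := b.ext fun i => by
        rw [Algebra.traceForm_apply, h1]; rfl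
      rw [h2]; rfl
    have hle : A.pwk 0 ⊓ B.pwk 0 ≤ (Submodule.pi Set.univ fun _ : s => W).comap Φ := by
      rintro x ⟨hxA, hxB⟩
      have hxA' : IsIntegral k[X] x := (hA x).1 hxA
      have hxB' : IsIntegral (Ainf k) x := (hB x).1 hxB
      intro i _
      have h1 : IsIntegral k[X] (Algebra.trace (RatFunc k) K (x * b i)) := Algebra.isIntegral_trace (hxA'.mul (hb i))
      have h2 : IsIntegral (Ainf k) (Algebra.trace (RatFunc k) K (x * (algebraMap (RatFunc k) K (y : RatFunc k) * b i))) :=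
        Algebra.isIntegral_trace (hxB'.mul (hby i))
      obtain ⟨f, hf⟩ := IsIntegrallyClosed.isIntegral_iff.1 h1
      obtain ⟨g, hg⟩ := IsIntegrallyClosed.isIntegral_iff.1 h2
      have h3 : Algebra.trace (RatFunc k) K (x * (algebraMap (RatFunc k) K (y : RatFunc k) * b i)) = y * Algebra.trace (RatFunc k) K (x * b i) := by
        rw [mul_left_comm, ← Algebra.smul_def, map_smul, smul_eq_mul]
      rw [h3, ← hf] at hg
      refine ⟨f, ?_, hf⟩
      rw [SetLike.mem_coe, mem_degreeLT]
      by_cases hf0 : f = 0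
      · rw [hf0, degree_zero]; exact WithBot.bot_lt_coe _
      have h4 : ((y : RatFunc k) * algebraMap k[X] (RatFunc k) f).intDegree ≤ 0 := by rw [← hg]; exact g.2
      rw [RatFunc.intDegree_mul hy0' (RatFunc.algebraMap_ne_zero hf0), RatFunc.intDegree_polynomial] at h4
      rw [degree_eq_natDegree hf0]
      have : f.natDegree < c + 1 := by omega
      exact_mod_cast this
    haveI : Module.Finite k (Submodule.pi Set.univ fun _ : s => W) := by
      have h5 : Submodule.pi Set.univ (fun _ : s => W) = LinearMap.range (LinearMap.pi fun i => W.subtype.comp (LinearMap.proj i) : (s → W) →ₗ[k] (s → RatFunc k)) := by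
        ext w
        constructor
        · intro hw
          exact ⟨fun i => ⟨w i, hw i trivial⟩, rfl⟩
        · rintro ⟨w', rfl⟩ i _
          exact (w' i).2
      rw [h5]
      infer_instance
    haveI : Module.Finite k ((Submodule.pi Set.univ fun _ : s => W).comap Φ) := by
      refine Module.Finite.of_injective (Φ.restrict (p := (Submodule.pi Set.univ fun _ : s => W).comap Φ) (q := Submodule.pi Set.univ fun _ : s => W) fun x hx => hx) ?_
      intro x y hxy
      exact Subtype.ext (hΦ (congrArg Subtype.val hxy))
    haveI : Module.Finite k (A.pwk 0 ⊓ B.pwk 0 : Submodule k K) := Submodule.finiteDimensional_of_le hle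
    exact ind_ne_top_of_finite
  · rw [hB]
    intro h
    rw [hz, isIntegral_algebraMap_iff (algebraMap (RatFunc k) K).injective, IsIntegrallyClosed.isIntegral_iff] at h
    obtain ⟨g, hg⟩ := h
    have h1 := mem_Ainf.1 g.2
    have h2 : (g : RatFunc k) = RatFunc.X := hg
    rw [h2, RatFunc.intDegree_X] at h1
    omega

end FThr
end part16


section part17
set_option linter.all false
open scoped nonZeroDivisors

namespace FThr

universe u
open Polynomial

lemma essFin {k : Type*} {K : Type u} [Field k] [Field K] [Algebra k K]
    (L : Submodule k K) (Lfd : Module.Finite k L)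
    (frac : ∀ x : K, ∃ (e : ℕ) (b : K), b ∈ L ^ e ∧ b ≠ 0 ∧ b * x ∈ L ^ e) : Algebra.EssFiniteType k K := by
  rw [← IntermediateField.fg_top_iff]
  obtain ⟨t, ht⟩ := (Module.Finite.iff_fg.1 Lfd)
  refine ⟨t, ?_⟩
  rw [eq_top_iff]
  intro x _
  set S := IntermediateField.adjoin k (t : Set K) with hS
  have hL : L ≤ Subalgebra.toSubmodule S.toSubalgebra := by
    rw [← ht, Submodule.span_le]
    intro y hy
    exact IntermediateField.subset_adjoin k _ hy
  have hLe : ∀ e, ∀ y ∈ L ^ e, y ∈ S := by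
    intro e
    induction e with
    | zero =>
      intro y hy
      rw [pow_zero, Submodule.mem_one] at hy
      obtain ⟨a, rfl⟩ := hy
      exact S.algebraMap_mem a
    | succ e ih =>
      intro y hy
      rw [pow_succ] at hy
      refine Submodule.mul_induction_on hy (fun a ha b hb => S.mul_mem (ih a ha) (hL hb)) (fun a b ha hb => S.add_mem ha hb)
  obtain ⟨e, b, hb, hb0, hbx⟩ := frac x
  have : x = (b * x) / b := by field_simp
  rw [this]
  exact S.div_mem (hLe e _ hbx) (hLe e _ hb)

theorem mkSetup' {k : Type*} {K : Type u} [Field k] [PerfectField k] [Field K] [Algebra k K]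
    (htr : Algebra.trdeg k K = 1)
    (L : Submodule k K) (oneL : (1 : K) ∈ L) (Lfd : Module.Finite k L)
    (frac : ∀ x : K, ∃ (e : ℕ) (b : K), b ∈ L ^ e ∧ b ≠ 0 ∧ b * x ∈ L ^ e) : Nonempty (Setup k K L) := by
  classical
  have hE := essFin L Lfd frac
  obtain ⟨s, hs, hsep⟩ := exists_isTranscendenceBasis_and_isSeparable_of_perfectField k K
  have hcard : s.card = 1 := by
    have := hs.lift_cardinalMk_eq_trdeg
    rw [htr] at this
    simpa using this
  obtain ⟨z, rfl⟩ := Finset.card_eq_one.1 hcard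
  have hz : Transcendental k z := by
    have := hs.1.transcendental ⟨z, by simp⟩
    exact this
  rw [Finset.coe_singleton] at hsep
  let e := RatFunc.algEquivOfTranscendental z hz
  let f : RatFunc k →ₐ[k] K := (IntermediateField.val _).comp e.toAlgHom
  letI : Algebra (RatFunc k) K := f.toRingHom.toAlgebra
  letI : Algebra k[X] K := (f.toRingHom.comp (algebraMap k[X] (RatFunc k))).toAlgebra
  haveI h1 : IsScalarTower k[X] (RatFunc k) K := IsScalarTower.of_algebraMap_eq (fun x => rfl)
  haveI h2 : IsScalarTower k (RatFunc k) K := IsScalarTower.of_algebraMap_eq (fun x => (f.commutes x).symm)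
  haveI h3 : IsScalarTower k k[X] K := IsScalarTower.of_algebraMap_eq (fun x => by
    change _ = f (algebraMap k[X] (RatFunc k) (algebraMap k k[X] x))
    rw [← IsScalarTower.algebraMap_apply k k[X] (RatFunc k)]
    exact (f.commutes x).symm)
  haveI h4 : Algebra.IsSeparable (RatFunc k) K :=
    Algebra.IsSeparable.of_equiv_equiv e.symm.toRingEquiv (RingEquiv.refl K) (by
      ext x
      change f (e.symm x) = x
      change ((e (e.symm x) : _) : K) = x
      rw [AlgEquiv.apply_symm_apply])
  haveI h5 : Algebra.EssFiniteType (RatFunc k) K := Algebra.EssFiniteType.of_comp k (RatFunc k) K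
  haveI h6 : FiniteDimensional (RatFunc k) K := Algebra.finite_of_essFiniteType_of_isAlgebraic
  exact mkSetup L oneL Lfd frac
end FThr
end part17


section part18
set_option linter.all false
open scoped nonZeroDivisors

namespace FThr

lemma ringKrullDim_eq_of_int {A B : Type*} [CommRing A] [CommRing B] [IsDomain A] [IsDomain B] [Algebra A B]
    [Algebra.IsIntegral A B] (hinj : Function.Injective (algebraMap A B)) :
    ringKrullDim A = ringKrullDim B := by
  apply le_antisymm
  · refine iSup_le fun l => ?_
    obtain ⟨Q, -, hQ, hQq⟩ := Ideal.exists_ideal_over_prime_of_isIntegral_of_isPrime (S := B) l.head.asIdeal ⊥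
      (by
        have : Ideal.comap (algebraMap A B) ⊥ = ⊥ := by
          rw [← RingHom.ker_eq_comap_bot]; exact (RingHom.injective_iff_ker_eq_bot _).1 hinj
        rw [this]; exact bot_le)
    haveI : Q.LiesOver l.head.asIdeal := ⟨hQq.symm⟩
    obtain ⟨l', hl', -⟩ := Ideal.exists_ltSeries_of_hasGoingUp l Q
    rw [← hl']
    exact Order.LTSeries.length_le_krullDim l'
  · refine Order.krullDim_le_of_strictMono (fun P => PrimeSpectrum.comap (algebraMap A B) P) ?_
    intro P Q hPQ
    exact Ideal.IsIntegral.comap_lt_comap (show P.asIdeal < Q.asIdeal from hPQ)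

lemma trdeg_of_dim {k : Type*} {R : Type*} [Field k] [CommRing R] [IsDomain R] [Algebra k R]
    [Algebra.FiniteType k R] (n : ℕ) (h : ringKrullDim R = n) : Algebra.trdeg k R = n := by
  obtain ⟨s, g, hg, hfin⟩ := exists_finite_inj_algHom_of_fg k R
  letI : Algebra (MvPolynomial (Fin s) k) R := g.toRingHom.toAlgebra
  haveI : IsScalarTower k (MvPolynomial (Fin s) k) R := IsScalarTower.of_algebraMap_eq (fun x => (g.commutes x).symm)
  haveI : Module.Finite (MvPolynomial (Fin s) k) R := hfin
  haveI : Algebra.IsIntegral (MvPolynomial (Fin s) k) R := Algebra.IsIntegral.of_finite _ _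
  have hi : Function.Injective (algebraMap (MvPolynomial (Fin s) k) R) := hg
  haveI : FaithfulSMul (MvPolynomial (Fin s) k) R := (faithfulSMul_iff_algebraMap_injective _ _).2 hi
  have h1 := ringKrullDim_eq_of_int hi
  rw [MvPolynomial.ringKrullDim_of_isNoetherianRing, h, ringKrullDim_eq_zero_of_field, zero_add, Nat.card_eq_fintype_card,
    Fintype.card_fin] at h1
  have hs : s = n := by exact_mod_cast h1
  subst hs
  have := lift_trdeg_add_eq k (MvPolynomial (Fin s) k) R
  rw [_root_.trdeg_eq_zero (R := MvPolynomial (Fin s) k), MvPolynomial.trdeg_of_isDomain] at this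
  simp at this
  first | exact this.symm | (rw [eq_comm]; exact_mod_cast this)

lemma trdeg_sub {k Q : Type*} [Field k] [Field Q] [Algebra k Q] (K : IntermediateField k Q) (t : Q)
    (ht : Transcendental K t)
    (hgen : ∀ x : Q, ∃ a b, a ∈ Algebra.adjoin K {t} ∧ b ∈ Algebra.adjoin K {t} ∧ x = a / b)
    (htr : Algebra.trdeg k Q = 2) : Algebra.trdeg k K = 1 := by
  haveI : IsFractionRing (Algebra.adjoin K {t}) Q := by
    refine IsFractionRing.of_field _ _ (fun x => ?_)
    obtain ⟨a, b, ha, hb, rfl⟩ := hgen x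
    exact ⟨⟨a, ha⟩, ⟨b, hb⟩, rfl⟩
  haveI : Algebra.IsAlgebraic (Algebra.adjoin K {t}) Q := IsLocalization.isAlgebraic _ (Algebra.adjoin K {t})⁰
  have h1 : Algebra.trdeg K Q ≤ 1 := by
    have := Algebra.IsAlgebraic.trdeg_le_cardinalMk K ({t} : Set Q)
    simpa using this
  have h2 : 1 ≤ Algebra.trdeg K Q := by
    haveI : Algebra.Transcendental K Q := ⟨t, ht⟩
    exact Cardinal.one_le_iff_pos.2 (trdeg_pos K Q)
  have h3 := trdeg_add_eq k K (A := Q)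
  rw [le_antisymm h1 h2, htr] at h3
  have h4 : Algebra.trdeg k K + 1 = (1 : Cardinal) + 1 := by rw [h3]; norm_num
  exact Cardinal.add_one_inj.1 h4

lemma trdeg_frac {k R : Type*} [Field k] [CommRing R] [IsDomain R] [Algebra k R]
    [Algebra.FiniteType k R] (h : ringKrullDim R = 2) : Algebra.trdeg k (FractionRing R) = 2 := by
  have h1 := trdeg_of_dim (k := k) (R := R) 2 h
  haveI : Algebra.IsAlgebraic R (FractionRing R) := IsLocalization.isAlgebraic _ R⁰
  have h3 := trdeg_add_eq k R (A := FractionRing R)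
  rw [trdeg_eq_zero (R := R), h1, add_zero] at h3
  rw [← h3]; norm_num

end FThr
end part18


section part19
set_option linter.all false
open scoped nonZeroDivisors

namespace FThr

section graded
variable {k R : Type*} [Field k] [CommRing R] [Algebra k R]
    (𝒜 : ℕ → Submodule k R) [GradedAlgebra 𝒜]

lemma gr_mem_adjoin (h0 : 𝒜 0 = Submodule.span k {1}) (hstd : ∀ n, 𝒜 (n + 1) = 𝒜 1 * 𝒜 n) (n : ℕ) :
    𝒜 n ≤ Subalgebra.toSubmodule (Algebra.adjoin k (𝒜 1 : Set R)) := by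
  induction n with
  | zero =>
    rw [h0, Submodule.span_le]
    intro x hx
    rw [Set.mem_singleton_iff.1 hx]
    exact one_mem (Algebra.adjoin k (𝒜 1 : Set R))
  | succ n ih =>
    rw [hstd, Submodule.mul_le]
    intro a ha b hb
    exact Subalgebra.mul_mem _ (Algebra.subset_adjoin ha) (ih hb)

lemma gr_adjoin (h0 : 𝒜 0 = Submodule.span k {1}) (hstd : ∀ n, 𝒜 (n + 1) = 𝒜 1 * 𝒜 n) :
    Algebra.adjoin k (𝒜 1 : Set R) = ⊤ := by
  rw [eq_top_iff]
  intro x _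
  refine DirectSum.Decomposition.inductionOn 𝒜 (zero_mem _) (fun {i} m => gr_mem_adjoin 𝒜 h0 hstd i m.2)
    (fun a b ha hb => add_mem ha hb) x

lemma gr_finiteType (h0 : 𝒜 0 = Submodule.span k {1}) (hstd : ∀ n, 𝒜 (n + 1) = 𝒜 1 * 𝒜 n)
    (hfg : FiniteDimensional k (𝒜 1)) : Algebra.FiniteType k R := by
  obtain ⟨t, ht⟩ := (Module.Finite.iff_fg.1 hfg)
  refine ⟨⟨t, ?_⟩⟩
  rw [← gr_adjoin 𝒜 h0 hstd, ← ht, Algebra.adjoin_span]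

lemma gr_pow_le (hstd : ∀ n, 𝒜 (n + 1) = 𝒜 1 * 𝒜 n) (m : ℕ) {a : R} (ha : a ∈ 𝒜 m) :
    a ∈ irrelevantIdeal 𝒜 ^ m := by
  induction m generalizing a with
  | zero => simp
  | succ m ih =>
    rw [hstd] at ha
    rw [pow_succ']
    refine Submodule.mul_induction_on ha (fun x hx y hy => Ideal.mul_mem_mul ?_ (ih hy)) (fun x y hx hy => add_mem hx hy)
    refine Ideal.subset_span ?_
    simp only [Set.mem_iUnion]
    exact ⟨1, by simp, hx⟩

lemma irr_eq (hstd : ∀ n, 𝒜 (n + 1) = 𝒜 1 * 𝒜 n) : irrelevantIdeal 𝒜 = Ideal.span (𝒜 1 : Set R) := by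
  apply le_antisymm
  · rw [irrelevantIdeal, Ideal.span_le]
    intro x hx
    simp only [Set.mem_iUnion] at hx
    obtain ⟨n, hn, hx⟩ := hx
    obtain ⟨n, rfl⟩ := Nat.exists_eq_succ_of_ne_zero (Nat.pos_iff_ne_zero.1 hn)
    change x ∈ 𝒜 (n + 1) at hx
    rw [hstd] at hx
    exact Submodule.mul_induction_on hx (fun x hx y hy => Ideal.mul_mem_right _ _ (Ideal.subset_span hx)) (fun x y hx hy => add_mem hx hy)
  · apply Ideal.span_mono
    intro x hx
    simp only [Set.mem_iUnion]
    exact ⟨1, by simp, hx⟩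

lemma irr_pow_le_iff (hstd : ∀ n, 𝒜 (n + 1) = 𝒜 1 * 𝒜 n) (J : Ideal R) (m : ℕ) :
    irrelevantIdeal 𝒜 ^ m ≤ J ↔ ∀ a ∈ 𝒜 m, a ∈ J := by
  constructor
  · intro h a ha
    exact h (gr_pow_le 𝒜 hstd m ha)
  · intro h
    have : ∀ n, irrelevantIdeal 𝒜 ^ n ≤ Ideal.span (𝒜 n : Set R) := by
      intro n
      induction n with
      | zero => 
        rw [pow_zero, Ideal.one_eq_top, top_le_iff, Ideal.eq_top_iff_one]
        exact Ideal.subset_span SetLike.GradedOne.one_mem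
      | succ n ih =>
        rw [pow_succ']
        refine (Ideal.mul_mono (irr_eq 𝒜 hstd).le ih).trans ?_
        rw [Ideal.span_mul_span', Ideal.span_le]
        rintro _ ⟨a, ha, b, hb, rfl⟩
        refine Ideal.subset_span ?_
        change a * b ∈ 𝒜 (n + 1)
        rw [hstd]
        exact Submodule.mul_mem_mul ha hb
    refine (this m).trans ?_
    rw [Ideal.span_le]
    exact h

lemma frob_gen {p : ℕ} (hp : p.Prime) [CharP R p] {ι : Type*} [Fintype ι] (f : ι → R) (n : ℕ) :
    (Ideal.span (Set.range f)).frobPow (p ^ n) = Ideal.span (Set.range fun i => f i ^ (p ^ n)) := by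
  haveI := Fact.mk hp
  apply le_antisymm
  · rw [Ideal.frobPow, Ideal.span_le]
    rintro _ ⟨x, hx, rfl⟩
    obtain ⟨c, rfl⟩ := Ideal.mem_span_range_iff_exists_fun.1 hx
    simp only [sum_pow_char_pow, mul_pow]
    exact Ideal.sum_mem _ fun i _ => Ideal.mul_mem_left _ _ (Ideal.subset_span ⟨i, rfl⟩)
  · rw [Ideal.span_le]
    rintro _ ⟨i, rfl⟩
    exact Ideal.subset_span ⟨f i, Ideal.subset_span ⟨i, rfl⟩, rfl⟩

lemma hom_gens [IsNoetherianRing R] (I : Ideal R) (hI : I.IsHomogeneous 𝒜) :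
    ∃ (N : ℕ) (f : Fin N → R) (d : Fin N → ℕ), (∀ i, f i ∈ 𝒜 (d i)) ∧ I = Ideal.span (Set.range f) := by
  obtain ⟨S, hS⟩ := (Ideal.IsHomogeneous.iff_exists 𝒜 I).1 hI
  have hfg : (Submodule.span R ((↑) '' S : Set R)).FG := IsNoetherian.noetherian _
  obtain ⟨s, hs, hs'⟩ := (Submodule.fg_span_iff_fg_span_finset_subset _).1 hfg
  have : ∀ i : Fin s.card, ∃ d, (s.equivFin.symm i : R) ∈ 𝒜 d := by
    intro i
    obtain ⟨x, hx, hx'⟩ := hs (s.equivFin.symm i).2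
    obtain ⟨d, hd⟩ := x.2
    exact ⟨d, by rw [← hx']; exact hd⟩
  choose d hd using this
  refine ⟨s.card, fun i => s.equivFin.symm i, d, hd, ?_⟩
  rw [hS]
  change Submodule.span R _ = Submodule.span R _
  rw [hs']
  congr 1
  ext x
  constructor
  · intro hx
    exact ⟨s.equivFin ⟨x, hx⟩, by simp⟩
  · rintro ⟨i, rfl⟩
    exact (s.equivFin.symm i).2

lemma gr_eventually (I : Ideal R) (hI : I.IsHomogeneous 𝒜) (hc : FiniteDimensional k (R ⧸ I)) :
    ∃ m, ∀ a ∈ 𝒜 m, a ∈ I := by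
  by_contra hcon
  push Not at hcon
  choose x hx hxI using hcon
  have hli : LinearIndependent k (fun m : ℕ => Ideal.Quotient.mkₐ k I (x m)) := by
    rw [linearIndependent_iff']
    intro s g hg i hi
    have hy : (∑ j ∈ s, g j • x j) ∈ I := by
      rw [← Ideal.Quotient.eq_zero_iff_mem]
      have h2 : Ideal.Quotient.mkₐ k I (∑ j ∈ s, g j • x j) = 0 := by
        rw [map_sum, ← hg]
        exact Finset.sum_congr rfl fun j _ => map_smul _ _ _
      exact h2
    have h3 : (DirectSum.decompose 𝒜 (∑ j ∈ s, g j • x j) i : R) ∈ I := hI i hy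
    have h4 : (DirectSum.decompose 𝒜 (∑ j ∈ s, g j • x j) i : R) = g i • x i := by
      rw [← GradedRing.proj_apply, map_sum, Finset.sum_eq_single i]
      · rw [GradedRing.proj_apply, DirectSum.decompose_of_mem_same _ (Submodule.smul_mem _ _ (hx i))]
      · intro j _ hj
        rw [GradedRing.proj_apply, DirectSum.decompose_of_mem_ne _ (Submodule.smul_mem _ _ (hx j)) hj]
      · exact fun h => absurd hi h
    rw [h4] at h3
    by_contra hgi
    apply hxI i
    have h5 : x i = algebraMap k R (g i)⁻¹ * (g i • x i) := by
      rw [← Algebra.smul_def, smul_smul, inv_mul_cancel₀ hgi, one_smul]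
    rw [h5]
    exact Ideal.mul_mem_left _ _ h3
  exact (Set.infinite_univ (α := ℕ)) (by have := hli.finite; exact Set.finite_univ)

lemma gr_comp {ι : Type*} [Fintype ι] (g : ι → R) (e : ι → ℕ) (hg : ∀ i, g i ∈ 𝒜 (e i)) {m : ℕ} {a : R} (ha : a ∈ 𝒜 m)
    (h : a ∈ Ideal.span (Set.range g)) :
    ∃ c : ι → R, (∀ i, e i ≤ m → c i ∈ 𝒜 (m - e i)) ∧ (∀ i, ¬ e i ≤ m → c i = 0) ∧ a = ∑ i, c i * g i := by
  classical
  obtain ⟨c, hc⟩ := Ideal.mem_span_range_iff_exists_fun.1 h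
  refine ⟨fun i => if e i ≤ m then (DirectSum.decompose 𝒜 (c i) (m - e i) : R) else 0, ?_, ?_, ?_⟩
  · intro i hi
    simp only [if_pos hi]
    exact SetLike.coe_mem _
  · intro i hi
    simp only [if_neg hi]
  · have : a = GradedRing.proj 𝒜 m a := by
      rw [GradedRing.proj_apply, DirectSum.decompose_of_mem_same _ ha]
    rw [this, ← hc, map_sum]
    refine Finset.sum_congr rfl fun i _ => ?_
    rw [GradedRing.proj_apply, DirectSum.coe_decompose_mul_of_right_mem 𝒜 m (hg i)]
    by_cases hi : e i ≤ m
    · simp only [if_pos hi]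
    · simp only [if_neg hi, zero_mul]

end graded
end FThr
end part19


section part20
set_option linter.all false
open scoped nonZeroDivisors

namespace FThr

section dehom
variable {k R Q : Type*} [Field k] [CommRing R] [IsDomain R] [Algebra k R]
    [Field Q] [Algebra R Q] [IsFractionRing R Q] [Algebra k Q] [IsScalarTower k R Q]
    (𝒜 : ℕ → Submodule k R) [GradedAlgebra 𝒜]

lemma ams {k R Q : Type*} [Field k] [CommRing R] [Algebra k R] [Field Q] [Algebra R Q] [Algebra k Q] [IsScalarTower k R Q]
    (c : k) (a : R) : algebraMap R Q (c • a) = c • algebraMap R Q a :=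
  map_smul (IsScalarTower.toAlgHom k R Q) c a

/-- degree `m` elements divided by `t ^ m` -/
def dh (Q : Type*) [Field Q] [Algebra R Q] [Algebra k Q] [IsScalarTower k R Q] (t : R) (m : ℕ) : Submodule k Q where
  carrier := {x | ∃ a ∈ 𝒜 m, x = algebraMap R Q a / algebraMap R Q t ^ m}
  zero_mem' := ⟨0, zero_mem _, by simp⟩
  add_mem' := by
    rintro _ _ ⟨a, ha, rfl⟩ ⟨b, hb, rfl⟩
    exact ⟨a + b, add_mem ha hb, by rw [map_add, add_div]⟩
  smul_mem' := by
    rintro c _ ⟨a, ha, rfl⟩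
    exact ⟨c • a, Submodule.smul_mem _ _ ha, by rw [ams, smul_div_assoc]⟩

lemma mem_dh {t : R} {m : ℕ} {x : Q} : x ∈ dh 𝒜 Q t m ↔ ∃ a ∈ 𝒜 m, x = algebraMap R Q a / algebraMap R Q t ^ m := Iff.rfl

lemma dh_pow (h0 : 𝒜 0 = Submodule.span k {1}) (hstd : ∀ n, 𝒜 (n + 1) = 𝒜 1 * 𝒜 n) {t : R} (ht0 : t ≠ 0) (m : ℕ) :
    dh 𝒜 Q t m = dh 𝒜 Q t 1 ^ m := by
  have hτ : algebraMap R Q t ≠ 0 := by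
    rwa [Ne, map_eq_zero_iff _ (IsFractionRing.injective R Q)]
  induction m with
  | zero =>
    ext x
    rw [pow_zero, Submodule.mem_one, mem_dh]
    constructor
    · rintro ⟨a, ha, rfl⟩
      rw [h0, Submodule.mem_span_singleton] at ha
      obtain ⟨c, rfl⟩ := ha
      exact ⟨c, by rw [ams, map_one, pow_zero, div_one, Algebra.smul_def, mul_one]⟩
    · rintro ⟨c, rfl⟩
      refine ⟨c • 1, ?_, ?_⟩
      · rw [h0]; exact Submodule.smul_mem _ _ (Submodule.mem_span_singleton_self _)
      · rw [ams, map_one, pow_zero, div_one, Algebra.smul_def, mul_one]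
  | succ n ih =>
    rw [pow_succ', ← ih]
    apply le_antisymm
    · rintro _ ⟨a, ha, rfl⟩
      rw [hstd] at ha
      refine Submodule.mul_induction_on ha (fun x hx y hy => ?_) (fun x y hx hy => ?_)
      · have : algebraMap R Q (x * y) / algebraMap R Q t ^ (n + 1) = (algebraMap R Q x / algebraMap R Q t ^ 1) * (algebraMap R Q y / algebraMap R Q t ^ n) := by
          rw [map_mul]; field_simp; try ring
        rw [this]
        exact Submodule.mul_mem_mul ⟨x, hx, rfl⟩ ⟨y, hy, rfl⟩
      · rw [map_add, add_div]; exact add_mem hx hy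
    · rw [Submodule.mul_le]
      rintro _ ⟨x, hx, rfl⟩ _ ⟨y, hy, rfl⟩
      refine ⟨x * y, ?_, ?_⟩
      · rw [hstd]; exact Submodule.mul_mem_mul hx hy
      · rw [map_mul]; field_simp; try ring

lemma mem_adjoin_pow {M : Submodule k Q} (h1 : (1 : Q) ∈ M) {x : Q} (hx : x ∈ Algebra.adjoin k (M : Set Q)) : ∃ e, x ∈ M ^ e := by
  induction hx using Algebra.adjoin_induction with
  | mem x hx => exact ⟨1, by rwa [pow_one]⟩
  | algebraMap r => exact ⟨0, by rw [pow_zero, Submodule.mem_one]; exact ⟨r, rfl⟩⟩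
  | add x y _ _ hx hy =>
    obtain ⟨e, he⟩ := hx
    obtain ⟨f, hf⟩ := hy
    exact ⟨e + f, add_mem (Lpow_mono h1 (by omega) he) (Lpow_mono h1 (by omega) hf)⟩
  | mul x y _ _ hx hy =>
    obtain ⟨e, he⟩ := hx
    obtain ⟨f, hf⟩ := hy
    exact ⟨e + f, Lpow_mul he hf⟩

/-- the degree zero field -/
abbrev Kf (Q : Type*) [Field Q] [Algebra R Q] [Algebra k Q] [IsScalarTower k R Q] (t : R) : IntermediateField k Q :=
  IntermediateField.adjoin k (dh 𝒜 Q t 1 : Set Q)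

/-- the degree one part in the degree zero field -/
def Lf (Q : Type*) [Field Q] [Algebra R Q] [Algebra k Q] [IsScalarTower k R Q] (t : R) : Submodule k (Kf 𝒜 Q t) :=
  (dh 𝒜 Q t 1).comap (Kf 𝒜 Q t).val.toLinearMap

lemma Lf_map (t : R) : (Lf 𝒜 Q t).map (Kf 𝒜 Q t).val.toLinearMap = dh 𝒜 Q t 1 := by
  rw [Lf, Submodule.map_comap_eq, inf_eq_right]
  intro x hx
  exact ⟨⟨x, IntermediateField.subset_adjoin k _ hx⟩, rfl⟩

lemma Lf_pow (h0 : 𝒜 0 = Submodule.span k {1}) (hstd : ∀ n, 𝒜 (n + 1) = 𝒜 1 * 𝒜 n) {t : R} (ht0 : t ≠ 0) (m : ℕ)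
    (x : Kf 𝒜 Q t) : x ∈ Lf 𝒜 Q t ^ m ↔ ∃ a ∈ 𝒜 m, (x : Q) = algebraMap R Q a / algebraMap R Q t ^ m := by
  rw [← mem_dh, dh_pow 𝒜 h0 hstd ht0, ← Lf_map]
  rw [← Submodule.map_pow]
  constructor
  · intro h
    exact Submodule.mem_map_of_mem h
  · rintro ⟨y, hy, hyx⟩
    have : y = x := Subtype.ext hyx
    exact this ▸ hy

lemma dh_mem_K (h0 : 𝒜 0 = Submodule.span k {1}) (hstd : ∀ n, 𝒜 (n + 1) = 𝒜 1 * 𝒜 n) {t : R} (ht0 : t ≠ 0) {m : ℕ} {a : R}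
    (ha : a ∈ 𝒜 m) : algebraMap R Q a / algebraMap R Q t ^ m ∈ Kf 𝒜 Q t := by
  have h1 : algebraMap R Q a / algebraMap R Q t ^ m ∈ dh 𝒜 Q t 1 ^ m := by
    rw [← dh_pow 𝒜 h0 hstd ht0]; exact ⟨a, ha, rfl⟩
  rw [← Lf_map, ← Submodule.map_pow] at h1
  obtain ⟨y, hy, hyx⟩ := h1
  rw [← hyx]
  exact y.2

lemma one_dh {t : R} (ht0 : t ≠ 0) (ht : t ∈ 𝒜 1) : (1 : Q) ∈ dh 𝒜 Q t 1 := by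
  have hτ : algebraMap R Q t ≠ 0 := by
    rwa [Ne, map_eq_zero_iff _ (IsFractionRing.injective R Q)]
  exact ⟨t, ht, by rw [pow_one, div_self hτ]⟩

lemma one_Lf {t : R} (ht0 : t ≠ 0) (ht : t ∈ 𝒜 1) : (1 : Kf 𝒜 Q t) ∈ Lf 𝒜 Q t := one_dh 𝒜 ht0 ht

lemma Lf_fin (hfg : FiniteDimensional k (𝒜 1)) (t : R) : Module.Finite k (Lf 𝒜 Q t) := by
  have h1 : (dh 𝒜 Q t 1).FG := by
    let g : R →ₗ[k] Q := (LinearMap.mulRight k ((algebraMap R Q t)⁻¹)).comp (IsScalarTower.toAlgHom k R Q).toLinearMap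
    have : dh 𝒜 Q t 1 = (𝒜 1).map g := by
      ext x
      constructor
      · rintro ⟨a, ha, rfl⟩
        exact ⟨a, ha, by simp [g, div_eq_mul_inv]⟩
      · rintro ⟨a, ha, rfl⟩
        exact ⟨a, ha, by simp [g, div_eq_mul_inv]⟩
    rw [this]
    exact (Module.Finite.iff_fg.1 hfg).map g
  rw [← Lf_map] at h1
  refine Module.Finite.iff_fg.2 (Submodule.fg_of_fg_map_injective _ ?_ h1)
  exact Subtype.val_injective

lemma Lf_frac (h0 : 𝒜 0 = Submodule.span k {1}) (hstd : ∀ n, 𝒜 (n + 1) = 𝒜 1 * 𝒜 n) {t : R} (ht0 : t ≠ 0) (ht : t ∈ 𝒜 1)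
    (x : Kf 𝒜 Q t) : ∃ (e : ℕ) (b : Kf 𝒜 Q t), b ∈ Lf 𝒜 Q t ^ e ∧ b ≠ 0 ∧ b * x ∈ Lf 𝒜 Q t ^ e := by
  have h1 : (1 : Q) ∈ dh 𝒜 Q t 1 := one_dh 𝒜 ht0 ht
  have key : ∀ (e : ℕ) (y : Kf 𝒜 Q t), (y : Q) ∈ dh 𝒜 Q t 1 ^ e → y ∈ Lf 𝒜 Q t ^ e := by
    intro e y hy
    rw [← dh_pow 𝒜 h0 hstd ht0] at hy
    exact (Lf_pow 𝒜 h0 hstd ht0 e y).2 hy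
  obtain ⟨r, hr, s, hs, hx⟩ := IntermediateField.mem_adjoin_iff_div.1 x.2
  obtain ⟨e, he⟩ := mem_adjoin_pow h1 hr
  obtain ⟨f, hf⟩ := mem_adjoin_pow h1 hs
  by_cases hs0 : s = 0
  · refine ⟨0, 1, ?_, one_ne_zero, ?_⟩
    · exact key 0 1 (by rw [pow_zero]; exact Submodule.one_le.1 le_rfl)
    · have : x = 0 := by
        apply Subtype.ext
        rw [hx, hs0, div_zero]; rfl
      rw [this, mul_zero]; exact zero_mem _
  · have hsK : s ∈ Kf 𝒜 Q t := IntermediateField.algebra_adjoin_le_adjoin k _ hs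
    refine ⟨e + f, ⟨s, hsK⟩, key _ _ (Lpow_mono h1 (by omega) hf), fun h => hs0 (congrArg Subtype.val h), key _ _ ?_⟩
    have : ((⟨s, hsK⟩ * x : Kf 𝒜 Q t) : Q) = r := by
      change s * (x : Q) = r
      rw [hx]; field_simp
    rw [this]
    exact Lpow_mono h1 (by omega) he

open scoped IntermediateField.algebraAdjoinAdjoin in
lemma t_trans (h0 : 𝒜 0 = Submodule.span k {1}) (hstd : ∀ n, 𝒜 (n + 1) = 𝒜 1 * 𝒜 n) {t : R} (ht0 : t ≠ 0) (ht : t ∈ 𝒜 1) :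
    Transcendental (Kf 𝒜 Q t) (algebraMap R Q t) := by
  classical
  have hτ : algebraMap R Q t ≠ 0 := by
    rwa [Ne, map_eq_zero_iff _ (IsFractionRing.injective R Q)]
  have h1 : (1 : Q) ∈ dh 𝒜 Q t 1 := one_dh 𝒜 ht0 ht
  intro halg
  rw [← IsFractionRing.isAlgebraic_iff (Algebra.adjoin k (dh 𝒜 Q t 1 : Set Q)) (Kf 𝒜 Q t) Q] at halg
  obtain ⟨P, hP0, hP⟩ := halg
  have : ∀ i, ∃ e, ((P.coeff i : _) : Q) ∈ dh 𝒜 Q t 1 ^ e := fun i => mem_adjoin_pow h1 (P.coeff i).2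
  choose e he using this
  obtain ⟨E, hE⟩ : ∃ E, ∀ i ∈ Finset.range (P.natDegree + 1), e i ≤ E :=
    ⟨(Finset.range (P.natDegree + 1)).sup e, fun i hi => Finset.le_sup hi⟩
  have : ∀ i, ∃ a : R, a ∈ 𝒜 E ∧ (i ∈ Finset.range (P.natDegree + 1) → ((P.coeff i : _) : Q) = algebraMap R Q a / algebraMap R Q t ^ E) := by
    intro i
    by_cases hi : i ∈ Finset.range (P.natDegree + 1)
    · have := Lpow_mono h1 (hE i hi) (he i)
      rw [← dh_pow 𝒜 h0 hstd ht0] at this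
      obtain ⟨a, ha, h⟩ := this
      exact ⟨a, ha, fun _ => h⟩
    · exact ⟨0, zero_mem _, fun h => absurd h hi⟩
  choose a ha hac using this
  rw [Polynomial.aeval_eq_sum_range] at hP
  have hsum : ∑ i ∈ Finset.range (P.natDegree + 1), a i * t ^ i = 0 := by
    apply IsFractionRing.injective R Q
    rw [map_sum, map_zero]
    have h2 : ∑ i ∈ Finset.range (P.natDegree + 1), algebraMap R Q (a i * t ^ i)
        = algebraMap R Q t ^ E * ∑ i ∈ Finset.range (P.natDegree + 1), P.coeff i • algebraMap R Q t ^ i := by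
      rw [Finset.mul_sum]
      refine Finset.sum_congr rfl fun i hi => ?_
      rw [Algebra.smul_def]
      change _ = algebraMap R Q t ^ E * (((P.coeff i : _) : Q) * _)
      rw [hac i hi, map_mul, map_pow]
      field_simp
    rw [h2, hP, mul_zero]
  have htp : ∀ i, t ^ i ∈ 𝒜 i := by
    intro i
    have := SetLike.pow_mem_graded (A := 𝒜) i ht
    simpa using this
  apply hP0
  rw [← Polynomial.leadingCoeff_eq_zero, Polynomial.leadingCoeff]
  have hi : P.natDegree ∈ Finset.range (P.natDegree + 1) := by simp
  have h4 : a P.natDegree * t ^ P.natDegree = 0 := by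
    have h3 := congrArg (GradedRing.proj 𝒜 (E + P.natDegree)) hsum
    rw [map_sum, map_zero, Finset.sum_eq_single P.natDegree] at h3
    · rwa [GradedRing.proj_apply, DirectSum.decompose_of_mem_same _ (SetLike.mul_mem_graded (ha _) (htp _))] at h3
    · intro j _ hj
      rw [GradedRing.proj_apply, DirectSum.decompose_of_mem_ne _ (SetLike.mul_mem_graded (ha j) (htp j)) (by omega)]
    · exact fun h => absurd hi h
  have h5 : a P.natDegree = 0 := (mul_eq_zero.1 h4).resolve_right (pow_ne_zero _ ht0)
  have h6 := hac _ hi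
  rw [h5, map_zero, zero_div] at h6
  exact Subtype.ext h6

lemma t_gen (h0 : 𝒜 0 = Submodule.span k {1}) (hstd : ∀ n, 𝒜 (n + 1) = 𝒜 1 * 𝒜 n) {t : R} (ht0 : t ≠ 0) (ht : t ∈ 𝒜 1) (x : Q) :
    ∃ a b, a ∈ Algebra.adjoin (Kf 𝒜 Q t) {algebraMap R Q t} ∧ b ∈ Algebra.adjoin (Kf 𝒜 Q t) {algebraMap R Q t} ∧ x = a / b := by
  have hτ : algebraMap R Q t ≠ 0 := by
    rwa [Ne, map_eq_zero_iff _ (IsFractionRing.injective R Q)]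
  have key : ∀ r : R, algebraMap R Q r ∈ Algebra.adjoin (Kf 𝒜 Q t) {algebraMap R Q t} := by
    intro r
    refine DirectSum.Decomposition.inductionOn 𝒜 ?_ (fun {i} m => ?_)
      (fun a b ha hb => ?_) r
    · rw [map_zero]; exact zero_mem _
    · have h1 := dh_mem_K (Q := Q) 𝒜 h0 hstd ht0 m.2
      have h2 : algebraMap R Q (m : R) = algebraMap (Kf 𝒜 Q t) Q ⟨_, h1⟩ * algebraMap R Q t ^ i := by
        change _ = (algebraMap R Q m / algebraMap R Q t ^ i) * _
        field_simp
      have h3 : algebraMap R Q t ∈ Algebra.adjoin (Kf 𝒜 Q t) {algebraMap R Q t} := Algebra.self_mem_adjoin_singleton _ _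
      rw [h2]
      exact Subalgebra.mul_mem _ (Subalgebra.algebraMap_mem _ _) (Subalgebra.pow_mem _ h3 _)
    · rw [map_add]; exact add_mem ha hb
  obtain ⟨a, b, hb, rfl⟩ := IsFractionRing.div_surjective (A := R) x
  exact ⟨_, _, key a, key b, rfl⟩

/-- comparison of the two notions of generation -/
lemma gd_iff (h0 : 𝒜 0 = Submodule.span k {1}) (hstd : ∀ n, 𝒜 (n + 1) = 𝒜 1 * 𝒜 n) {t : R} (ht0 : t ≠ 0)
    {N : ℕ} (f : Fin N → R) (d : Fin N → ℕ) (hf : ∀ i, f i ∈ 𝒜 (d i)) (φ : Fin N → Kf 𝒜 Q t)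
    (hφ : ∀ i, (φ i : Q) = algebraMap R Q (f i) / algebraMap R Q t ^ d i) (p n m : ℕ) :
    gd (Lf 𝒜 Q t) p φ d n m ↔ ∀ a ∈ 𝒜 m, a ∈ Ideal.span (Set.range fun i => f i ^ (p ^ n)) := by
  have hτ : algebraMap R Q t ≠ 0 := by
    rwa [Ne, map_eq_zero_iff _ (IsFractionRing.injective R Q)]
  have hfq : ∀ i, f i ^ p ^ n ∈ 𝒜 (p ^ n * d i) := fun i => SetLike.pow_mem_graded (A := 𝒜) (p ^ n) (hf i)
  have htri : ∀ i, p ^ n * d i ≤ m → ∀ c ∈ 𝒜 (m - p ^ n * d i),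
      algebraMap R Q c / algebraMap R Q t ^ (m - p ^ n * d i) * (φ i : Q) ^ p ^ n = algebraMap R Q (c * f i ^ p ^ n) / algebraMap R Q t ^ m := by
    intro i hi c hc
    obtain ⟨j, rfl⟩ := Nat.exists_eq_add_of_le hi
    rw [Nat.add_sub_cancel_left, hφ, map_mul, map_pow, div_pow, ← pow_mul, pow_add, mul_comm (d i)]
    field_simp
  have hLz : ∀ i, p ^ n * d i ≤ m → Lz (Lf 𝒜 Q t) ((m : ℤ) - ((p ^ n : ℕ) : ℤ) * (d i : ℤ)) = Lf 𝒜 Q t ^ (m - p ^ n * d i) := by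
    intro i hi
    rw [← Lz_nat]
    congr 1
    rw [Nat.cast_sub hi]; push_cast; rfl
  have hLz' : ∀ i, ¬ p ^ n * d i ≤ m → Lz (Lf 𝒜 Q t) ((m : ℤ) - ((p ^ n : ℕ) : ℤ) * (d i : ℤ)) = ⊥ := by
    intro i hi
    rw [Lz, if_neg]
    rw [← Nat.cast_mul]
    omega
  constructor
  · intro hg a ha
    have hx : (⟨_, dh_mem_K (Q := Q) 𝒜 h0 hstd ht0 ha⟩ : Kf 𝒜 Q t) ∈ Lf 𝒜 Q t ^ m :=
      (Lf_pow 𝒜 h0 hstd ht0 m _).2 ⟨a, ha, rfl⟩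
    obtain ⟨α, hα, hsum⟩ := hg hx
    have : ∀ i, ∃ c : R, ((α i * φ i ^ p ^ n : Kf 𝒜 Q t) : Q) = algebraMap R Q (c * f i ^ p ^ n) / algebraMap R Q t ^ m := by
      intro i
      have hi := hα i
      by_cases h : p ^ n * d i ≤ m
      · rw [hLz i h] at hi
        obtain ⟨c, hc, hc'⟩ := (Lf_pow 𝒜 h0 hstd ht0 _ _).1 hi
        refine ⟨c, ?_⟩
        rw [← htri i h c hc, ← hc']
        rfl
      · rw [hLz' i h, Submodule.mem_bot] at hi
        exact ⟨0, by rw [hi]; simp⟩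
    choose c hc using this
    have h1 : algebraMap R Q a / algebraMap R Q t ^ m = ∑ i, ((α i * φ i ^ p ^ n : Kf 𝒜 Q t) : Q) := by
      have := congrArg (Kf 𝒜 Q t).val hsum
      rw [map_sum] at this
      exact this
    have h2 : a = ∑ i, c i * f i ^ p ^ n := by
      apply IsFractionRing.injective R Q
      rw [Finset.sum_congr rfl fun i _ => hc i, ← Finset.sum_div, ← map_sum] at h1
      exact (div_left_inj' (pow_ne_zero m hτ)).1 h1
    rw [h2]
    exact Ideal.sum_mem _ fun i _ => Ideal.mul_mem_left _ _ (Ideal.subset_span ⟨i, rfl⟩)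
  · intro h x hx
    obtain ⟨a, ha, hxa⟩ := (Lf_pow 𝒜 h0 hstd ht0 m x).1 hx
    obtain ⟨c, hc, hc', hac⟩ := gr_comp 𝒜 (fun i => f i ^ p ^ n) (fun i => p ^ n * d i) hfq ha (h a ha)
    have : ∀ i, ∃ α : Kf 𝒜 Q t, α ∈ Lz (Lf 𝒜 Q t) ((m : ℤ) - ((p ^ n : ℕ) : ℤ) * (d i : ℤ)) ∧
        ((α * φ i ^ p ^ n : Kf 𝒜 Q t) : Q) = algebraMap R Q (c i * f i ^ p ^ n) / algebraMap R Q t ^ m := by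
      intro i
      by_cases h : p ^ n * d i ≤ m
      · refine ⟨⟨_, dh_mem_K (Q := Q) 𝒜 h0 hstd ht0 (hc i h)⟩, ?_, ?_⟩
        · rw [hLz i h]
          exact (Lf_pow 𝒜 h0 hstd ht0 _ _).2 ⟨c i, hc i h, rfl⟩
        · exact htri i h _ (hc i h)
      · exact ⟨0, zero_mem _, by rw [hc' i h]; simp⟩
    choose α hα hα' using this
    refine ⟨α, hα, ?_⟩
    apply Subtype.ext
    have h1 : ((∑ i, α i * φ i ^ p ^ n : Kf 𝒜 Q t) : Q) = ∑ i, ((α i * φ i ^ p ^ n : Kf 𝒜 Q t) : Q) :=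
      map_sum (Kf 𝒜 Q t).val _ _
    refine Eq.trans ?_ h1.symm
    rw [Finset.sum_congr rfl fun i _ => hα' i, ← Finset.sum_div, ← map_sum, ← hac, hxa]

end dehom
end FThr
end part20


section part21
set_option linter.all false
open scoped nonZeroDivisors

namespace FThr

lemma shift_sInf {S : Set ℕ} (hS : ∀ a b, a ≤ b → a ∈ S → b ∈ S) :
    sInf {r | r + 1 ∈ S} ≤ sInf S ∧ sInf S ≤ sInf {r | r + 1 ∈ S} + 1 := by
  rcases S.eq_empty_or_nonempty with h | h
  · subst h
    simp
  · have h1 : sInf S ∈ S := Nat.sInf_mem h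
    have h2 : sInf S ∈ {r | r + 1 ∈ S} := hS _ _ (Nat.le_succ _) h1
    refine ⟨Nat.sInf_le h2, Nat.sInf_le ?_⟩
    exact Nat.sInf_mem ⟨_, h2⟩

lemma tendsto_shift {p : ℕ} (hp : 2 ≤ p) {u v : ℕ → ℕ} (h1 : ∀ n, v n ≤ u n) (h2 : ∀ n, u n ≤ v n + 1) {c : ℝ}
    (h : Tendsto (fun n => (u n : ℝ) / (p : ℝ) ^ n) atTop (nhds c)) :
    Tendsto (fun n => (v n : ℝ) / (p : ℝ) ^ n) atTop (nhds c) := by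
  have hp1 : (1 : ℝ) < p := by exact_mod_cast hp
  have hpos : ∀ n : ℕ, (0 : ℝ) < (p : ℝ) ^ n := fun n => by positivity
  have h3 : Tendsto (fun n : ℕ => (1 : ℝ) / (p : ℝ) ^ n) atTop (nhds 0) := by
    have := tendsto_pow_atTop_nhds_zero_of_lt_one (r := (p : ℝ)⁻¹) (by positivity) (inv_lt_one_of_one_lt₀ hp1)
    simpa [inv_pow] using this
  have h4 := h.sub h3
  rw [sub_zero] at h4
  refine tendsto_of_tendsto_of_tendsto_of_le_of_le h4 h (fun n => ?_) (fun n => ?_)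
  · change (u n : ℝ) / (p : ℝ) ^ n - 1 / (p : ℝ) ^ n ≤ (v n : ℝ) / (p : ℝ) ^ n
    rw [← sub_div]
    refine div_le_div_of_nonneg_right ?_ (hpos n).le
    have : (u n : ℝ) ≤ v n + 1 := by exact_mod_cast h2 n
    linarith
  · refine div_le_div_of_nonneg_right ?_ (hpos n).le
    exact (Nat.cast_le (α := ℝ)).2 (h1 n)

theorem main {p : ℕ} (hp : p.Prime)
    {k : Type*} [Field k] [CharP k p] [ExpChar k p] [PerfectRing k p]
    {R : Type*} [CommRing R] [IsDomain R] [Algebra k R]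
    (𝒜 : ℕ → Submodule k R) [GradedAlgebra 𝒜]
    (Q : Type*) [Field Q] [Algebra R Q] [IsFractionRing R Q] [Algebra k Q] [IsScalarTower k R Q]
    (htr : Algebra.trdeg k Q = 2) [Algebra.FiniteType k R]
    (h0 : 𝒜 0 = Submodule.span k {1})
    (hstd : ∀ n, 𝒜 (n + 1) = 𝒜 1 * 𝒜 n)
    (hfg : FiniteDimensional k (𝒜 1))
    (t : R) (ht : t ∈ 𝒜 1) (ht0 : t ≠ 0)
    (I : Ideal R) (hIhom : Ideal.IsHomogeneous 𝒜 I)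
    (hcolen : FiniteDimensional k (R ⧸ I)) :
    ∃ c : ℚ,
      Tendsto (fun n : ℕ => (nuF (irrelevantIdeal 𝒜) I (p ^ n) : ℝ) / (p : ℝ) ^ n)
        atTop (nhds (c : ℝ)) := by
  haveI : PerfectField k := PerfectRing.toPerfectField k p
  haveI : IsNoetherianRing R := Algebra.FiniteType.isNoetherianRing k R
  haveI : CharP R p := charP_of_injective_algebraMap (algebraMap k R).injective p
  haveI : CharP (Kf 𝒜 Q t) p := charP_of_injective_algebraMap (algebraMap k (Kf 𝒜 Q t)).injective p
  have htK : Algebra.trdeg k (Kf 𝒜 Q t) = 1 :=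
    trdeg_sub (Kf 𝒜 Q t) (algebraMap R Q t) (t_trans 𝒜 h0 hstd ht0 ht) (t_gen 𝒜 h0 hstd ht0 ht) htr
  obtain ⟨E⟩ := mkSetup' htK (Lf 𝒜 Q t) (one_Lf 𝒜 ht0 ht) (Lf_fin 𝒜 hfg t) (Lf_frac 𝒜 h0 hstd ht0 ht)
  obtain ⟨N, f, d, hf, hI⟩ := hom_gens 𝒜 I hIhom
  let φ : Fin N → Kf 𝒜 Q t := fun i => ⟨_, dh_mem_K (Q := Q) 𝒜 h0 hstd ht0 (hf i)⟩
  have hφ : ∀ i, (φ i : Q) = algebraMap R Q (f i) / algebraMap R Q t ^ d i := fun i => rfl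
  have hφL : ∀ i, φ i ∈ Lf 𝒜 Q t ^ d i := fun i => (Lf_pow 𝒜 h0 hstd ht0 _ _).2 ⟨f i, hf i, rfl⟩
  have hgd : ∀ n m, gd (Lf 𝒜 Q t) p φ d n m ↔ irrelevantIdeal 𝒜 ^ m ≤ I.frobPow (p ^ n) := by
    intro n m
    rw [gd_iff 𝒜 h0 hstd ht0 f d hf φ hφ, irr_pow_le_iff 𝒜 hstd, hI, frob_gen hp]
  have hne : ∃ m, gd (Lf 𝒜 Q t) p φ d 0 m := by
    obtain ⟨m, hm⟩ := gr_eventually 𝒜 I hIhom hcolen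
    refine ⟨m, (gd_iff 𝒜 h0 hstd ht0 f d hf φ hφ p 0 m).2 ?_⟩
    simp only [pow_zero, pow_one]
    rw [← hI]
    exact hm
  obtain ⟨c, hc⟩ := E.rational hp φ d hφL hne
  refine ⟨c, tendsto_shift hp.two_le (fun n => ?_) (fun n => ?_) hc⟩
  · have := (shift_sInf (S := {m | gd (Lf 𝒜 Q t) p φ d n m}) (fun a b h ha => gd_mono h ha)).1
    simpa only [nuF, Set.mem_setOf_eq, hgd] using this
  · have := (shift_sInf (S := {m | gd (Lf 𝒜 Q t) p φ d n m}) (fun a b h ha => gd_mono h ha)).2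
    simpa only [nuF, Set.mem_setOf_eq, hgd] using this

lemma exists_t {k R : Type*} [Field k] [CommRing R] [IsDomain R] [Algebra k R]
    (𝒜 : ℕ → Submodule k R) [GradedAlgebra 𝒜] (h0 : 𝒜 0 = Submodule.span k {1})
    (hstd : ∀ n, 𝒜 (n + 1) = 𝒜 1 * 𝒜 n) (htr : Algebra.trdeg k R = 2) : ∃ t ∈ 𝒜 1, t ≠ 0 := by
  by_contra hcon
  push Not at hcon
  have h1 : Algebra.adjoin k (𝒜 1 : Set R) ≤ ⊥ := by
    rw [Algebra.adjoin_le_iff]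
    intro x hx
    rw [hcon x hx]
    exact Subalgebra.zero_mem _
  rw [gr_adjoin 𝒜 h0 hstd] at h1
  haveI : Algebra.IsAlgebraic k R := ⟨fun x => by
    obtain ⟨c, rfl⟩ := Algebra.mem_bot.1 (h1 (Algebra.mem_top (x := x)))
    exact isAlgebraic_algebraMap c⟩
  rw [trdeg_eq_zero (R := k)] at htr
  norm_num at htr

end FThr
end part21


/-- **Theorem (Statement 0).** Let `(R, I)` be a standard graded pair over a perfect field `k`
of characteristic `p > 0`, with `R` a two-dimensional domain.  Then the `F`-threshold
`c^I(𝔪)` exists and is a rational number. -/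
theorem fThreshold_exists_and_rational
    (p : ℕ) (hp : p.Prime)
    (k : Type*) [Field k] [CharP k p] [ExpChar k p] [PerfectRing k p]
    (R : Type*) [CommRing R] [IsDomain R] [Algebra k R]
    (𝒜 : ℕ → Submodule k R) [GradedAlgebra 𝒜]
    -- `R₀ = k·1`
    (h0 : 𝒜 0 = Submodule.span k {1})
    -- `R` is generated over `k` in degree one
    (hstd : ∀ n, 𝒜 (n + 1) = 𝒜 1 * 𝒜 n)
    -- by finitely many degree-one elements (so `R` is Noetherian standard graded)
    (hfg : FiniteDimensional k (𝒜 1))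
    -- `R` is two-dimensional
    (hdim : ringKrullDim R = 2)
    -- `I` is a homogeneous ideal with `ℓ(R/I) < ∞`
    (I : Ideal R) (hIhom : Ideal.IsHomogeneous 𝒜 I)
    (hcolen : FiniteDimensional k (R ⧸ I)) :
    ∃ c : ℚ,
      Tendsto (fun n : ℕ => (nuF (irrelevantIdeal 𝒜) I (p ^ n) : ℝ) / (p : ℝ) ^ n)
        atTop (𝓝 (c : ℝ)) := by
  haveI : Algebra.FiniteType k R := FThr.gr_finiteType 𝒜 h0 hstd hfg
  have htr : Algebra.trdeg k R = 2 := by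
    have := FThr.trdeg_of_dim (k := k) (R := R) 2 hdim
    rw [this]; norm_num
  obtain ⟨t, ht, ht0⟩ := FThr.exists_t 𝒜 h0 hstd htr
  exact FThr.main hp 𝒜 (FractionRing R) (FThr.trdeg_frac hdim) h0 hstd hfg t ht ht0 I hIhom hcolen
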